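/- Let (W, S) be any Coxeter system and φ a special matching of a Bruhat order ideal of W, and let x, y be in the domain with x ⋖ φ(x) and y ⋖ φ(y). Then the R-polynomials satisfy R_{φ(x),φ(y)} = R_{x,y} and R_{x,φ(y)} = (q−1)R_{x,y} + qR_{φ(x),y}. -/

import Mathlib

open CoxeterSystem Polynomial

section CoxPre

variable {B : Type*} {W : Type*} [Group W] {M : CoxeterMatrix B}

/-- The alternating word of length `n` starting with the letter `i`
(and then alternating between `i` and `j`). -/
def altW (i j : B) : ℕ → List B
  | 0 => []
  | n + 1 => i :: altW j i n

variable (cs : CoxeterSystem M W)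

/-- The Bruhat order on a Coxeter group: the reflexive-transitive closure of the
relation `u → u * t` (`t` a reflection) when the length goes up. -/
def bruhatLE : W → W → Prop :=
  Relation.ReflTransGen
    (fun u v => ∃ t, cs.IsReflection t ∧ v = u * t ∧ cs.length u < cs.length v)

/-- The covering relation of the Bruhat order. -/
def bCov (u v : W) : Prop :=
  bruhatLE cs u v ∧ u ≠ v ∧ ∀ z, bruhatLE cs u z → bruhatLE cs z v → z = u ∨ z = v

/-- The set of coatoms of `v` in the Bruhat order. -/
def bCoat (v : W) : Set W := {x | bCov cs x v}

/-- A partial special matching of `W` equipped with the Bruhat order: a Bruhat order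
ideal `dom` together with an involution of it such that `u ⋖ φ u` or `φ u ⋖ u` for all
`u ∈ dom`, satisfying the coatom condition. -/
structure BSM where
  dom : Set W
  toFun : W → W
  ideal : ∀ ⦃x y : W⦄, y ∈ dom → bruhatLE cs x y → x ∈ dom
  maps : ∀ x ∈ dom, toFun x ∈ dom
  invol : ∀ x ∈ dom, toFun (toFun x) = x
  cov : ∀ x ∈ dom, bCov cs (toFun x) x ∨ bCov cs x (toFun x)
  coatom : ∀ u ∈ dom, bCov cs u (toFun u) →
    bCoat cs (toFun u) =
      {u} ∪ {w | ∃ v, bCov cs v u ∧ bCov cs v (toFun v) ∧ w = toFun v}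

/-- The standard dihedral subgroup `⟨s,t⟩` of `W`, as a set. -/
def dihedral (s t : B) : Set W :=
  (Subgroup.closure {cs.simple s, cs.simple t} : Subgroup W)

/-- `w` is full with respect to `J ⊆ S`: for all distinct `i, j ∈ J`, `m i j < ∞` and the
longest element of `⟨i,j⟩` is `≤ w` in Bruhat order. -/
def IsFullWrt (J : Set B) (w : W) : Prop :=
  ∀ i ∈ J, ∀ j ∈ J, i ≠ j →
    M i j ≠ 0 ∧ bruhatLE cs (cs.wordProd (altW i j (M i j))) w

/-- The standard axioms characterizing the `R`-polynomials of the Hecke algebra of `W`. -/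
def RAxioms (R : W → W → Polynomial ℤ) : Prop :=
  (∀ u, R u u = 1) ∧
  (∀ u v, ¬ bruhatLE cs u v → R u v = 0) ∧
  (∀ (i : B) (x y : W),
      cs.length (cs.simple i * x) = cs.length x + 1 →
      cs.length (cs.simple i * y) = cs.length y + 1 →
      R (cs.simple i * x) (cs.simple i * y) = R x y ∧
      R x (cs.simple i * y) = (X - 1) * R x y + X * R (cs.simple i * x) y) ∧
  (∀ (i : B) (x y : W),
      cs.length (x * cs.simple i) = cs.length x + 1 →
      cs.length (y * cs.simple i) = cs.length y + 1 →
      R (x * cs.simple i) (y * cs.simple i) = R x y ∧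
      R x (y * cs.simple i) = (X - 1) * R x y + X * R (x * cs.simple i) y)

variable {cs}

/-- `ψ` extends the partial special matching `φ`. -/
def BExtends (ψ φ : BSM cs) : Prop :=
  φ.dom ⊆ ψ.dom ∧ ∀ x ∈ φ.dom, ψ.toFun x = φ.toFun x

/-- `φ` is a maximal partial special matching. -/
def BMax (φ : BSM cs) : Prop := ∀ ψ : BSM cs, BExtends ψ φ → ψ.dom = φ.dom

/-- `φ` is `g`-regular on the left: its domain is stable under left multiplication by `g`
and `φ` commutes with left multiplication by `g`. -/
def LeftReg (φ : BSM cs) (g : W) : Prop :=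
  (∀ x ∈ φ.dom, g * x ∈ φ.dom) ∧ ∀ x ∈ φ.dom, φ.toFun (g * x) = g * φ.toFun x

/-- `φ` is `g`-regular on the right. -/
def RightReg (φ : BSM cs) (g : W) : Prop :=
  (∀ x ∈ φ.dom, x * g ∈ φ.dom) ∧ ∀ x ∈ φ.dom, φ.toFun (x * g) = φ.toFun x * g

end CoxPre

namespace SpecialMatching

section StrongExchange

variable {B : Type*} {W : Type*} [Group W] {M : CoxeterMatrix B} (cs : CoxeterSystem M W)

open Classical in
/-- The action of a generator on pairs (element, parity) used for the strong exchange property. -/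
noncomputable def flip (i : B) : Function.End (W × ZMod 2) :=
  fun p => (cs.simple i * p.1 * cs.simple i, p.2 + if p.1 = cs.simple i then 1 else 0)

open Classical in
theorem flip_prod (ω : List B) (t : W) (e : ZMod 2) :
    ((ω.map (flip cs)).prod : Function.End (W × ZMod 2)) (t, e) =
      (cs.wordProd ω * t * (cs.wordProd ω)⁻¹, e + ((cs.rightInvSeq ω).count t : ℕ)) := by
  induction ω with
  | nil => simp [Function.End.one_def]
  | cons i ω ih =>
    rw [List.map_cons, List.prod_cons]
    change flip cs i (((ω.map (flip cs)).prod : Function.End (W × ZMod 2)) (t, e)) = _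
    rw [ih, flip, rightInvSeq, List.count_cons, cs.wordProd_cons]
    have h : (cs.wordProd ω * t * (cs.wordProd ω)⁻¹ = cs.simple i) ↔
        ((cs.wordProd ω)⁻¹ * cs.simple i * cs.wordProd ω = t) := by
      constructor
      · intro h; rw [← h]; group
      · intro h; rw [← h]; group
    ext
    · simp [mul_assoc]
    · by_cases hh : (cs.wordProd ω)⁻¹ * cs.simple i * cs.wordProd ω = t
      · simp [h.2 hh, hh, add_assoc]
      · simp [h, hh]

theorem even_count_rightInvSeq (i j : B) (t : W) [DecidableEq W] :
    Even ((cs.rightInvSeq (alternatingWord i j (2 * M i j))).count t) := by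
  have hrev : (cs.rightInvSeq (alternatingWord i j (2 * M i j))).count t =
      (cs.leftInvSeq (alternatingWord i j (2 * M i j)).reverse).count t := by
    rw [cs.leftInvSeq_reverse, List.count_reverse]
  have halt : ∀ (m : ℕ) (i j : B), (alternatingWord i j (2 * m)).reverse =
      alternatingWord j i (2 * m) := by
    intro m i j
    apply List.ext_getElem (by simp)
    intro n h1 h2
    simp only [List.length_reverse, length_alternatingWord] at h1
    rw [List.getElem_reverse, getElem_alternatingWord _ _ _ _ h1,
      getElem_alternatingWord _ _ _ _ (by simp; omega)]
    have hp : Even (2 * m + (alternatingWord i j (2 * m)).length - 1 - n) ↔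
        ¬ Even (2 * m + n) := by
      simp only [length_alternatingWord, Nat.even_iff]; omega
    have hp' : 2 * m + ((alternatingWord i j (2 * m)).length - 1 - n) =
        2 * m + (alternatingWord i j (2 * m)).length - 1 - n := by
      simp only [length_alternatingWord]; omega
    rw [hp']
    rw [if_congr hp rfl rfl]
    by_cases h : Even (2 * m + n) <;> simp only [h, not_true, not_false_iff, if_true, if_false]
  rw [hrev, halt]
  set L := cs.leftInvSeq (alternatingWord j i (2 * M i j)) with hL
  have hlen : L.length = 2 * M i j := by simp [hL]
  have hhalf : L.take (M i j) = L.drop (M i j) := by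
    apply List.ext_getElem (by simp [hlen]; omega)
    intro n h1 h2
    simp only [List.length_take, hlen] at h1
    rw [List.getElem_take, List.getElem_drop]
    have hget : ∀ (k : ℕ) (hk : k < L.length), L[k] =
        cs.wordProd (alternatingWord i j (2 * k + 1)) := fun k hk =>
      cs.getElem_leftInvSeq_alternatingWord (i := j) (j := i) (p := M i j) (k := k) (by omega)
    rw [hget, hget]
    rw [cs.prod_alternatingWord_eq_mul_pow, cs.prod_alternatingWord_eq_mul_pow]
    have e1 : (2 * n + 1) / 2 = n := by omega
    have e2 : (2 * (M i j + n) + 1) / 2 = M i j + n := by omega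
    have o1 : ¬ Even (2 * n + 1) := by simp
    have o2 : ¬ Even (2 * (M i j + n) + 1) := by simp
    rw [e1, e2, if_neg o1, if_neg o2, pow_add]
    simp
  rw [← List.take_append_drop (M i j) L, List.count_append, hhalf]
  exact ⟨_, rfl⟩

theorem flip_liftable : M.IsLiftable (flip cs) := by
  classical
  intro i j
  have key : (flip cs i * flip cs j) ^ M i j =
      ((alternatingWord i j (2 * M i j)).map (flip cs)).prod := by
    have : ∀ m : ℕ, (flip cs i * flip cs j) ^ m =
      ((alternatingWord i j (2 * m)).map (flip cs)).prod := by
      intro m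
      induction m with
      | zero => simp [alternatingWord]
      | succ m ih =>
        rw [show 2 * (m + 1) = (2 * m + 1) + 1 by ring, alternatingWord_succ',
          alternatingWord_succ']
        rw [pow_succ', ih]
        simp [mul_assoc]
    exact this _
  rw [key]
  funext p
  obtain ⟨t, e⟩ := p
  rw [flip_prod]
  have h1 : cs.wordProd (alternatingWord i j (2 * M i j)) = 1 := by
    rw [cs.prod_alternatingWord_eq_mul_pow]; simp
  have h2 : (((cs.rightInvSeq (alternatingWord i j (2 * M i j))).count t : ℕ) : ZMod 2) = 0 := by
    rw [ZMod.natCast_eq_zero_iff_even]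
    exact even_count_rightInvSeq cs i j t
  rw [h1, h2]
  simp [Function.End.one_def]

open Classical in
theorem count_parity_congr {ω ω' : List B} (h : cs.wordProd ω = cs.wordProd ω') (t : W) :
    (((cs.rightInvSeq ω).count t : ℕ) : ZMod 2) = ((cs.rightInvSeq ω').count t : ℕ) := by
  let η := cs.lift ⟨flip cs, flip_liftable cs⟩
  have hη : ∀ ω : List B, η (cs.wordProd ω) = (ω.map (flip cs)).prod := by
    intro ω
    induction ω with
    | nil => simp
    | cons i ω ih =>
      rw [cs.wordProd_cons, map_mul, ih, List.map_cons, List.prod_cons]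
      congr 1
      exact cs.lift_apply_simple (flip_liftable cs) i
  have h1 := congrFun (hη ω) (t, 0)
  have h2 := congrFun (hη ω') (t, 0)
  rw [h, h2, flip_prod, flip_prod] at h1
  simpa using (congrArg Prod.snd h1).symm

open Classical in
theorem count_refl_parity {t : W} (ht : cs.IsReflection t) {ω : List B}
    (hω : cs.wordProd ω = t) : (((cs.rightInvSeq ω).count t : ℕ) : ZMod 2) = 1 := by
  obtain ⟨v, i, rfl⟩ := ht
  obtain ⟨α, -, rfl⟩ := cs.exists_isReduced v
  have hw : cs.wordProd (α ++ [i] ++ α.reverse) =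
      cs.wordProd α * cs.simple i * (cs.wordProd α)⁻¹ := by
    simp [cs.wordProd_append, cs.wordProd_cons, mul_assoc]
  rw [count_parity_congr cs (hω.trans hw.symm)]
  have h1 := flip_prod cs (α ++ [i] ++ α.reverse)
    (cs.wordProd α * cs.simple i * (cs.wordProd α)⁻¹) 0
  have h2 := flip_prod cs (α ++ α.reverse)
    (cs.wordProd α * cs.simple i * (cs.wordProd α)⁻¹) 0
  have h0 : (((cs.rightInvSeq (α ++ α.reverse)).count
      (cs.wordProd α * cs.simple i * (cs.wordProd α)⁻¹) : ℕ) : ZMod 2) = 0 := by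
    rw [count_parity_congr cs (ω' := []) (by simp [cs.wordProd_append])]; simp
  rw [h0] at h2
  simp only [List.map_append, List.prod_append, List.map_cons, List.map_nil, List.prod_singleton]
    at h1 h2
  have hz : ((α.reverse.map (flip cs)).prod : Function.End (W × ZMod 2))
      (cs.wordProd α * cs.simple i * (cs.wordProd α)⁻¹, 0) = (cs.simple i,
        (((cs.rightInvSeq α.reverse).count
          (cs.wordProd α * cs.simple i * (cs.wordProd α)⁻¹) : ℕ) : ZMod 2)) := by
    rw [flip_prod]; ext
    · simp [mul_assoc]
    · simp
  set c : ZMod 2 := (((cs.rightInvSeq α.reverse).count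
          (cs.wordProd α * cs.simple i * (cs.wordProd α)⁻¹) : ℕ) : ZMod 2)
  have e2 := congrArg Prod.snd h2
  have e1 := congrArg Prod.snd h1
  change (((α.map (flip cs)).prod : Function.End (W × ZMod 2))
    (((α.reverse.map (flip cs)).prod : Function.End (W × ZMod 2)) _)).2 = _ at e2
  change (((α.map (flip cs)).prod : Function.End (W × ZMod 2))
    (flip cs i (((α.reverse.map (flip cs)).prod : Function.End (W × ZMod 2)) _))).2 = _ at e1
  rw [hz, flip_prod] at e2
  rw [hz, flip, flip_prod] at e1
  simp only [simple_mul_simple_self, one_mul, if_true, zero_add] at e1 e2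
  rw [List.append_assoc] at e1 ⊢
  simp only [List.singleton_append] at e1 ⊢
  rw [← e1, add_right_comm, e2, zero_add]

/-- Strong exchange property. -/
theorem strong_exchange {ω : List B} {t : W} (ht : cs.IsReflection t)
    (hlt : cs.length (cs.wordProd ω * t) < cs.length (cs.wordProd ω)) :
    ∃ j < ω.length, cs.wordProd ω * t = cs.wordProd (ω.eraseIdx j) := by
  classical
  by_cases hmem : t ∈ cs.rightInvSeq ω
  · obtain ⟨j, hj, rfl⟩ := List.getElem_of_mem hmem
    refine ⟨j, by simpa using hj, ?_⟩
    rw [← cs.wordProd_mul_getD_rightInvSeq, List.getD_eq_getElem _ _ hj]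
  · exfalso
    obtain ⟨α, hα, hαe⟩ := cs.exists_isReduced (cs.wordProd ω * t)
    obtain ⟨τ, -, hτ⟩ := cs.exists_isReduced t
    have h1 := flip_prod cs (ω ++ τ) t 0
    rw [List.map_append, List.prod_append] at h1
    change ((ω.map (flip cs)).prod : Function.End (W × ZMod 2))
      (((τ.map (flip cs)).prod : Function.End (W × ZMod 2)) _) = _ at h1
    rw [flip_prod, flip_prod] at h1
    have h2 := congrArg Prod.snd h1
    simp only at h2
    rw [count_refl_parity cs ht hτ.symm, ← hτ,
      count_parity_congr cs (ω := ω ++ τ) (ω' := α) (by rw [cs.wordProd_append, ← hτ, hαe])] at h2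
    have h3 : t * t * t⁻¹ = t := by group
    rw [h3, List.count_eq_zero_of_not_mem hmem] at h2
    have h4 : t ∈ cs.rightInvSeq α := by
      by_contra hc
      rw [List.count_eq_zero_of_not_mem hc] at h2
      simp at h2
    have h5 := (cs.isRightInversion_of_mem_rightInvSeq hα h4).2
    rw [← hαe, mul_assoc, ht.mul_self, mul_one] at h5
    omega

end StrongExchange

variable {B : Type*} {W : Type*} [Group W] {M : CoxeterMatrix B} {cs : CoxeterSystem M W}

section BruhatBasics

/-- `a` is a simple generator. -/
def Gen (cs : CoxeterSystem M W) (a : W) : Prop := ∃ i, a = cs.simple i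

local notation "ℓ" => CoxeterSystem.length cs
local infix:50 " ≼ " => bruhatLE cs

variable {a b u v w x y z : W}

theorem Gen.mul_self (ha : Gen cs a) : a * a = 1 := by
  obtain ⟨i, rfl⟩ := ha; simp

theorem Gen.inv (ha : Gen cs a) : a⁻¹ = a := by
  obtain ⟨i, rfl⟩ := ha; simp

theorem Gen.cancel_right (ha : Gen cs a) (w : W) : w * a * a = w := by
  rw [mul_assoc, ha.mul_self, mul_one]

theorem Gen.cancel_left (ha : Gen cs a) (w : W) : a * (a * w) = w := by
  rw [← mul_assoc, ha.mul_self, one_mul]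

theorem Gen.length (ha : Gen cs a) : ℓ a = 1 := by
  obtain ⟨i, rfl⟩ := ha; simp

theorem Gen.ne_one (ha : Gen cs a) : a ≠ 1 := by
  rintro rfl; have := ha.length; simp at this

theorem Gen.isReflection (ha : Gen cs a) : cs.IsReflection a := by
  obtain ⟨i, rfl⟩ := ha; exact cs.isReflection_simple i

theorem Gen.length_mul (ha : Gen cs a) (w : W) : ℓ (w * a) = ℓ w + 1 ∨ ℓ (w * a) + 1 = ℓ w := by
  obtain ⟨i, rfl⟩ := ha; exact cs.length_mul_simple w i

theorem Gen.mul_length (ha : Gen cs a) (w : W) : ℓ (a * w) = ℓ w + 1 ∨ ℓ (a * w) + 1 = ℓ w := by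
  obtain ⟨i, rfl⟩ := ha; exact cs.length_simple_mul w i

theorem Gen.length_inv_mul (ha : Gen cs a) (w : W) : ℓ (w⁻¹ * a) = ℓ (a * w) := by
  rw [← cs.length_inv (a * w), mul_inv_rev, ha.inv]

theorem Gen.length_mul_inv (ha : Gen cs a) (w : W) : ℓ (a * w⁻¹) = ℓ (w * a) := by
  rw [← cs.length_inv (w * a), mul_inv_rev, ha.inv]

theorem exists_gen_mul_lt (hw : w ≠ 1) : ∃ a, Gen cs a ∧ ℓ (a * w) + 1 = ℓ w := by
  obtain ⟨i, hi⟩ := cs.exists_leftDescent_of_ne_one hw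
  exact ⟨_, ⟨i, rfl⟩, cs.isLeftDescent_iff.1 hi⟩

theorem exists_mul_gen_lt (hw : w ≠ 1) : ∃ a, Gen cs a ∧ ℓ (w * a) + 1 = ℓ w := by
  obtain ⟨i, hi⟩ := cs.exists_rightDescent_of_ne_one hw
  exact ⟨_, ⟨i, rfl⟩, cs.isRightDescent_iff.1 hi⟩

variable (cs) in
@[elab_as_elim]
theorem right_induction {P : W → Prop} (one : P 1)
    (mul : ∀ w a, Gen cs a → ℓ (w * a) = ℓ w + 1 → P w → P (w * a)) (w : W) : P w := by
  induction h : ℓ w using Nat.strong_induction_on generalizing w with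
  | _ n ih =>
    by_cases hw : w = 1
    · rwa [hw]
    · obtain ⟨a, ha, hl⟩ := exists_mul_gen_lt (cs := cs) hw
      rw [← ha.cancel_right w]
      refine mul _ _ ha ?_ (ih _ (by omega) _ rfl)
      rw [ha.cancel_right]; exact hl.symm

variable (cs) in
@[elab_as_elim]
theorem left_induction {P : W → Prop} (one : P 1)
    (mul : ∀ w a, Gen cs a → ℓ (a * w) = ℓ w + 1 → P w → P (a * w)) (w : W) : P w := by
  have := right_induction cs (P := fun w => P w⁻¹) (by simpa) (fun w a ha hl h => by
    simp only [mul_inv_rev, ha.inv]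
    refine mul _ _ ha ?_ h
    rw [ha.length_mul_inv, cs.length_inv, hl]) w⁻¹
  simpa using this

theorem ble_refl (u : W) : u ≼ u := Relation.ReflTransGen.refl

theorem ble_trans (h : u ≼ v) (h' : v ≼ w) : u ≼ w := Relation.ReflTransGen.trans h h'

/-- The relation generating the Bruhat order. -/
def Edge (cs : CoxeterSystem M W) (u v : W) : Prop :=
  ∃ t, cs.IsReflection t ∧ v = u * t ∧ cs.length u < cs.length v

theorem Edge.ble (h : Edge cs u v) : u ≼ v := Relation.ReflTransGen.single h

theorem ble_length (h : u ≼ v) : u = v ∨ ℓ u < ℓ v := by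
  induction h with
  | refl => exact Or.inl rfl
  | tail _ h ih => obtain ⟨t, _, _, hl⟩ := h; right; rcases ih with rfl | ih <;> omega

theorem ble_length_le (h : u ≼ v) : ℓ u ≤ ℓ v := by
  rcases ble_length h with rfl | h <;> omega

theorem ble_eq (h : u ≼ v) (hl : ℓ v ≤ ℓ u) : u = v := by
  rcases ble_length h with rfl | h
  · rfl
  · omega

theorem ble_antisymm (h : u ≼ v) (h' : v ≼ u) : u = v := ble_eq h (ble_length_le h')

theorem ble_mul_gen (ha : Gen cs a) (h : ℓ u < ℓ (u * a)) : u ≼ u * a :=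
  Edge.ble ⟨a, ha.isReflection, rfl, h⟩

theorem mul_gen_ble (ha : Gen cs a) (h : ℓ (u * a) < ℓ u) : u * a ≼ u :=
  Edge.ble ⟨a, ha.isReflection, (ha.cancel_right u).symm, h⟩

theorem Edge.inv (h : Edge cs u v) : Edge cs u⁻¹ v⁻¹ := by
  obtain ⟨t, ht, rfl, hl⟩ := h
  refine ⟨u * t * u⁻¹, ht.conj u, ?_, by rwa [cs.length_inv, cs.length_inv]⟩
  rw [mul_inv_rev, ht.inv]; group

theorem ble_inv (h : u ≼ v) : u⁻¹ ≼ v⁻¹ := by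
  induction h with
  | refl => exact ble_refl _
  | tail _ h ih => exact ble_trans ih (Edge.inv h).ble

theorem ble_inv_iff : u⁻¹ ≼ v⁻¹ ↔ u ≼ v :=
  ⟨fun h => by simpa using ble_inv h, ble_inv⟩

theorem ble_inv_left (ha : Gen cs a) (h : a ≼ u⁻¹) : a ≼ u := by
  rw [← ble_inv_iff, ha.inv]; exact h

theorem Edge.mul_gen (h : Edge cs u v) (ha : Gen cs a) : v = u * a ∨ Edge cs (u * a) (v * a) := by
  obtain ⟨t, ht, rfl, hl⟩ := h
  by_cases hta : t = a
  · left; rw [hta]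
  right
  refine ⟨a * t * a, by simpa [ha.inv] using ht.conj a, ?_, ?_⟩
  · simp only [mul_assoc]; rw [ha.cancel_left]
  by_contra hcon
  have hre : cs.IsReflection (a * t * a) := by simpa [ha.inv] using ht.conj a
  have e1 : u * a * (a * t * a) = u * t * a := by
    simp only [mul_assoc]; rw [ha.cancel_left]
  have hne := hre.length_mul_left_ne (u * a)
  rw [e1] at hne
  obtain ⟨ω, hω, rfl⟩ := cs.exists_isReduced u
  obtain ⟨i, rfl⟩ := ha
  have hw : cs.wordProd (ω ++ [i]) = cs.wordProd ω * cs.simple i := by simp [cs.wordProd_append]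
  have := strong_exchange cs (ω := ω ++ [i]) hre (by rw [hw, e1]; omega)
  obtain ⟨j, hj, he⟩ := this
  rw [hw, e1] at he
  have h1 := cs.length_mul_simple (cs.wordProd ω) i
  have h2 := cs.length_mul_simple (cs.wordProd ω * t) i
  by_cases hjl : j < ω.length
  · rw [List.eraseIdx_append_of_lt_length hjl, cs.wordProd_append, cs.wordProd_singleton] at he
    have he' := mul_right_cancel he
    have := cs.length_wordProd_le (ω.eraseIdx j)
    rw [List.length_eraseIdx_of_lt hjl] at this
    have h3 : ℓ (cs.wordProd ω) = ω.length := hω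
    rw [← he'] at this
    omega
  · simp at hj
    have hjl' : j = ω.length := by omega
    subst hjl'
    rw [List.eraseIdx_append_of_length_le (le_refl _)] at he
    simp at he
    rw [mul_assoc] at he
    have : t * cs.simple i = 1 := by simpa using he
    apply hta
    rw [mul_eq_one_iff_eq_inv] at this
    rw [this, cs.inv_simple]

theorem mul_gen_ble_or (h : u ≼ v) (ha : Gen cs a) : u * a ≼ v ∨ u * a ≼ v * a := by
  induction h using Relation.ReflTransGen.head_induction_on with
  | refl => right; exact ble_refl _
  | @head c d h h' ih =>
    rcases Edge.mul_gen h ha with rfl | h2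
    · left; exact h'
    · rcases ih with ih | ih
      · left; exact ble_trans h2.ble ih
      · right; exact ble_trans h2.ble ih

theorem ble_mul_gen_or (h : u ≼ v) (ha : Gen cs a) : u ≼ v * a ∨ u * a ≼ v * a := by
  induction h with
  | refl => right; exact ble_refl _
  | @tail c d h h' ih =>
    rcases Edge.mul_gen h' ha with rfl | h2
    · left; rwa [ha.cancel_right]
    · rcases ih with ih | ih
      · left; exact ble_trans ih h2.ble
      · right; exact ble_trans ih h2.ble

theorem lift_up_left (h : u ≼ v) (ha : Gen cs a) (hv : ℓ (v * a) < ℓ v) : u * a ≼ v := by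
  rcases mul_gen_ble_or h ha with h | h
  · exact h
  · exact ble_trans h (mul_gen_ble ha hv)

theorem lift_down_right (h : u ≼ v) (ha : Gen cs a) (hu : ℓ u < ℓ (u * a)) : u ≼ v * a := by
  rcases ble_mul_gen_or h ha with h | h
  · exact h
  · exact ble_trans (ble_mul_gen ha hu) h

theorem lift_down_down (h : u ≼ v) (ha : Gen cs a) (hu : ℓ (u * a) < ℓ u) : u * a ≼ v * a := by
  rcases ble_mul_gen_or h ha with h | h
  · exact ble_trans (mul_gen_ble ha hu) h
  · exact h

theorem lift_up_up (h : u ≼ v) (ha : Gen cs a) (hv : ℓ v < ℓ (v * a)) : u * a ≼ v * a := by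
  rcases mul_gen_ble_or h ha with h | h
  · exact ble_trans h (ble_mul_gen ha hv)
  · exact h

theorem ble_gen_mul (ha : Gen cs a) (h : ℓ u < ℓ (a * u)) : u ≼ a * u := by
  have := ble_mul_gen (u := u⁻¹) ha (by rw [ha.length_inv_mul, cs.length_inv]; exact h)
  simpa [ha.inv] using ble_inv this

theorem gen_mul_ble (ha : Gen cs a) (h : ℓ (a * u) < ℓ u) : a * u ≼ u := by
  have := ble_gen_mul (u := a * u) ha (by rwa [ha.cancel_left])
  rwa [ha.cancel_left] at this

theorem llift_up_left (h : u ≼ v) (ha : Gen cs a) (hv : ℓ (a * v) < ℓ v) : a * u ≼ v := by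
  have := lift_up_left (ble_inv h) ha (by rw [ha.length_inv_mul, cs.length_inv]; exact hv)
  simpa [ha.inv] using ble_inv this

theorem llift_down_right (h : u ≼ v) (ha : Gen cs a) (hu : ℓ u < ℓ (a * u)) : u ≼ a * v := by
  have := lift_down_right (ble_inv h) ha (by rw [ha.length_inv_mul, cs.length_inv]; exact hu)
  simpa [ha.inv] using ble_inv this

theorem llift_down_down (h : u ≼ v) (ha : Gen cs a) (hu : ℓ (a * u) < ℓ u) : a * u ≼ a * v := by
  have := lift_down_down (ble_inv h) ha (by rw [ha.length_inv_mul, cs.length_inv]; exact hu)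
  simpa [ha.inv] using ble_inv this

theorem llift_up_up (h : u ≼ v) (ha : Gen cs a) (hv : ℓ v < ℓ (a * v)) : a * u ≼ a * v := by
  have := lift_up_up (ble_inv h) ha (by rw [ha.length_inv_mul, cs.length_inv]; exact hv)
  simpa [ha.inv] using ble_inv this

theorem one_ble (w : W) : 1 ≼ w := by
  refine right_induction cs (ble_refl 1) (fun w a ha hl h => ?_) w
  exact ble_trans h (ble_mul_gen ha (by omega))

/-- The covering relation in terms of length. -/
def Cov (cs : CoxeterSystem M W) (u v : W) : Prop := bruhatLE cs u v ∧ cs.length v = cs.length u + 1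

theorem exists_coatom (h : u ≼ v) (hne : u ≠ v) : ∃ z, u ≼ z ∧ Cov cs z v := by
  induction v using right_induction cs generalizing u with
  | one => exact absurd (ble_eq h (by simp)) hne
  | mul v a ha hl ih =>
    by_cases hu : ℓ u < ℓ (u * a)
    · have := lift_down_right h ha hu
      rw [ha.cancel_right] at this
      exact ⟨v, this, ble_mul_gen ha (by omega), hl⟩
    · have hu' := ha.length_mul u
      have h1 := lift_down_down h ha (by omega)
      rw [ha.cancel_right] at h1
      obtain ⟨z, hz, hzv⟩ := ih h1 (by rintro rfl; exact hne (ha.cancel_right u).symm)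
      have hz' := ha.length_mul z
      by_cases hzz : ℓ z < ℓ (z * a)
      · refine ⟨z * a, ?_, lift_up_up hzv.1 ha (by omega), ?_⟩
        · have := lift_up_up hz ha hzz
          rwa [ha.cancel_right] at this
        · have := hzv.2; omega
      · refine ⟨v, ?_, ble_mul_gen ha (by omega), hl⟩
        have := lift_up_left hz ha (by omega)
        rw [ha.cancel_right] at this
        exact ble_trans this hzv.1

theorem bCov_iff : bCov cs u v ↔ Cov cs u v := by
  constructor
  · rintro ⟨h, hne, hz⟩
    obtain ⟨z, huz, hzv⟩ := exists_coatom h hne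
    rcases hz z huz hzv.1 with rfl | rfl
    · exact hzv
    · have := hzv.2; omega
  · rintro ⟨h, hl⟩
    refine ⟨h, by rintro rfl; omega, fun z hz hz' => ?_⟩
    rcases ble_length hz with rfl | h1
    · exact Or.inl rfl
    · exact Or.inr (ble_eq hz' (by omega))

theorem Cov.inv (h : Cov cs u v) : Cov cs u⁻¹ v⁻¹ := ⟨ble_inv h.1, by simpa using h.2⟩

theorem Cov.mul_gen (ha : Gen cs a) (h : ℓ (u * a) = ℓ u + 1) : Cov cs u (u * a) :=
  ⟨ble_mul_gen ha (by omega), h⟩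

theorem Cov.gen_mul (ha : Gen cs a) (h : ℓ (a * u) = ℓ u + 1) : Cov cs u (a * u) :=
  ⟨ble_gen_mul ha (by omega), h⟩

/-- A coatom of `v` without the right descent `a` of `v` is `v * a`. -/
theorem Cov.eq_mul_gen (h : Cov cs z v) (ha : Gen cs a) (hv : ℓ (v * a) < ℓ v)
    (hz : ℓ z < ℓ (z * a)) : v = z * a := by
  have h1 := lift_up_left h.1 ha hv
  have := h.2
  exact (ble_eq h1 (by omega)).symm

theorem Cov.eq_gen_mul (h : Cov cs z v) (ha : Gen cs a) (hv : ℓ (a * v) < ℓ v)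
    (hz : ℓ z < ℓ (a * z)) : v = a * z := by
  have h1 := llift_up_left h.1 ha hv
  have := h.2
  exact (ble_eq h1 (by omega)).symm

/-- A coatom `z` of `v` that is not `v * a`, for `a` a right descent of `v`. -/
theorem Cov.descent (h : Cov cs z v) (ha : Gen cs a) (hv : ℓ (v * a) < ℓ v) (hne : z ≠ v * a) :
    ℓ (z * a) + 1 = ℓ z := by
  rcases ha.length_mul z with h1 | h1
  · exfalso; apply hne; rw [h.eq_mul_gen ha hv (by omega), ha.cancel_right]
  · exact h1

theorem Cov.ldescent (h : Cov cs z v) (ha : Gen cs a) (hv : ℓ (a * v) < ℓ v) (hne : z ≠ a * v) :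
    ℓ (a * z) + 1 = ℓ z := by
  rcases ha.mul_length z with h1 | h1
  · exfalso; apply hne; rw [h.eq_gen_mul ha hv (by omega), ha.cancel_left]
  · exact h1

/-- Elements below a reduced product split accordingly. -/
theorem ble_mul_split (hl : ℓ (x * y) = ℓ x + ℓ y) (h : u ≼ x * y) :
    ∃ u₁ u₂, u = u₁ * u₂ ∧ u₁ ≼ x ∧ u₂ ≼ y ∧ ℓ u = ℓ u₁ + ℓ u₂ := by
  induction y using right_induction cs generalizing u with
  | one => exact ⟨u, 1, by simp, by simpa using h, ble_refl 1, by simp⟩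
  | mul y a ha hy ih =>
    rw [← mul_assoc] at hl h
    have h1 := cs.length_mul_le x y
    have h2 := ha.length_mul (x * y)
    by_cases hu : ℓ u < ℓ (u * a)
    · have := lift_down_right h ha hu
      rw [ha.cancel_right] at this
      obtain ⟨u₁, u₂, rfl, hu1, hu2, hl'⟩ := ih (by omega) this
      exact ⟨u₁, u₂, rfl, hu1, ble_trans hu2 (ble_mul_gen ha (by omega)), hl'⟩
    · have h3 := ha.length_mul u
      have := lift_down_down h ha (by omega)
      rw [ha.cancel_right] at this
      obtain ⟨u₁, u₂, he, hu1, hu2, hl'⟩ := ih (by omega) this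
      have he' : u = u₁ * (u₂ * a) := by rw [← mul_assoc, ← he, ha.cancel_right]
      refine ⟨u₁, u₂ * a, he', hu1, lift_up_up hu2 ha (by omega), ?_⟩
      have h4 := cs.length_mul_le u₁ (u₂ * a)
      have h5 := ha.length_mul u₂
      rw [← he'] at h4
      omega

theorem ble_mul_mono (hl : ℓ (x * y) = ℓ x + ℓ y) (hu : u ≼ x) (hv : v ≼ y) :
    u * v ≼ x * y := by
  induction y using right_induction cs generalizing v with
  | one =>
    have : v = 1 := ble_eq hv (by simp)
    simpa [this] using hu
  | mul y a ha hy ih =>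
    rw [← mul_assoc] at hl ⊢
    have h1 := cs.length_mul_le x y
    have h2 := ha.length_mul (x * y)
    by_cases hva : ℓ v < ℓ (v * a)
    · have := lift_down_right hv ha hva
      rw [ha.cancel_right] at this
      exact ble_trans (ih (by omega) this) (ble_mul_gen ha (by omega))
    · have h3 := ha.length_mul v
      have := lift_down_down hv ha (by omega)
      rw [ha.cancel_right] at this
      have h4 := lift_up_up (ih (by omega) this) ha (by omega)
      rwa [← mul_assoc, ha.cancel_right] at h4

end BruhatBasics

section Parabolic

local notation "ℓ" => CoxeterSystem.length cs
local infix:50 " ≼ " => bruhatLE cs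

variable {a b u v w x y z g h r p q j A A' y' : W} {J J' K : Set W}

theorem Gen.ble_one (ha : Gen cs a) : ¬ a ≼ 1 := by
  intro h
  have := ble_length_le h
  simp [ha.length] at this

theorem Gen.eq_of_ble (ha : Gen cs a) (hb : Gen cs b) (h : a ≼ b) : a = b :=
  ble_eq h (by rw [ha.length, hb.length])

theorem ble_gen (ha : Gen cs a) (h : u ≼ a) : u = 1 ∨ u = a := by
  rcases ble_length h with rfl | h
  · exact Or.inr rfl
  · rw [ha.length] at h
    left; rw [← cs.length_eq_zero_iff]; omega

theorem descent_ble (ha : Gen cs a) (h : ℓ (w * a) < ℓ w) : a ≼ w := by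
  have h1 := ha.length_mul w
  have := ble_mul_mono (x := w * a) (y := a) (u := 1) (v := a)
    (by rw [ha.cancel_right, ha.length]; omega) (one_ble _) (ble_refl a)
  rwa [one_mul, ha.cancel_right] at this

theorem ldescent_ble (ha : Gen cs a) (h : ℓ (a * w) < ℓ w) : a ≼ w := by
  apply ble_inv_left ha
  exact descent_ble ha (by rwa [ha.length_inv_mul, cs.length_inv])

theorem gen_ble_mul (ha : Gen cs a) (h : a ≼ x * y) : a ≼ x ∨ a ≼ y := by
  induction y using right_induction cs with
  | one => left; simpa using h
  | mul y b hb hy ih =>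
    rw [← mul_assoc] at h
    have hab : a ≼ x * y ∨ a = b := by
      by_cases hx : ℓ (x * y * b) < ℓ (x * y)
      · left; exact ble_trans h (mul_gen_ble hb hx)
      · have h1 := hb.length_mul (x * y)
        rcases mul_gen_ble_or h hb with h2 | h2
        · have h3 := hb.length_mul a
          rcases h3 with h3 | h3
          · left
            have := lift_down_right h hb (by omega)
            rwa [hb.cancel_right] at this
          · right
            rw [ha.length] at h3
            have : a * b = 1 := by rw [← cs.length_eq_zero_iff]; omega
            rw [mul_eq_one_iff_eq_inv.1 this, hb.inv]
        · rw [hb.cancel_right] at h2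
          have h3 := hb.length_mul a
          rcases h3 with h3 | h3
          · left
            exact ble_trans (ble_mul_gen hb (by omega)) h2
          · right
            rw [ha.length] at h3
            have : a * b = 1 := by rw [← cs.length_eq_zero_iff]; omega
            rw [mul_eq_one_iff_eq_inv.1 this, hb.inv]
    rcases hab with h1 | rfl
    · exact (ih h1).imp id fun h => ble_trans h (ble_mul_gen hb (by omega))
    · right; exact descent_ble ha (by rw [ha.cancel_right]; omega)

/-- Membership in the standard parabolic subgroup generated by `J`. -/
def InPar (cs : CoxeterSystem M W) (J : Set W) (w : W) : Prop :=
  ∀ a, Gen cs a → bruhatLE cs a w → a ∈ J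

theorem InPar.one : InPar cs J 1 := fun _ ha h => absurd h ha.ble_one

theorem InPar.mul (hx : InPar cs J x) (hy : InPar cs J y) : InPar cs J (x * y) :=
  fun a ha h => (gen_ble_mul ha h).elim (hx a ha) (hy a ha)

theorem InPar.inv (hx : InPar cs J x) : InPar cs J x⁻¹ :=
  fun a ha h => hx a ha (ble_inv_left ha h)

theorem InPar.of_ble (hx : InPar cs J x) (h : u ≼ x) : InPar cs J u :=
  fun a ha h' => hx a ha (ble_trans h' h)

theorem InPar.gen (ha : Gen cs a) (h : a ∈ J) : InPar cs J a :=
  fun b hb h' => by rwa [hb.eq_of_ble ha h']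

theorem InPar.mono (hx : InPar cs J x) (h : J ⊆ J') : InPar cs J' x :=
  fun a ha h' => h (hx a ha h')

theorem InPar.descent (hx : InPar cs J x) (ha : Gen cs a) (h : ℓ (x * a) < ℓ x) : a ∈ J :=
  hx a ha (descent_ble ha h)

theorem InPar.ldescent (hx : InPar cs J x) (ha : Gen cs a) (h : ℓ (a * x) < ℓ x) : a ∈ J :=
  hx a ha (ldescent_ble ha h)

theorem InPar.length_mul (hx : InPar cs J x) (ha : Gen cs a) (h : a ∉ J) :
    ℓ (x * a) = ℓ x + 1 := by
  rcases ha.length_mul x with h1 | h1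
  · exact h1
  · exact absurd (hx.descent ha (by omega)) h

theorem InPar.mul_length (hx : InPar cs J x) (ha : Gen cs a) (h : a ∉ J) :
    ℓ (a * x) = ℓ x + 1 := by
  rcases ha.mul_length x with h1 | h1
  · exact h1
  · exact absurd (hx.ldescent ha (by omega)) h

theorem inPar_mul_iff (hl : ℓ (x * y) = ℓ x + ℓ y) :
    InPar cs J (x * y) ↔ InPar cs J x ∧ InPar cs J y := by
  refine ⟨fun h => ⟨h.of_ble ?_, h.of_ble ?_⟩, fun h => h.1.mul h.2⟩
  · simpa using ble_mul_mono hl (ble_refl x) (one_ble y)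
  · simpa using ble_mul_mono hl (one_ble x) (ble_refl y)

/-- `A` has no right descent in `J`. -/
def RMin (cs : CoxeterSystem M W) (J : Set W) (A : W) : Prop :=
  ∀ a, Gen cs a → a ∈ J → cs.length A < cs.length (A * a)

/-- `A` has no left descent in `J`. -/
def LMin (cs : CoxeterSystem M W) (J : Set W) (A : W) : Prop :=
  ∀ a, Gen cs a → a ∈ J → cs.length A < cs.length (a * A)

theorem LMin.inv (h : LMin cs J A) : RMin cs J A⁻¹ := fun a ha haJ => by
  rw [ha.length_inv_mul, cs.length_inv]; exact h a ha haJ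

theorem RMin.inv (h : RMin cs J A) : LMin cs J A⁻¹ := fun a ha haJ => by
  rw [ha.length_mul_inv, cs.length_inv]; exact h a ha haJ

theorem length_mul_of_minimal (hA : ∀ z, InPar cs J z → ℓ A ≤ ℓ (A * z)) (hy : InPar cs J y) :
    ℓ (A * y) = ℓ A + ℓ y := by
  induction y using right_induction cs with
  | one => simp
  | mul y a ha hl ih =>
    have hy' := (inPar_mul_iff (by rw [hl, ha.length])).1 hy
    have ih := ih hy'.1
    rw [← mul_assoc, hl]
    rcases ha.length_mul (A * y) with h | h
    · omega
    · exfalso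
      obtain ⟨u₁, u₂, he, h1, h2, h3⟩ := ble_mul_split ih (mul_gen_ble ha (by omega))
      have h4 : u₁ = A * (y * a * u₂⁻¹) := by
        rw [eq_comm, ← mul_assoc, ← mul_assoc, he]; group
      have h5 := hA _ (hy.mul (hy'.1.of_ble h2).inv)
      rw [← h4] at h5
      have h6 := ble_eq h1 h5
      subst h6
      rw [mul_assoc] at he
      have := ble_length_le h2
      rw [← mul_left_cancel he] at this
      omega

theorem exists_minimal_coset (J : Set W) (w : W) : ∃ A y, w = A * y ∧ InPar cs J y ∧
    ∀ z, InPar cs J z → ℓ A ≤ ℓ (A * z) := by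
  have hex : ∃ n, ∃ y, InPar cs J y ∧ ℓ (w * y) = n := ⟨_, 1, InPar.one, rfl⟩
  classical
  obtain ⟨y, hy, hn⟩ := Nat.find_spec hex
  refine ⟨w * y, y⁻¹, by group, hy.inv, fun z hz => ?_⟩
  rw [hn]
  exact Nat.find_min' hex ⟨y * z, hy.mul hz, by rw [mul_assoc]⟩

theorem RMin.length_mul (hA : RMin cs J A) (hy : InPar cs J y) : ℓ (A * y) = ℓ A + ℓ y := by
  obtain ⟨A₀, z, rfl, hz, hmin⟩ := exists_minimal_coset (cs := cs) J A
  have hz1 : z = 1 := by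
    by_contra hne
    obtain ⟨a, ha, hl⟩ := exists_mul_gen_lt (cs := cs) hne
    have h1 := hA a ha (hz.descent ha (by omega))
    rw [mul_assoc, length_mul_of_minimal hmin hz,
      length_mul_of_minimal hmin (hz.mul (InPar.gen ha (hz.descent ha (by omega))))] at h1
    omega
  subst hz1
  rw [mul_one] at *
  exact length_mul_of_minimal hmin hy

variable (cs) in
theorem exists_rmin (J : Set W) (w : W) :
    ∃ A y, w = A * y ∧ RMin cs J A ∧ InPar cs J y ∧ ℓ w = ℓ A + ℓ y := by
  obtain ⟨A, y, h, hy, hmin⟩ := exists_minimal_coset (cs := cs) J w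
  refine ⟨A, y, h, fun a ha haJ => ?_, hy, by rw [h, length_mul_of_minimal hmin hy]⟩
  rw [length_mul_of_minimal hmin (InPar.gen ha haJ), ha.length]; omega

theorem LMin.length_mul (hA : LMin cs J A) (hy : InPar cs J y) : ℓ (y * A) = ℓ y + ℓ A := by
  rw [← cs.length_inv, mul_inv_rev, hA.inv.length_mul hy.inv, cs.length_inv, cs.length_inv, add_comm]

variable (cs) in
theorem exists_lmin (J : Set W) (w : W) :
    ∃ y A, w = y * A ∧ LMin cs J A ∧ InPar cs J y ∧ ℓ w = ℓ y + ℓ A := by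
  obtain ⟨A, y, h, hA, hy, hl⟩ := exists_rmin cs J w⁻¹
  refine ⟨y⁻¹, A⁻¹, ?_, hA.inv, hy.inv, ?_⟩
  · rw [← mul_inv_rev, ← h, inv_inv]
  · rw [cs.length_inv] at *; rw [cs.length_inv]; omega

theorem RMin.eq_one (hA : RMin cs J A) (hy : InPar cs J A) : A = 1 := by
  by_contra hne
  obtain ⟨a, ha, hl⟩ := exists_mul_gen_lt (cs := cs) hne
  have := hA a ha (hy.descent ha (by omega))
  omega

theorem RMin.right_factor (hA : RMin cs J (x * z)) (hl : ℓ (x * z) = ℓ x + ℓ z) :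
    RMin cs J z := fun a ha haJ => by
  have h1 := hA a ha haJ
  have h2 := cs.length_mul_le x (z * a)
  rw [← mul_assoc] at h2
  omega

theorem RMin.gen_mul (hA : RMin cs J A) (hp : Gen cs p) (hl : ℓ (p * A) < ℓ A) :
    RMin cs J (p * A) := by
  apply RMin.right_factor (x := p) (z := p * A)
  · rwa [hp.cancel_left]
  · rw [hp.cancel_left, hp.length]; have := hp.mul_length A; omega

theorem RMin.ble (hA : RMin cs J A) (h : A ≼ A' * y) (hy : InPar cs J y)
    (hl : ℓ (A' * y) = ℓ A' + ℓ y) : A ≼ A' := by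
  obtain ⟨u₁, u₂, rfl, h1, h2, h3⟩ := ble_mul_split hl h
  have := (hA.right_factor h3).eq_one (hy.of_ble h2)
  rw [this, mul_one]; exact h1

theorem LMin.ble (hA : LMin cs J A) (h : A ≼ y * A') (hy : InPar cs J y)
    (hl : ℓ (y * A') = ℓ y + ℓ A') : A ≼ A' := by
  have h1 := ble_inv h
  rw [mul_inv_rev] at h1
  exact ble_inv_iff.1 (hA.inv.ble h1 hy.inv (by
    rw [← mul_inv_rev, cs.length_inv, cs.length_inv, cs.length_inv, hl, add_comm]))

theorem ble_left_mul (hl : ℓ (x * y) = ℓ x + ℓ y) : x ≼ x * y := by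
  simpa using ble_mul_mono hl (ble_refl x) (one_ble y)

theorem ble_right_mul (hl : ℓ (x * y) = ℓ x + ℓ y) : y ≼ x * y := by
  simpa using ble_mul_mono hl (one_ble x) (ble_refl y)

end Parabolic

section Dihedral

local notation "ℓ" => CoxeterSystem.length cs
local infix:50 " ≼ " => bruhatLE cs

variable {a b u v w x y z g h r p q j A A' y' : W} {J J' K : Set W}

theorem dihedral_ext (hg : InPar cs {p, q} g) (hh : InPar cs {p, q} h) (hl : ℓ g = ℓ h)
    (ha : Gen cs a) (hag : ℓ (a * g) < ℓ g) (hah : ℓ (a * h) < ℓ h) : g = h := by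
  induction hn : ℓ g generalizing g h a with
  | zero => omega
  | succ n ih =>
    have h1 := ha.mul_length g
    have h2 := ha.mul_length h
    have haK := hg.ldescent ha hag
    by_cases hn0 : n = 0
    · have e1 : a * g = 1 := by rw [← cs.length_eq_zero_iff]; omega
      have e2 : a * h = 1 := by rw [← cs.length_eq_zero_iff]; omega
      exact mul_left_cancel (e1.trans e2.symm)
    · have hg' : a * g ≠ 1 := by rw [ne_eq, ← cs.length_eq_zero_iff]; omega
      have hh' : a * h ≠ 1 := by rw [ne_eq, ← cs.length_eq_zero_iff]; omega
      obtain ⟨c, hc, hcl⟩ := exists_gen_mul_lt (cs := cs) hg'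
      obtain ⟨d, hd, hdl⟩ := exists_gen_mul_lt (cs := cs) hh'
      have ig := (InPar.gen ha haK).mul hg
      have ih' := (InPar.gen ha haK).mul hh
      have hcK := ig.ldescent hc (by omega)
      have hdK := ih'.ldescent hd (by omega)
      have hca : c ≠ a := by rintro rfl; rw [hc.cancel_left] at hcl; omega
      have hda : d ≠ a := by rintro rfl; rw [hd.cancel_left] at hdl; omega
      have hcd : c = d := by
        simp only [Set.mem_insert_iff, Set.mem_singleton_iff] at haK hcK hdK
        grind
      subst hcd
      have := ih ig ih' (by omega) hc (by omega) (by omega) (by omega)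
      exact mul_left_cancel this

theorem dihedral_ble_succ (hg : InPar cs {p, q} g) (hh : InPar cs {p, q} h)
    (hl : ℓ h = ℓ g + 1) : g ≼ h := by
  induction hn : ℓ g generalizing g h with
  | zero => rw [cs.length_eq_zero_iff.1 hn]; exact one_ble _
  | succ n ih =>
    have hh1 : h ≠ 1 := by rw [ne_eq, ← cs.length_eq_zero_iff]; omega
    have hg1 : g ≠ 1 := by rw [ne_eq, ← cs.length_eq_zero_iff]; omega
    obtain ⟨a, ha, hal⟩ := exists_gen_mul_lt (cs := cs) hh1
    have haK := hh.ldescent ha (by omega)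
    have ih' := (InPar.gen ha haK).mul hh
    rcases ha.mul_length g with h1 | h1
    · obtain ⟨b, hb, hbl⟩ := exists_gen_mul_lt (cs := cs) hg1
      have hbK := hg.ldescent hb (by omega)
      have hah1 : a * h ≠ 1 := by rw [ne_eq, ← cs.length_eq_zero_iff]; omega
      obtain ⟨c, hc, hcl⟩ := exists_gen_mul_lt (cs := cs) hah1
      have hcK := ih'.ldescent hc (by omega)
      have hca : c ≠ a := by rintro rfl; rw [hc.cancel_left] at hcl; omega
      have hba : b ≠ a := by rintro rfl; omega
      have hcb : c = b := by
        simp only [Set.mem_insert_iff, Set.mem_singleton_iff] at haK hcK hbK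
        grind
      subst hcb
      rw [dihedral_ext hg ih' (by omega) hb (by omega) (by omega)]
      exact gen_mul_ble ha (by omega)
    · have := ih ((InPar.gen ha haK).mul hg) ih' (by omega) (by omega)
      have := llift_up_up this ha (by rw [ha.cancel_left]; omega)
      rwa [ha.cancel_left, ha.cancel_left] at this

theorem dihedral_ble (hg : InPar cs {p, q} g) (hh : InPar cs {p, q} h)
    (hl : ℓ g < ℓ h) : g ≼ h := by
  induction hn : ℓ h - ℓ g generalizing h with
  | zero => omega
  | succ n ih =>
    by_cases h0 : ℓ h = ℓ g + 1
    · exact dihedral_ble_succ hg hh h0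
    · have hh1 : h ≠ 1 := by rw [ne_eq, ← cs.length_eq_zero_iff]; omega
      obtain ⟨a, ha, hal⟩ := exists_gen_mul_lt (cs := cs) hh1
      exact ble_trans (ih ((InPar.gen ha (hh.ldescent ha (by omega))).mul hh) (by omega) (by omega))
        (gen_mul_ble ha (by omega))

/-- An element of a dihedral parabolic subgroup with two left descents is longest. -/
theorem dihedral_longest (hpq : p ≠ q) (hp : Gen cs p) (hq : Gen cs q) (hy : InPar cs {p, q} y)
    (h1 : ℓ (p * y) < ℓ y) (h2 : ℓ (q * y) < ℓ y) (hg : InPar cs {p, q} g) : ℓ g ≤ ℓ y := by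
  by_contra hlt
  have key : ∀ n g, InPar cs {p, q} g → ℓ g = ℓ y + 1 + n → False := by
    intro n
    induction n with
    | zero =>
      intro g hg hl
      have hg1 : g ≠ 1 := by rw [ne_eq, ← cs.length_eq_zero_iff]; omega
      obtain ⟨a, ha, hal⟩ := exists_gen_mul_lt (cs := cs) hg1
      have haK := hg.ldescent ha (by omega)
      have hag := (InPar.gen ha haK).mul hg
      have hy1 : y ≠ 1 := by rintro rfl; simp at h1
      have hag1 : a * g ≠ 1 := by
        rw [ne_eq, ← cs.length_eq_zero_iff]
        rw [ne_eq, ← cs.length_eq_zero_iff] at hy1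
        omega
      obtain ⟨b, hb, hbl⟩ := exists_gen_mul_lt (cs := cs) hag1
      have hbK := hag.ldescent hb (by omega)
      simp only [Set.mem_insert_iff, Set.mem_singleton_iff] at hbK haK
      have hby : ℓ (b * y) < ℓ y := by rcases hbK with rfl | rfl <;> assumption
      have hay : ℓ (a * y) < ℓ y := by rcases haK with rfl | rfl <;> assumption
      have := dihedral_ext hag hy (by omega) hb (by omega) hby
      rw [← this, ha.cancel_left] at hay
      omega
    | succ n ih =>
      intro g hg hl
      have hg1 : g ≠ 1 := by rw [ne_eq, ← cs.length_eq_zero_iff]; omega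
      obtain ⟨a, ha, hal⟩ := exists_gen_mul_lt (cs := cs) hg1
      exact ih _ ((InPar.gen ha (hg.ldescent ha (by omega))).mul hg) (by omega)
  exact key (ℓ g - (ℓ y + 1)) g hg (by omega)

/-- Two left descents `p`, `q` force a longest left factor in the dihedral group. -/
theorem exists_dihedral_factor (hpq : p ≠ q) (hp : Gen cs p) (hq : Gen cs q)
    (h1 : ℓ (p * u) < ℓ u) (h2 : ℓ (q * u) < ℓ u) : ∃ P A, u = P * A ∧ ℓ u = ℓ P + ℓ A ∧
      InPar cs {p, q} P ∧ LMin cs {p, q} A ∧ ℓ (p * P) < ℓ P ∧ ℓ (q * P) < ℓ P ∧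
      ∀ g, InPar cs {p, q} g → ℓ g ≤ ℓ P ∧ g ≼ u := by
  obtain ⟨P, A, rfl, hA, hP, hl⟩ := exists_lmin cs {p, q} u
  have d1 : ℓ (p * P) < ℓ P := by
    have := hA.length_mul ((InPar.gen hp (by simp)).mul hP)
    rw [mul_assoc] at this; omega
  have d2 : ℓ (q * P) < ℓ P := by
    have := hA.length_mul ((InPar.gen hq (by simp)).mul hP)
    rw [mul_assoc] at this; omega
  refine ⟨P, A, rfl, hl, hP, hA, d1, d2, fun g hg => ?_⟩
  have h3 := dihedral_longest hpq hp hq hP d1 d2 hg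
  refine ⟨h3, ble_trans ?_ (ble_left_mul hl)⟩
  rcases Nat.lt_or_ge (ℓ g) (ℓ P) with h4 | h4
  · exact dihedral_ble hg hP h4
  · by_cases hg1 : g = 1
    · rw [hg1]; exact one_ble _
    obtain ⟨a, ha, hal⟩ := exists_gen_mul_lt (cs := cs) hg1
    have haK := hg.ldescent ha (by omega)
    simp only [Set.mem_insert_iff, Set.mem_singleton_iff] at haK
    have : ℓ (a * P) < ℓ P := by rcases haK with rfl | rfl <;> assumption
    rw [dihedral_ext hg hP (by omega) ha (by omega) this]
    exact ble_refl _

theorem comm_of_length (hr : Gen cs r) (ha : Gen cs a) (hra : r ≠ a) :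
    ℓ (r * a) = 2 ∧ (r * a = a * r ∨ ℓ (r * a * r) = 3) := by
  have h1 : ℓ (r * a) = 2 := by
    rcases ha.length_mul r with h | h
    · rw [h, hr.length]
    · rw [hr.length] at h
      have : r * a = 1 := by rw [← cs.length_eq_zero_iff]; omega
      exact absurd (by rw [mul_eq_one_iff_eq_inv.1 this, ha.inv]) hra
  refine ⟨h1, ?_⟩
  rcases hr.length_mul (r * a) with h | h
  · right; omega
  · left
    have : ℓ (r * a * r) = 1 := by omega
    obtain ⟨i, hi⟩ := cs.length_eq_one_iff.1 this
    have hc : Gen cs (r * a * r) := ⟨i, hi⟩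
    have hle : r * a * r ≼ r * a := mul_gen_ble hr (by omega)
    rcases gen_ble_mul hc hle with h2 | h2
    · have := hc.eq_of_ble hr h2
      exfalso
      have h3 : a * r = 1 := by
        apply mul_left_cancel (a := r); rw [← mul_assoc, this, mul_one]
      exact hra (by rw [mul_eq_one_iff_eq_inv.1 h3, hr.inv])
    · have := hc.eq_of_ble ha h2
      calc r * a = r * a * r * r := (hr.cancel_right _).symm
        _ = a * r := by rw [this]

/-- Two left descents: peeling them off alternately. -/
theorem two_ldescents (hr : Gen cs r) (hj : Gen cs j) (hrj : r ≠ j)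
    (h1 : ℓ (r * u) < ℓ u) (h2 : ℓ (j * u) < ℓ u) :
    ℓ (r * (j * u)) + 2 = ℓ u ∧ (r * j ≠ j * r → ℓ (j * (r * (j * u))) + 3 = ℓ u) := by
  obtain ⟨P, A, rfl, hl, hP, hA, d1, d2, hlong⟩ := exists_dihedral_factor hrj hr hj h1 h2
  have hrK : InPar cs {r, j} r := InPar.gen hr (by simp)
  have hjK : InPar cs {r, j} j := InPar.gen hj (by simp)
  have e1 : ∀ z, InPar cs {r, j} z → ℓ (z * A) = ℓ z + ℓ A := fun z hz => hA.length_mul hz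
  have d1' := hr.mul_length P
  have d2' := hj.mul_length P
  have hlen := comm_of_length hr hj hrj
  have h2P := (hlong _ (hrK.mul hjK)).1
  have step : ∀ z c d, ((c = r ∧ d = j) ∨ (c = j ∧ d = r)) → InPar cs {r, j} z → z ≠ 1 →
      ℓ z < ℓ (d * z) → ℓ (c * z) + 1 = ℓ z := by
    intro z c d hcd hz hz1 hdz
    obtain ⟨e, he, hel⟩ := exists_gen_mul_lt (cs := cs) hz1
    have heK := hz.ldescent he (by omega)
    simp only [Set.mem_insert_iff, Set.mem_singleton_iff] at heK
    have hed : e ≠ d := by rintro rfl; omega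
    have : c = e := by grind
    rwa [this]
  have s1 := step (j * P) r j (Or.inl ⟨rfl, rfl⟩) (hjK.mul hP)
    (by rw [ne_eq, ← cs.length_eq_zero_iff]; omega) (by rw [hj.cancel_left]; exact d2)
  constructor
  · rw [← mul_assoc, ← mul_assoc, mul_assoc r j P, e1 _ (hrK.mul (hjK.mul hP))]
    omega
  · intro hne
    have h3 := (hlen.2.resolve_left hne)
    have h3P := (hlong _ ((hrK.mul hjK).mul hrK)).1
    have s2 := step (r * (j * P)) j r (Or.inr ⟨rfl, rfl⟩) (hrK.mul (hjK.mul hP))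
      (by rw [ne_eq, ← cs.length_eq_zero_iff]; omega) (by rw [hr.cancel_left]; omega)
    have := e1 _ (hjK.mul (hrK.mul (hjK.mul hP)))
    simp only [mul_assoc] at *
    omega

theorem comm_of_conj_mem (hr : Gen cs r) (hrK : r ∉ K) (hg : InPar cs K g)
    (hh : InPar cs K (r * g * r)) : r * g = g * r := by
  have key : ∀ g h, InPar cs K g → InPar cs K h → r * g = h * r → g ≼ h := by
    intro g h hg hh he
    have h1 := hg.mul_length hr hrK
    have h2 := hh.length_mul hr hrK
    have h3 : g ≼ h * r := by rw [← he]; exact ble_gen_mul hr (by omega)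
    obtain ⟨u₁, u₂, rfl, h4, h5, h6⟩ := ble_mul_split (by rw [h2, hr.length]) h3
    rcases ble_gen hr h5 with rfl | rfl
    · simpa using h4
    · exact absurd (((inPar_mul_iff h6).1 hg).2 _ hr (ble_refl _)) hrK
  have h1 := key g (r * g * r) hg hh (by rw [hr.cancel_right])
  have h2 := key (r * g * r)⁻¹ g⁻¹ hh.inv hg.inv (by
    rw [mul_inv_rev, mul_inv_rev, hr.inv, hr.cancel_left])
  have h3 := ble_antisymm h1 (ble_inv_iff.1 h2)
  conv_rhs => rw [h3, hr.cancel_right]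

theorem length_insert (hr : Gen cs r) (hrK : r ∉ K) (hx : InPar cs K x) (hy : InPar cs K y)
    (hl : ℓ (x * y) = ℓ x + ℓ y) : ℓ (x * r * y) = ℓ x + 1 + ℓ y := by
  induction y using right_induction cs with
  | one => simp [hx.length_mul hr hrK]
  | mul y a ha hya ih =>
    have hy' := (inPar_mul_iff (by rw [hya, ha.length])).1 hy
    have h0 := ha.length_mul (x * y)
    have h00 := cs.length_mul_le x y
    rw [← mul_assoc] at hl ⊢
    have ih := ih hy'.1 (by omega)
    rcases ha.length_mul (x * r * y) with h | h
    · omega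
    exfalso
    have hle := mul_gen_ble (u := x * r * y) ha (by omega)
    have hxr := hx.length_mul hr hrK
    obtain ⟨u₁, u₃, he, h1, h3, h4⟩ := ble_mul_split (by omega) hle
    obtain ⟨x₁, x₂, rfl, h5, h6, h7⟩ := ble_mul_split (by rw [hxr, hr.length]) h1
    have hx1 := hx.of_ble h5
    have hu3 := hy'.1.of_ble h3
    have hinv : r = x⁻¹ * (x₁ * x₂ * u₃) * (y * a)⁻¹ := by rw [← he]; group
    rcases ble_gen hr h6 with rfl | rfl
    · apply hrK
      rw [mul_one] at hinv
      have := (hx.inv.mul (hx1.mul hu3)).mul hy.inv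
      rw [← hinv] at this
      exact this r hr (ble_refl r)
    · have hc := comm_of_conj_mem (g := x⁻¹ * x₁) hr hrK (hx.inv.mul hx1) (by
        have : x₂ * (x⁻¹ * x₁) * x₂ = y * a * u₃⁻¹ := by
          calc x₂ * (x⁻¹ * x₁) * x₂ = x₂ * (x⁻¹ * (x₁ * x₂ * u₃) * (y * a)⁻¹) * (y * a) * u₃⁻¹ := by
                group
            _ = x₂ * x₂ * (y * a) * u₃⁻¹ := by rw [← hinv]
            _ = _ := by rw [hr.mul_self, one_mul]
        rw [this]; exact hy.mul hu3.inv)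
      have : x * y * a = x₁ * u₃ := by
        have h8 : x₂ * (y * a) = x₂ * (x⁻¹ * x₁ * u₃) := by
          rw [← mul_assoc x₂ (x⁻¹ * x₁), hc, ← mul_assoc]
          have : x * x₂ * y * a = x * (x⁻¹ * x₁ * x₂ * u₃) := by rw [he]; group
          have h9 : x₂ * y * a = x⁻¹ * x₁ * x₂ * u₃ := by
            apply mul_left_cancel (a := x); rw [← this]; group
          exact h9
        have h9 := mul_left_cancel h8
        rw [mul_assoc, h9]; group
      have h10 := cs.length_mul_le x₁ u₃
      rw [← this] at h10
      rw [hr.length] at h7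
      omega

theorem comm_of_letters (h : ∀ a, Gen cs a → a ≼ g → r * a = a * r) : r * g = g * r := by
  induction g using left_induction cs with
  | one => simp
  | mul g c hc hcl ihg =>
    have hlc : ℓ (c * g) = ℓ c + ℓ g := by rw [hcl, hc.length]; omega
    rw [← mul_assoc, h c hc (ble_left_mul hlc), mul_assoc,
      ihg fun a ha h' => h a ha (ble_trans h' (ble_right_mul hlc)), mul_assoc]

/-- If the single letter `r` can be extracted on the left, it commutes with what precedes it. -/
theorem extract_left (hr : Gen cs r) (hrK : r ∉ K) (hg : InPar cs K g) (hy : InPar cs K y)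
    (hl : ℓ (g * y) = ℓ g + ℓ y) (hd : ℓ (r * (g * r * y)) < ℓ (g * r * y)) :
    ∀ a, Gen cs a → a ≼ g → r * a = a * r := by
  induction g using left_induction cs with
  | one => intro a ha h; exact absurd h ha.ble_one
  | mul g j hj hjl ih =>
    have hlj : ℓ (j * g) = ℓ j + ℓ g := by rw [hjl, hj.length]; omega
    have hgj := (inPar_mul_iff hlj).1 hg
    have hjK : j ∈ K := hgj.1 j hj (ble_refl j)
    have hrj : r ≠ j := by rintro rfl; exact hrK hjK
    have h1 := cs.length_mul_le g y
    have h2 := hj.mul_length (g * y)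
    have hl2 := hl
    rw [mul_assoc] at hl2
    have hl' : ℓ (g * y) = ℓ g + ℓ y := by omega
    have ins := length_insert hr hrK hgj.2 hy hl'
    have ins' := length_insert hr hrK hg hy hl
    have e0 : j * (j * g * r * y) = g * r * y := by
      simp only [mul_assoc]; rw [hj.cancel_left]
    have hjd : ℓ (j * (j * g * r * y)) < ℓ (j * g * r * y) := by rw [e0]; omega
    obtain ⟨t1, t2⟩ := two_ldescents hr hj hrj hd hjd
    rw [e0] at t1 t2
    have ih := ih hgj.2 hl' (by omega)
    have hrg : r * g = g * r := comm_of_letters ih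
    have hjr : r * j = j * r := by
      by_contra hne
      have t2 := t2 hne
      rw [← hrg, mul_assoc r, hr.cancel_left] at t2
      have : ℓ (r * g * y) = ℓ (g * r * y) := by rw [hrg]
      omega
    intro a ha hle
    rcases gen_ble_mul ha hle with h | h
    · rw [ha.eq_of_ble hj h, hjr]
    · exact ih a ha h

theorem extract_right (hr : Gen cs r) (hrK : r ∉ K) (hg : InPar cs K g) (hy : InPar cs K y)
    (hl : ℓ (y * g) = ℓ y + ℓ g) (hd : ℓ (y * r * g * r) < ℓ (y * r * g)) :
    ∀ a, Gen cs a → a ≼ g → r * a = a * r := by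
  have hinv : (y * r * g)⁻¹ = g⁻¹ * r * y⁻¹ := by rw [mul_inv_rev, mul_inv_rev, hr.inv, mul_assoc]
  have := extract_left hr hrK hg.inv hy.inv
    (by rw [← mul_inv_rev, cs.length_inv, cs.length_inv, cs.length_inv, hl, add_comm])
    (by rw [← hinv, hr.length_mul_inv, cs.length_inv]; exact hd)
  intro a ha h
  exact this a ha (by rw [← ha.inv]; exact ble_inv h)

/-- An element with at most two coatoms lies in a dihedral parabolic subgroup. -/
theorem exists_dihedral_of_coatoms (c₁ c₂ : W) (hv : v ≠ 1)
    (hc : ∀ z, Cov cs z v → z = c₁ ∨ z = c₂) :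
    ∃ i j, Gen cs i ∧ Gen cs j ∧ i ≼ v ∧ j ≼ v ∧ InPar cs {i, j} v := by
  obtain ⟨a, ha, hal⟩ := exists_mul_gen_lt (cs := cs) hv
  by_cases h1 : v * a = 1
  · have : v = a := by rw [mul_eq_one_iff_eq_inv.1 h1, ha.inv]
    subst this
    exact ⟨v, v, ha, ha, ble_refl v, ble_refl v, InPar.gen ha (by simp)⟩
  obtain ⟨b, hb, hbl⟩ := exists_mul_gen_lt (cs := cs) h1
  obtain ⟨A, y, hAy, hA, hy, hl⟩ := exists_rmin cs {a, b} v
  have hav : a ≼ v := descent_ble ha (by omega)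
  have hbv : b ≼ v := ble_trans (descent_ble hb (by omega)) (mul_gen_ble ha (by omega))
  by_cases hA1 : A = 1
  · exact ⟨a, b, ha, hb, hav, hbv, by rw [hAy, hA1, one_mul]; exact hy⟩
  exfalso
  have haK : InPar cs {a, b} a := InPar.gen ha (by simp)
  have hbK : InPar cs {a, b} b := InPar.gen hb (by simp)
  have e1 : v * a * b = A * (y * a * b) := by rw [hAy]; simp only [mul_assoc]
  have l1 := hA.length_mul ((hy.mul haK).mul hbK)
  rw [← e1] at l1
  have l2 := hA.length_mul (hy.mul haK)
  rw [← mul_assoc, ← hAy] at l2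
  have hya1 : y * a ≠ 1 := by rw [ne_eq, ← cs.length_eq_zero_iff]; omega
  obtain ⟨p', hp', hpl'⟩ := exists_gen_mul_lt (cs := cs) hya1
  have hpK' := (hy.mul haK).ldescent hp' (by omega)
  have hpy : ℓ (p' * y) + 1 = ℓ y := by
    have := ha.length_mul (p' * y)
    rw [mul_assoc] at this
    have := hp'.mul_length y
    omega
  obtain ⟨p, hp, hpl⟩ := exists_gen_mul_lt (cs := cs) hA1
  have k1 : Cov cs (v * a) v := ⟨mul_gen_ble ha (by omega), by omega⟩
  have k2 : Cov cs (A * (p' * y)) v := by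
    rw [hAy]
    have hin := (InPar.gen hp' hpK').mul hy
    refine ⟨ble_mul_mono (hA.length_mul hy) (ble_refl A) (gen_mul_ble hp' (by omega)), ?_⟩
    rw [hA.length_mul hin, hA.length_mul hy]; omega
  have hpA := hA.gen_mul hp (by omega)
  have k3 : Cov cs (p * v) v := by
    have : p * v = p * A * y := by rw [hAy, mul_assoc]
    have l3 : ℓ (p * v) + 1 = ℓ v := by
      rw [this, hpA.length_mul hy, hAy, hA.length_mul hy]; omega
    exact ⟨gen_mul_ble hp (by omega), l3.symm⟩
  have key : ∀ z, InPar cs {a, b} z → p * v ≠ A * z := by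
    intro z hz he
    have h5 : p * A = A * (z * y⁻¹) := by
      rw [← mul_assoc, ← he, hAy]; group
    have := hA.length_mul (hz.mul hy.inv)
    rw [← h5] at this; omega
  have n12 : v * a ≠ A * (p' * y) := by
    rw [hAy, mul_assoc]
    intro he
    have he := mul_left_cancel he
    rw [he, hp'.cancel_left] at hpl'
    omega
  have n13 : p * v ≠ v * a := by
    rw [show v * a = A * (y * a) by rw [hAy, mul_assoc]]
    exact key _ (hy.mul haK)
  have n23 := key (p' * y) ((InPar.gen hp' hpK').mul hy)
  have c1 := hc _ k1
  have c2 := hc _ k2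
  have c3 := hc _ k3
  grind

end Dihedral

section Matching

local notation "ℓ" => CoxeterSystem.length cs
local infix:50 " ≼ " => bruhatLE cs

variable {a b u v w x y z g h r p q k T A : W} {J K : Set W}

instance : CoeFun (BSM cs) (fun _ => W → W) := ⟨BSM.toFun⟩

/-- `u` is matched with a larger element. -/
def Up (φ : BSM cs) (u : W) : Prop := u ∈ φ.dom ∧ cs.length (φ u) = cs.length u + 1

/-- `u` is matched with a smaller element. -/
def Down (φ : BSM cs) (u : W) : Prop := u ∈ φ.dom ∧ cs.length (φ u) + 1 = cs.length u

variable {φ : BSM cs}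

theorem up_or_down (hu : u ∈ φ.dom) : Up φ u ∨ Down φ u := by
  rcases φ.cov u hu with h | h
  · right; exact ⟨hu, (bCov_iff.1 h).2.symm⟩
  · left; exact ⟨hu, (bCov_iff.1 h).2⟩

theorem Up.not_down (h : Up φ u) : ¬ Down φ u := fun h' => by have := h.2; have := h'.2; omega

theorem Up.cov (h : Up φ u) : Cov cs u (φ u) := by
  rcases φ.cov u h.1 with h' | h'
  · have := (bCov_iff.1 h').2; have := h.2; omega
  · exact bCov_iff.1 h'

theorem Down.cov (h : Down φ u) : Cov cs (φ u) u := by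
  rcases φ.cov u h.1 with h' | h'
  · exact bCov_iff.1 h'
  · have := (bCov_iff.1 h').2; have := h.2; omega

theorem up_iff : Up φ u ↔ u ∈ φ.dom ∧ bCov cs u (φ u) :=
  ⟨fun h => ⟨h.1, bCov_iff.2 h.cov⟩, fun h => ⟨h.1, (bCov_iff.1 h.2).2⟩⟩

theorem Up.down (h : Up φ u) : Down φ (φ u) :=
  ⟨φ.maps u h.1, by rw [φ.invol u h.1]; exact h.2.symm⟩

theorem Down.up (h : Down φ u) : Up φ (φ u) :=
  ⟨φ.maps u h.1, by rw [φ.invol u h.1]; exact h.2.symm⟩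

theorem map_inj (hu : u ∈ φ.dom) (hv : v ∈ φ.dom) (h : φ u = φ v) : u = v := by
  have := congrArg φ h
  rwa [φ.invol u hu, φ.invol v hv] at this

theorem Up.map_cov (hu : Up φ u) (hv : Up φ v) (h : Cov cs v u) : Cov cs (φ v) (φ u) := by
  have := φ.coatom u hu.1 (bCov_iff.2 hu.cov)
  have h2 : φ v ∈ bCoat cs (φ u) := by
    rw [this]; right; exact ⟨v, bCov_iff.2 h, bCov_iff.2 hv.cov, rfl⟩
  exact bCov_iff.1 h2

theorem Down.cov_cases (hy : Down φ y) (h : Cov cs z y) :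
    z = φ y ∨ (Down φ z ∧ Cov cs (φ z) (φ y)) := by
  have hu := hy.up
  have := φ.coatom _ hu.1 (bCov_iff.2 hu.cov)
  have h2 : z ∈ bCoat cs (φ (φ y)) := by rw [φ.invol y hy.1]; exact bCov_iff.2 h
  rw [this] at h2
  rcases h2 with h2 | ⟨v, hv, hv', rfl⟩
  · exact Or.inl h2
  · right
    have hvd := φ.ideal hu.1 hv.1
    have hvu : Up φ v := up_iff.2 ⟨hvd, hv'⟩
    refine ⟨hvu.down, ?_⟩
    rw [φ.invol v hvd]
    exact bCov_iff.1 hv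

/-- Lifting property of special matchings. -/
theorem Down.lift (hy : Down φ y) (h : x ≼ y) :
    (Down φ x → φ x ≼ φ y) ∧ (Up φ x → x ≼ φ y) := by
  induction hn : ℓ y using Nat.strong_induction_on generalizing y with
  | _ n ih =>
    by_cases hxy : x = y
    · subst hxy
      exact ⟨fun _ => ble_refl _, fun h => absurd hy h.not_down⟩
    obtain ⟨z, hxz, hzy⟩ := exists_coatom h hxy
    rcases hy.cov_cases hzy with rfl | ⟨hz, hzc⟩
    · exact ⟨fun hx => ble_trans hx.cov.1 hxz, fun _ => hxz⟩
    · have := ih _ (by have := hzy.2; omega) hz hxz rfl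
      exact ⟨fun hx => ble_trans (this.1 hx) hzc.1, fun hx => ble_trans (this.2 hx) hzc.1⟩

theorem Down.ble_map (hy : Down φ y) (h : x ≼ y) (hx : Up φ x) : x ≼ φ y := (hy.lift h).2 hx

theorem Up.map_ble (hy : Up φ y) (h : x ≼ y) (hx : Up φ x) : φ x ≼ φ y := by
  induction hn : ℓ y using Nat.strong_induction_on generalizing y with
  | _ n ih =>
    by_cases hxy : x = y
    · subst hxy; exact ble_refl _
    obtain ⟨z, hxz, hzy⟩ := exists_coatom h hxy
    have hl := hzy.2
    rcases up_or_down (φ.ideal hy.1 hzy.1) with hz | hz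
    · exact ble_trans (ih _ (by omega) hz hxz rfl) (hy.map_cov hz hzy).1
    · have h1 := hz.ble_map hxz hx
      have h2 := ih _ (by have := hz.2; omega) hz.up h1 rfl
      rw [φ.invol z hz.1] at h2
      exact ble_trans h2 (ble_trans hzy.1 hy.cov.1)

theorem Down.map_up_ble (hy : Down φ y) (h : x ≼ y) (hx : Up φ x) : φ x ≼ y := by
  have := hy.up.map_ble (hy.ble_map h hx) hx
  rwa [φ.invol y hy.1] at this

theorem Down.map_mem (hy : Down φ y) (h : x ≼ y) : φ x ≼ y := by
  rcases up_or_down (φ.ideal hy.1 h) with hx | hx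
  · exact hy.map_up_ble h hx
  · exact ble_trans hx.cov.1 h

theorem Down.eq_map_of_cov (hy : Down φ y) (hz : Up φ z) (h : Cov cs z y) : y = φ z := by
  rcases hy.cov_cases h with h | h
  · rw [h, φ.invol y hy.1]
  · exact absurd h.1 hz.not_down

theorem one_mem (hu : u ∈ φ.dom) : (1 : W) ∈ φ.dom := φ.ideal hu (one_ble u)

theorem up_one (h1 : (1 : W) ∈ φ.dom) : Up φ 1 := by
  rcases up_or_down h1 with h | h
  · exact h
  · have := h.2; simp at this

theorem gen_map_one (h1 : (1 : W) ∈ φ.dom) : Gen cs (φ 1) := by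
  have := (up_one h1).2
  rw [cs.length_one, zero_add, cs.length_eq_one_iff] at this
  exact this

theorem Down.ble (hu : Down φ u) : φ 1 ≼ u := hu.map_up_ble (one_ble u) (up_one (one_mem hu.1))

theorem gen_up (ha : Gen cs a) (had : a ∈ φ.dom) (h : a ≠ φ 1) : Up φ a := by
  rcases up_or_down had with h' | h'
  · exact h'
  · exact absurd (ha.eq_of_ble (gen_map_one (one_mem had)) (by
      have := h'.2
      rw [ha.length] at this
      have h2 : φ a = 1 := by rw [← cs.length_eq_zero_iff]; omega
      rw [← h2, φ.invol a had]; exact ble_refl _)) h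

theorem gen_ble_map (ha : Gen cs a) (hu : u ∈ φ.dom) (h : a ≼ φ u) : a ≼ u ∨ a = φ 1 := by
  by_cases has : a = φ 1
  · exact Or.inr has
  left
  have haU := gen_up ha (φ.ideal (φ.maps u hu) h) has
  rcases up_or_down hu with h' | h'
  · have := h'.down.ble_map h haU
    rwa [φ.invol u hu] at this
  · exact ble_trans h h'.cov.1

theorem InPar.map (hu : u ∈ φ.dom) (h : InPar cs K u) (hs : φ 1 ∈ K) : InPar cs K (φ u) :=
  fun a ha hle => (gen_ble_map ha hu hle).elim (h a ha) (fun h => h ▸ hs)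

theorem map_inv_bCov : bCov cs u⁻¹ v⁻¹ ↔ bCov cs u v := by
  rw [bCov_iff, bCov_iff]
  exact ⟨fun h => by simpa using h.inv, Cov.inv⟩

/-- The restriction of a matching to a lower interval. -/
def restrict (φ : BSM cs) (w : W) (hw : Down φ w) : BSM cs where
  dom := {x | bruhatLE cs x w}
  toFun := φ.toFun
  ideal _ _ hy h := ble_trans h hy
  maps _ hx := hw.map_mem hx
  invol x hx := φ.invol x (φ.ideal hw.1 hx)
  cov x hx := φ.cov x (φ.ideal hw.1 hx)
  coatom u hu h := φ.coatom u (φ.ideal hw.1 hu) h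

/-- The mirror image of a matching under inversion. -/
def mirror (φ : BSM cs) : BSM cs where
  dom := {x | x⁻¹ ∈ φ.dom}
  toFun u := (φ.toFun u⁻¹)⁻¹
  ideal _ _ hy h := φ.ideal hy (ble_inv h)
  maps x hx := by
    change (φ.toFun x⁻¹)⁻¹⁻¹ ∈ φ.dom
    rw [inv_inv]; exact φ.maps _ hx
  invol x hx := by rw [inv_inv, φ.invol _ hx, inv_inv]
  cov x hx := by
    have := φ.cov _ hx
    rwa [← map_inv_bCov, inv_inv, ← map_inv_bCov (v := (φ.toFun x⁻¹)⁻¹), inv_inv]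
  coatom u hu h := by
    rw [← map_inv_bCov, inv_inv] at h
    have := φ.coatom _ hu h
    ext z
    have hz : z ∈ bCoat cs (φ.toFun u⁻¹)⁻¹ ↔ z⁻¹ ∈ bCoat cs (φ.toFun u⁻¹) := by
      change bCov cs z _ ↔ bCov cs z⁻¹ _
      rw [← map_inv_bCov, inv_inv]
    rw [hz, this]
    constructor
    · rintro (h | ⟨v, h1, h2, h3⟩)
      · left; exact inv_injective h
      · right
        refine ⟨v⁻¹, ?_, ?_, ?_⟩
        · rw [← map_inv_bCov, inv_inv]; exact h1
        · rw [inv_inv, map_inv_bCov]; exact h2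
        · rw [inv_inv, ← h3, inv_inv]
    · rintro (h | ⟨v, h1, h2, h3⟩)
      · left; exact congrArg _ h
      · right
        refine ⟨v⁻¹, map_inv_bCov.2 h1, ?_, ?_⟩
        · rw [← map_inv_bCov, inv_inv] at h2; exact h2
        · rw [h3, inv_inv]

theorem mirror_apply (u : W) : mirror φ u = (φ u⁻¹)⁻¹ := rfl

theorem mem_mirror : u ∈ (mirror φ).dom ↔ u⁻¹ ∈ φ.dom := Iff.rfl

theorem mirror_one : mirror φ 1 = (φ 1)⁻¹ := by rw [mirror_apply, inv_one]

theorem up_mirror : Up (mirror φ) u ↔ Up φ u⁻¹ := by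
  unfold Up; rw [mem_mirror, mirror_apply, cs.length_inv, cs.length_inv]

theorem down_mirror : Down (mirror φ) u ↔ Down φ u⁻¹ := by
  unfold Down; rw [mem_mirror, mirror_apply, cs.length_inv, cs.length_inv]

theorem up_restrict (hw : Down φ w) : Up (restrict φ w hw) u ↔ u ≼ w ∧ Up φ u :=
  ⟨fun h => ⟨h.1, φ.ideal hw.1 h.1, h.2⟩, fun h => ⟨h.1, h.2.2⟩⟩

/-- A matching that is right multiplication by `s` on all dihedral elements below `A` is so on
all elements below `A`. -/
theorem eq_mul_right_of_dihedral (hA : A ∈ φ.dom)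
    (H : ∀ t, Gen cs t → ∀ u, Up φ u → InPar cs {φ 1, t} u → u ≼ A → φ u = u * φ 1)
    (hu : Up φ u) (huA : u ≼ A) : φ u = u * φ 1 := by
  have hs : Gen cs (φ 1) := gen_map_one (one_mem hA)
  induction hn : ℓ u using Nat.strong_induction_on generalizing u with
  | _ n ih =>
    have ih' : ∀ v, Up φ v → v ≼ A → ℓ v < ℓ u → φ v = v * φ 1 := fun v hv hvA hl =>
      ih (ℓ v) (by omega) hv hvA rfl
    have dn : ∀ v, Down φ v → v ≼ A → ℓ v ≤ ℓ u → v * φ 1 = φ v ∧ ℓ (v * φ 1) + 1 = ℓ v := by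
      intro v hv hvA hl
      have h1 := ih' (φ v) hv.up (ble_trans hv.cov.1 hvA) (by have := hv.2; omega)
      rw [φ.invol v hv.1] at h1
      have : v * φ 1 = φ v := by conv_lhs => rw [h1, hs.cancel_right]
      exact ⟨this, by rw [this]; exact hv.2⟩
    have hus : ℓ (u * φ 1) = ℓ u + 1 := by
      rcases hs.length_mul u with h | h
      · exact h
      exfalso
      have hle := mul_gen_ble (u := u) hs (by omega)
      have hvA := ble_trans hle huA
      rcases up_or_down (φ.ideal hA hvA) with hv | hv
      · have h1 := ih' _ hv hvA (by omega)
        rw [hs.cancel_right] at h1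
        have h2 := hv.down
        rw [h1] at h2
        exact hu.not_down h2
      · have h1 := dn _ hv hvA (by omega)
        rw [hs.cancel_right] at h1
        omega
    by_contra hne
    have same : ∀ z, Cov cs z (φ u) ↔ Cov cs z (u * φ 1) := by
      intro z
      constructor
      · intro hz
        rcases hu.down.cov_cases hz with h | ⟨h1, h2⟩
        · rw [h, φ.invol u hu.1]; exact Cov.mul_gen hs hus
        · rw [φ.invol u hu.1] at h2
          have h3 := ih' _ h1.up (ble_trans h2.1 huA) (by have := h2.2; omega)
          rw [φ.invol z h1.1] at h3
          have h4 := h1.2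
          refine ⟨?_, by have := hz.2; have := hu.2; omega⟩
          rw [h3]; exact lift_up_up h2.1 hs (by omega)
      · intro hz
        by_cases hzu : z = u
        · rw [hzu]; exact hu.cov
        · have h1 := hz.descent hs (by rw [hs.cancel_right]; omega)
            (by rwa [hs.cancel_right])
          have h2 := lift_down_down hz.1 hs (by omega)
          rw [hs.cancel_right] at h2
          have h3 : Cov cs (z * φ 1) u := ⟨h2, by have := hz.2; omega⟩
          have hvA := ble_trans h2 huA
          rcases up_or_down (φ.ideal hA hvA) with hv | hv
          · have h4 := hu.map_cov hv h3
            rwa [ih' _ hv hvA (by have := h3.2; omega), hs.cancel_right] at h4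
          · have := dn _ hv hvA (by have := h3.2; omega)
            rw [hs.cancel_right] at this
            omega
    have hX1 : φ u ≠ 1 := by
      intro h; have := hu.2; rw [h, cs.length_one] at this; omega
    obtain ⟨a, ha, hal⟩ := exists_mul_gen_lt (cs := cs) hX1
    have hXY : ∀ z, Cov cs z (u * φ 1) → ℓ z < ℓ (z * a) → φ u = z * a := fun z hz hza =>
      ((same z).2 hz).eq_mul_gen ha (by omega) hza
    have haY : ℓ (u * φ 1 * a) = ℓ (u * φ 1) + 1 := by
      rcases ha.length_mul (u * φ 1) with h | h
      · exact h
      exfalso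
      apply hne
      have := hXY (u * φ 1 * a) ⟨mul_gen_ble ha (by omega), h.symm⟩
        (by rw [ha.cancel_right]; omega)
      rwa [ha.cancel_right] at this
    have hco : ∀ z, Cov cs z (u * φ 1 * a) → z = u * φ 1 ∨ z = φ u := by
      intro z hz
      by_cases hzY : z = u * φ 1
      · exact Or.inl hzY
      right
      have h1 := hz.descent ha (by rw [ha.cancel_right]; omega) (by rwa [ha.cancel_right])
      have h2 := lift_down_down hz.1 ha (by omega)
      rw [ha.cancel_right] at h2
      have := hXY (z * a) ⟨h2, by have := hz.2; omega⟩ (by rw [ha.cancel_right]; omega)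
      rw [ha.cancel_right] at this
      exact this.symm
    obtain ⟨i, j, hi, hj, -, -, hij⟩ := exists_dihedral_of_coatoms (cs := cs) _ _
      (by intro h; rw [h, cs.length_one] at haY; omega) hco
    have hle : u * φ 1 ≼ u * φ 1 * a := ble_mul_gen ha (by omega)
    have hsm := hij _ hs (ble_trans (descent_ble hs (by rw [hs.cancel_right]; omega)) hle)
    have huK : InPar cs {i, j} u := hij.of_ble (ble_trans (ble_mul_gen hs (by omega)) hle)
    simp only [Set.mem_insert_iff, Set.mem_singleton_iff] at hsm
    rcases hsm with h | h
    · exact hne (H j hj u hu (h ▸ huK) huA)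
    · exact hne (H i hi u hu (by rw [h, Set.pair_comm]; exact huK) huA)

/-- `p` commutes with the matching at `u` or agrees with it there. -/
def GoodAt (φ : BSM cs) (p u : W) : Prop := φ (p * u) = p * φ u ∨ φ u = p * u

/-- `b` is moved up by `p` and the matching without commutation. -/
structure NonComm (φ : BSM cs) (p b : W) : Prop where
  up : Up φ b
  lt : cs.length (p * b) = cs.length b + 1
  mem : p * b ∈ φ.dom
  ne : φ b ≠ p * b
  ne' : φ (p * b) ≠ p * φ b

theorem NonComm.up_mul (hp : Gen cs p) (h : NonComm φ p b) : Up φ (p * b) := by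
  rcases up_or_down h.mem with h' | h'
  · exact h'
  · exact absurd (h'.eq_map_of_cov h.up (Cov.gen_mul hp h.lt)).symm h.ne

theorem NonComm.length_mul_map (hp : Gen cs p) (h : NonComm φ p b) :
    ℓ (p * φ b) = ℓ b + 2 := by
  have h2 := h.up.2
  have h3 := h.lt
  rcases hp.mul_length (φ b) with h1 | h1
  · omega
  · exact absurd (h.up.cov.eq_gen_mul hp (by omega) (by omega)) h.ne

theorem goodAt_of_no_nonComm (hp : Gen cs p) (hT : Down φ T) (hpT : ℓ (p * T) < ℓ T)
    (hno : ∀ b, p * b ≼ T → ¬ NonComm φ p b) (hu : u ≼ T) : GoodAt φ p u := by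
  have main : ∀ n b, ℓ b = n → p * b ≼ T → ℓ (p * b) = ℓ b + 1 → GoodAt φ p b := by
    intro n
    induction n using Nat.strong_induction_on with
    | _ n ih =>
      intro b hn hb hlb
      have hpbd := φ.ideal hT.1 hb
      have hbd : b ∈ φ.dom := φ.ideal hpbd (ble_gen_mul hp (by omega))
      by_contra hbad
      rcases up_or_down hbd with hbu | hbu
      · refine hno b hb ⟨hbu, hlb, hpbd, fun h => hbad (Or.inr h), fun h => hbad (Or.inl h)⟩
      · have hbl := hbu.2
        have hbT : b ≼ T := ble_trans (ble_gen_mul hp (by omega)) hb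
        rcases hp.mul_length (φ b) with h1 | h1
        · have hb'T : p * φ b ≼ T := llift_up_left (ble_trans hbu.cov.1 hbT) hp hpT
          rcases ih _ (by omega) (φ b) rfl hb'T (by omega) with h | h
          · rw [φ.invol b hbd] at h
            apply hbad; left
            rw [← h, φ.invol _ (φ.ideal hT.1 hb'T)]
          · rw [φ.invol b hbd] at h
            rw [h, hp.cancel_left] at hlb
            omega
        · have e : p * (p * φ b) = φ b := hp.cancel_left _
          rcases ih _ (by omega) (p * φ b) rfl (by rw [e]; exact ble_trans hbu.cov.1 hbT)
            (by rw [e]; omega) with h | h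
          · rw [e, φ.invol b hbd] at h
            apply hbad; left
            have h2 : p * b = φ (p * φ b) := by rw [h, hp.cancel_left, ← h]
            rw [h2, φ.invol]
            exact φ.ideal hbu.up.1 (gen_mul_ble hp (by omega))
          · have h3 : p * φ b ∈ φ.dom := φ.ideal hbu.up.1 (gen_mul_ble hp (by omega))
            have h4 := map_inj h3 hbd (by rw [h, e])
            rw [h4] at h1; omega
  rcases hp.mul_length u with h | h
  · exact main _ u rfl (llift_up_left hu hp hpT) h
  · have hpuT := llift_up_left hu hp hpT
    have h1 := main _ (p * u) rfl (by rwa [hp.cancel_left]) (by rw [hp.cancel_left]; omega)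
    unfold GoodAt at h1
    rw [hp.cancel_left] at h1
    rcases h1 with h1 | h1
    · left; rw [h1, hp.cancel_left]
    · right
      have := φ.invol _ (φ.ideal hT.1 hpuT)
      rwa [h1] at this

/-- If `p` is not good below `w`, there is a non-commuting pair in a dihedral subgroup. -/
theorem exists_nonComm_dihedral (hp : Gen cs p) (hw : Down φ w) (hpw : ℓ (p * w) < ℓ w)
    (hu : u ≼ w) (hbad : ¬ GoodAt φ p u) :
    ∃ k b, Gen cs k ∧ k ≠ p ∧ (p = φ 1 ∨ k = φ 1) ∧ NonComm φ p b ∧ p * b ≼ w ∧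
      InPar cs {p, k} b := by
  have hexF : ∃ T, T ≼ w ∧ Down φ T ∧ ℓ (p * T) < ℓ T ∧ ¬ GoodAt φ p T := by
    by_contra hcon
    push Not at hcon
    apply hbad
    clear hbad
    induction hn : ℓ w - ℓ u using Nat.strong_induction_on generalizing u with
    | _ n ih =>
      have hud := φ.ideal hw.1 hu
      have hpu := llift_up_left hu hp hpw
      have hlu := ble_length_le hu
      rcases up_or_down hud with h | h
      · have h1 := hw.map_mem hu
        have h2 := ble_length_le h1
        have h3 := h.2
        rcases ih _ (by omega) h1 rfl with h4 | h4
        · rw [φ.invol u hud] at h4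
          left; rw [← h4, φ.invol]; exact φ.ideal hw.1 (llift_up_left h1 hp hpw)
        · rw [φ.invol u hud] at h4
          right; rw [h4, hp.cancel_left, ← h4]
      · rcases hp.mul_length u with h1 | h1
        · have h2 := ble_length_le hpu
          rcases ih _ (by omega) hpu rfl with h4 | h4
          · rw [hp.cancel_left] at h4
            left; rw [h4, hp.cancel_left]
          · rw [hp.cancel_left] at h4
            right
            have := φ.invol _ (φ.ideal hw.1 hpu)
            rwa [h4] at this
        · by_contra hb
          exact hb (hcon u hu h (by omega))
  have hmin : ∃ n, ∃ T, T ≼ w ∧ Down φ T ∧ ℓ (p * T) < ℓ T ∧ ¬ GoodAt φ p T ∧ ℓ T = n := by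
    obtain ⟨T, h1, h2, h3, h4⟩ := hexF
    exact ⟨_, T, h1, h2, h3, h4, rfl⟩
  classical
  obtain ⟨T, hTw, hTd, hpT, hTbad, hTn⟩ := Nat.find_spec hmin
  have hTmin : ∀ z, z ≼ w → Down φ z → ℓ (p * z) < ℓ z → ℓ z < ℓ T → GoodAt φ p z := by
    intro z h1 h2 h3 h4
    by_contra h5
    have := Nat.find_min' hmin ⟨z, h1, h2, h3, h5, rfl⟩
    omega
  have hpT' := hp.mul_length T
  have hne1 : φ T ≠ p * T := fun h => hTbad (Or.inr h)
  have hne2 : φ (p * T) ≠ p * φ T := fun h => hTbad (Or.inl h)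
  have hTl := hTd.2
  have hφTp : ℓ (p * φ T) + 1 = ℓ (φ T) := hTd.cov.ldescent hp hpT hne1
  have hpTcov : Cov cs (p * T) T := ⟨gen_mul_ble hp hpT, by omega⟩
  have hpTd : Down φ (p * T) := by
    rcases hTd.cov_cases hpTcov with h | h
    · exact absurd h.symm hne1
    · exact h.1
  have hco : ∀ z, Cov cs z T → z = φ T ∨ z = p * T := by
    intro z hz
    by_contra! hcon
    obtain ⟨hz1, hz2⟩ := hcon
    have hzl := hz.2
    obtain ⟨hzd, hzc⟩ := (hTd.cov_cases hz).resolve_left hz1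
    have hzp := hz.ldescent hp hpT hz2
    have hzdl := hzd.2
    rcases hTmin z (ble_trans hz.1 hTw) hzd (by omega) (by omega) with h | h
    · have hφz : ℓ (p * φ z) + 1 = ℓ (φ z) := by
        by_cases hh : φ z = p * z
        · exfalso
          have h1 := llift_up_left hzc.1 hp (by omega)
          rw [hh, hp.cancel_left] at h1
          exact hz1 (ble_eq h1 (by omega))
        · exact hzd.cov.ldescent hp (by omega) hh
      have h1 := llift_down_down hzc.1 hp (by omega)
      have h2 : Cov cs (p * φ T) (p * T) :=
        ⟨llift_down_down hTd.cov.1 hp (by omega), by omega⟩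
      have h3 : Down φ (p * φ T) := by
        rcases hpTd.cov_cases h2 with h | h
        · exact absurd h.symm hne2
        · exact h.1
      have hpz : p * z ∈ φ.dom := φ.ideal hzd.1 (gen_mul_ble hp (by omega))
      have h4 : φ (p * φ z) = p * z := by rw [← h, φ.invol _ hpz]
      have h5 : Up φ (p * φ z) := ⟨φ.ideal h3.1 h1, by rw [h4]; omega⟩
      have h6 := h3.map_up_ble h1 h5
      rw [h4] at h6
      exact hz1 (mul_left_cancel (ble_eq h6 (by omega)))
    · have h1 := llift_up_left hzc.1 hp (by omega)
      rw [h, hp.cancel_left] at h1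
      exact hz1 (ble_eq h1 (by omega))
  obtain ⟨i, j, hi, hj, hiT, hjT, hij⟩ := exists_dihedral_of_coatoms (cs := cs) _ _
    (by rintro rfl; simp at hpT) hco
  have hsT := hij _ (gen_map_one (one_mem hTd.1)) hTd.ble
  have hpK := hij _ hp (ldescent_ble hp hpT)
  obtain ⟨b, hb, hbn⟩ : ∃ b, p * b ≼ T ∧ NonComm φ p b := by
    by_contra! hcon
    exact hTbad (goodAt_of_no_nonComm hp hTd hpT hcon (ble_refl T))
  have hbK : InPar cs {i, j} b := hij.of_ble (ble_trans (ble_gen_mul hp (by have := hbn.lt; omega)) hb)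
  have fin : ∀ k, Gen cs k → ({i, j} : Set W) = {p, k} →
      ∃ k b, Gen cs k ∧ k ≠ p ∧ (p = φ 1 ∨ k = φ 1) ∧ NonComm φ p b ∧ p * b ≼ w ∧
      InPar cs {p, k} b := by
    intro k hk hK
    rw [hK] at hbK hsT
    simp only [Set.mem_insert_iff, Set.mem_singleton_iff] at hsT
    refine ⟨k, b, hk, ?_, hsT.imp Eq.symm Eq.symm, hbn, ble_trans hb hTw, hbK⟩
    rintro rfl
    have hk1 : k = φ 1 := by tauto
    have hb1 : b = 1 := by
      by_contra hne
      obtain ⟨a, ha, hal⟩ := exists_gen_mul_lt (cs := cs) hne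
      have := hbK.ldescent ha (by omega)
      have hak : a = k := by simpa using this
      have := hbn.lt
      rw [hak] at hal; omega
    apply hbn.ne
    rw [hb1, mul_one, hk1]
  simp only [Set.mem_insert_iff, Set.mem_singleton_iff] at hpK
  rcases hpK with rfl | rfl
  · exact fin j hj rfl
  · exact fin i hi (Set.pair_comm _ _)

/-- The structure of a non-commuting pair in a dihedral subgroup. -/
theorem NonComm.structure (hp : Gen cs p) (hk : Gen cs k) (hkp : k ≠ p)
    (hs : φ 1 ∈ ({p, k} : Set W)) (h : NonComm φ p b) (hb : InPar cs {p, k} b) (hb1 : b ≠ 1) :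
    φ (p * b) = k * (p * b) ∧ ℓ (k * (p * b)) = ℓ b + 2 ∧ ℓ (k * b) + 1 = ℓ b ∧
    ∃ c d, Gen cs c ∧ Gen cs d ∧ c ≠ d ∧ ({p, k} : Set W) = {c, d} ∧ φ b = b * c ∧
      ℓ (b * c) = ℓ b + 1 ∧ ℓ (b * d) + 1 = ℓ b := by
  have hpK : InPar cs {p, k} p := InPar.gen hp (by simp)
  have hkK : InPar cs {p, k} k := InPar.gen hk (by simp)
  have hlt := h.lt
  have hup := h.up.2
  have hup' := (h.up_mul hp).2
  have hlm := h.length_mul_map hp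
  have hφb := hb.map h.up.1 hs
  have hφpb := (hpK.mul hb).map h.mem hs
  have ldesc : ∀ z, InPar cs {p, k} z → z ≠ 1 → ℓ z < ℓ (p * z) → ℓ (k * z) + 1 = ℓ z := by
    intro z hz hz1 hpz
    obtain ⟨a, ha, hal⟩ := exists_gen_mul_lt (cs := cs) hz1
    have hm := hz.ldescent ha (by omega)
    simp only [Set.mem_insert_iff, Set.mem_singleton_iff] at hm
    rcases hm with rfl | rfl
    · omega
    · exact hal
  have hne : ∀ z : W, 0 < ℓ z → z ≠ 1 := by rintro z hz rfl; simp at hz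
  have l0 : 0 < ℓ b := Nat.pos_of_ne_zero (by rwa [ne_eq, cs.length_eq_zero_iff])
  have kb := ldesc b hb hb1 (by omega)
  have hpφ : ℓ (φ (p * b)) < ℓ (p * φ (p * b)) := by
    by_contra hcon
    have := hp.mul_length (φ (p * b))
    exact h.ne' (dihedral_ext hφpb (hpK.mul hφb) (by omega) hp (by omega)
      (by rw [hp.cancel_left]; omega))
  have hkφ := ldesc _ hφpb (hne _ (by omega)) hpφ
  have e1 : φ (p * b) = k * (p * b) := by
    have hpd : ℓ (p * (k * φ (p * b))) < ℓ (k * φ (p * b)) := by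
      obtain ⟨a, ha, hal⟩ := exists_gen_mul_lt (cs := cs) (hne (k * φ (p * b)) (by omega))
      have hm := (hkK.mul hφpb).ldescent ha (by omega)
      simp only [Set.mem_insert_iff, Set.mem_singleton_iff] at hm
      rcases hm with rfl | rfl
      · omega
      · rw [ha.cancel_left] at hal; omega
    have := dihedral_ext (hkK.mul hφpb) (hpK.mul hb) (by omega) hp hpd
      (by rw [hp.cancel_left]; omega)
    conv_rhs => rw [← this, hk.cancel_left]
  refine ⟨e1, by rw [← e1]; omega, kb, ?_⟩
  obtain ⟨c, hc, hcl⟩ := exists_mul_gen_lt (cs := cs) (hne (φ b) (by omega))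
  obtain ⟨d, hd, hdl⟩ := exists_mul_gen_lt (cs := cs) hb1
  have hcm := hφb.descent hc (by omega)
  have hdm := hb.descent hd (by omega)
  have e2 : φ b * c = b := by
    have hcK := InPar.gen (cs := cs) hc hcm
    refine dihedral_ext (hφb.mul hcK) hb (by omega) hk ?_ (by omega)
    have := ldesc (φ b * c) (hφb.mul hcK) (hne _ (by omega)) ?_
    · omega
    · have h3 := hc.length_mul (p * φ b)
      rw [mul_assoc] at h3
      omega
  have e3 : φ b = b * c := by conv_rhs => rw [← e2, hc.cancel_right]
  have hcd : c ≠ d := by rintro rfl; rw [← e3] at hdl; omega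
  refine ⟨c, d, hc, hd, hcd, ?_, e3, by rw [← e3]; omega, hdl⟩
  simp only [Set.mem_insert_iff, Set.mem_singleton_iff] at hcm hdm
  rcases hcm with rfl | rfl <;> rcases hdm with rfl | rfl
  · exact absurd rfl hcd
  · rfl
  · exact Set.pair_comm _ _
  · exact absurd rfl hcd

end Matching

section RPolynomials

local notation "ℓ" => CoxeterSystem.length cs
local infix:50 " ≼ " => bruhatLE cs

variable {a b u v w x y z i j p s : W} {R : W → W → Polynomial ℤ} {φ : BSM cs}

theorem rAxioms_inv (hR : RAxioms cs R) : RAxioms cs (fun u v => R u⁻¹ v⁻¹) := by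
  refine ⟨fun u => hR.1 _, fun u v h => hR.2.1 _ _ (fun h' => h (ble_inv_iff.1 h')), ?_, ?_⟩
  · intro i x y hx hy
    have := hR.2.2.2 i x⁻¹ y⁻¹
    rw [← cs.length_inv] at hx hy
    simp only [mul_inv_rev, cs.inv_simple] at hx hy ⊢
    exact this (by rw [hx, cs.length_inv]) (by rw [hy, cs.length_inv])
  · intro i x y hx hy
    have := hR.2.2.1 i x⁻¹ y⁻¹
    rw [← cs.length_inv] at hx hy
    simp only [mul_inv_rev, cs.inv_simple] at hx hy ⊢
    exact this (by rw [hx, cs.length_inv]) (by rw [hy, cs.length_inv])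

theorem R_eq_zero (hR : RAxioms cs R) (h : ¬ u ≼ v) : R u v = 0 := hR.2.1 u v h

theorem R_left (hR : RAxioms cs R) (ha : Gen cs a) (hx : ℓ (a * x) = ℓ x + 1)
    (hy : ℓ (a * y) = ℓ y + 1) :
    R (a * x) (a * y) = R x y ∧ R x (a * y) = (X - 1) * R x y + X * R (a * x) y := by
  obtain ⟨i, rfl⟩ := ha
  exact hR.2.2.1 i x y hx hy

theorem R_right (hR : RAxioms cs R) (ha : Gen cs a) (hx : ℓ (x * a) = ℓ x + 1)
    (hy : ℓ (y * a) = ℓ y + 1) :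
    R (x * a) (y * a) = R x y ∧ R x (y * a) = (X - 1) * R x y + X * R (x * a) y := by
  obtain ⟨i, rfl⟩ := ha
  exact hR.2.2.2 i x y hx hy

/-- The recursion for the `R`-polynomials `R x w` provided by the special matching `φ`. -/
def RRec (R : W → W → Polynomial ℤ) (φ : BSM cs) (w : W) : Prop :=
  ∀ x, Up φ x → R (φ x) w = R x (φ w) ∧
    R x w = (X - 1) * R x (φ w) + X * R (φ x) (φ w)

theorem RRec.of_ble (hR : RAxioms cs R) (hw : Down φ w)
    (h : ∀ x, x ≼ w → Up φ x → R (φ x) w = R x (φ w) ∧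
      R x w = (X - 1) * R x (φ w) + X * R (φ x) (φ w)) : RRec R φ w := by
  intro x hx
  by_cases hxw : x ≼ w
  · exact h x hxw hx
  · have h1 : ¬ φ x ≼ w := fun h => hxw (ble_trans hx.cov.1 h)
    have h2 : ¬ x ≼ φ w := fun h => hxw (ble_trans h hw.cov.1)
    have h3 : ¬ φ x ≼ φ w := fun h => h1 (ble_trans h hw.cov.1)
    simp [R_eq_zero hR hxw, R_eq_zero hR h1, R_eq_zero hR h2, R_eq_zero hR h3]

theorem RRec.of_mul_right (hR : RAxioms cs R) (hs : Gen cs s) (hw : Down φ w)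
    (h : ∀ u, u ≼ w → Up φ u → φ u = u * s) : RRec R φ w := by
  refine RRec.of_ble hR hw fun x hxw hx => ?_
  have h1 := h x hxw hx
  have h2 := h _ hw.cov.1 hw.up
  have h3 := hx.2
  have h4 := hw.2
  rw [φ.invol w hw.1] at h2
  rw [h1] at h3
  have := R_right hR hs h3 (y := φ w) (by rw [← h2]; omega)
  rwa [← h1, ← h2] at this

theorem RRec.of_mirror (h : RRec (fun u v => R u⁻¹ v⁻¹) (mirror φ) w⁻¹) : RRec R φ w := by
  intro x hx
  have := h x⁻¹ (up_mirror.2 (by rwa [inv_inv]))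
  simpa [mirror_apply] using this

/-- The `R`-polynomials of dihedral intervals, as a function of the length. -/
noncomputable def dihedralR : ℕ → Polynomial ℤ
  | 0 => 1
  | 1 => X - 1
  | 2 => (X - 1) * (X - 1)
  | n + 3 => (X - 1) * dihedralR (n + 2) + X * dihedralR (n + 1)

theorem R_eq_dihedralR (hR : RAxioms cs R) (hw : InPar cs {i, j} w) (hx : x ≼ w) : R x w = dihedralR (ℓ w - ℓ x) := by
  induction w using left_induction cs generalizing x with
  | one =>
    have : x = 1 := ble_eq hx (by simp)
    subst this
    simp [hR.1, dihedralR]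
  | mul y a ha hl ih =>
    have hya : y ≼ a * y := ble_gen_mul ha (by omega)
    have hy := hw.of_ble hya
    have hxK := hw.of_ble hx
    have haK : InPar cs {i, j} a := InPar.gen ha (hw.ldescent ha (by rw [ha.cancel_left]; omega))
    rcases ha.mul_length x with h | h
    · have hxy : x ≼ y := by
        have := llift_down_right hx ha (by omega)
        rwa [ha.cancel_left] at this
      have hlxy := ble_length_le hxy
      have := (R_left hR ha h hl).2
      rw [this, ih hy hxy]
      by_cases h2 : ℓ x + 2 ≤ ℓ y
      · have h3 : a * x ≼ y := dihedral_ble (haK.mul hxK) hy (by omega)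
        rw [ih hy h3, hl, h]
        obtain ⟨n, hn⟩ := Nat.exists_eq_add_of_le h2
        have e1 : ℓ y + 1 - ℓ x = n + 3 := by omega
        have e2 : ℓ y - ℓ x = n + 2 := by omega
        have e3 : ℓ y - (ℓ x + 1) = n + 1 := by omega
        rw [e1, e2, e3, dihedralR]
      · have h3 : ¬ a * x ≼ y := by
          intro h3
          have := ble_eq h3 (by omega)
          rw [← this, ha.cancel_left] at hl
          omega
        rw [R_eq_zero hR h3, hl]
        obtain e | e : ℓ y - ℓ x = 0 ∨ ℓ y - ℓ x = 1 := by omega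
        · have e1 : ℓ y + 1 - ℓ x = 1 := by omega
          rw [e, e1]; simp [dihedralR]
        · have e1 : ℓ y + 1 - ℓ x = 2 := by omega
          rw [e, e1]; simp [dihedralR]
    · have hxy : a * x ≼ y := by
        have := llift_down_down hx ha (by omega)
        rwa [ha.cancel_left] at this
      have := (R_left hR ha (x := a * x) (by rw [ha.cancel_left]; omega) hl).1
      rw [ha.cancel_left] at this
      rw [this, ih hy hxy]
      congr 1; omega

theorem RRec.of_dihedral (hR : RAxioms cs R) (hK : InPar cs {i, j} w) (hw : Down φ w) : RRec R φ w := by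
  refine RRec.of_ble hR hw fun x hxw hx => ?_
  have h1 := hw.map_up_ble hxw hx
  have h2 := hw.ble_map hxw hx
  have hφw := hK.of_ble hw.cov.1
  have l1 := hw.2
  have l2 := hx.2
  have l3 := ble_length_le h2
  have key := fun {u v} => R_eq_dihedralR (cs := cs) (w := v) (x := u) (i := i) (j := j) hR
  rw [key hK h1, key hφw h2, key hK hxw]
  refine ⟨by congr 1; omega, ?_⟩
  by_cases h : ℓ x + 2 ≤ ℓ (φ w)
  · have h3 : φ x ≼ φ w := dihedral_ble (hK.of_ble h1) hφw (by omega)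
    rw [key hφw h3]
    obtain ⟨n, hn⟩ := Nat.exists_eq_add_of_le h
    have e1 : ℓ w - ℓ x = n + 3 := by omega
    have e2 : ℓ (φ w) - ℓ x = n + 2 := by omega
    have e3 : ℓ (φ w) - ℓ (φ x) = n + 1 := by omega
    rw [e1, e2, e3, dihedralR]
  · have h3 : ¬ φ x ≼ φ w := by
      intro h3
      have := map_inj hx.1 hw.1 (ble_eq h3 (by omega))
      rw [this] at hx
      exact hx.not_down hw
    rw [R_eq_zero hR h3]
    obtain e | e : ℓ (φ w) - ℓ x = 0 ∨ ℓ (φ w) - ℓ x = 1 := by omega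
    · have e1 : ℓ w - ℓ x = 1 := by omega
      rw [e, e1]; simp [dihedralR]
    · have e1 : ℓ w - ℓ x = 2 := by omega
      rw [e, e1]; simp [dihedralR]

/-- A left descent `p` of `w` such that left multiplication by `p` commutes with `φ` below `w`. -/
def HasGoodLeft (φ : BSM cs) (w : W) : Prop :=
  ∃ p, Gen cs p ∧ cs.length (p * w) < cs.length w ∧ p * w ≠ φ w ∧
    ∀ u, bruhatLE cs u w → GoodAt φ p u

theorem RRec.of_hasGoodLeft (hR : RAxioms cs R) (hw : Down φ w) (h : HasGoodLeft φ w)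
    (ih : ∀ v, ℓ v < ℓ w → Down φ v → RRec R φ v) : RRec R φ w := by
  obtain ⟨p, hp, hpw, hne, hgood⟩ := h
  have hpwlt : ℓ (p * w) + 1 = ℓ w := by rcases hp.mul_length w with h | h <;> omega
  have lw := hw.2
  have hφpw : φ (p * w) = p * φ w := (hgood w (ble_refl w)).resolve_right (Ne.symm hne)
  have hpφ : ℓ (p * φ w) + 1 = ℓ (φ w) := hw.cov.ldescent hp hpw hne.symm
  obtain ⟨v, rfl⟩ : ∃ v, w = p * v := ⟨p * w, (hp.cancel_left w).symm⟩
  rw [hp.cancel_left] at hφpw hpw hpwlt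
  have hv : Down φ v := ⟨φ.ideal hw.1 (ble_gen_mul hp hpw), by rw [hφpw]; omega⟩
  have e1 : φ (p * v) = p * φ v := by rw [hφpw, hp.cancel_left]
  have hlv' : ℓ (p * φ v) = ℓ (φ v) + 1 := by
    rw [← e1]; have := congrArg ℓ hφpw; omega
  have hlv : ℓ (p * v) = ℓ v + 1 := hpwlt.symm
  have IH := ih v hpw hv
  refine RRec.of_ble hR hw fun x hxw hx => ?_
  have lx := hx.2
  have hxd := hx.1
  have hpx : p * x ≼ p * v := llift_up_left hxw hp (by rw [hp.cancel_left]; omega)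
  rw [e1]
  by_cases hφp : φ x ≠ p * x
  · have hg := (hgood x hxw).resolve_right hφp
    rcases hp.mul_length x with h | h
    · by_cases hφx : ℓ (p * φ x) = ℓ (φ x) + 1
      · have hpxu : Up φ (p * x) := ⟨φ.ideal hw.1 hpx, by rw [hg]; omega⟩
        obtain ⟨i1, i2⟩ := IH x hx
        obtain ⟨j1, j2⟩ := IH _ hpxu
        rw [hg] at j1 j2
        have a1 := (R_left hR hp hφx hlv).2
        have a2 := (R_left hR hp h hlv').2
        have a3 := (R_left hR hp h hlv).2
        have a4 := (R_left hR hp hφx hlv').2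
        constructor
        · rw [a1, a2, i1, j1]
        · rw [a3, a2, a4, i2, j2]; ring
      · have h1 := hp.mul_length (φ x)
        exact absurd (hx.cov.eq_gen_mul hp (by omega) (by omega)) hφp
    · have hpxd : p * x ∈ φ.dom := φ.ideal hw.1 hpx
      have hpxu : Up φ (p * x) := by
        refine (up_or_down hpxd).resolve_right fun hd => ?_
        have := hd.2
        rw [hg] at this
        rcases hp.mul_length (φ x) with h | h <;> omega
      have l1 := hpxu.2
      obtain ⟨x, rfl⟩ : ∃ y, x = p * y := ⟨p * x, (hp.cancel_left x).symm⟩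
      rw [hp.cancel_left] at hg h hpxu l1
      have hgg : φ (p * x) = p * φ x := by rw [hg, hp.cancel_left]
      rw [hgg] at lx ⊢
      obtain ⟨i1, i2⟩ := IH x hpxu
      have a1 := (R_left hR hp (x := φ x) (y := v) (by omega) hlv).1
      have a2 := (R_left hR hp (x := x) (y := v) (by omega) hlv).1
      have a3 := (R_left hR hp (x := φ x) (y := φ v) (by omega) hlv').1
      have a4 := (R_left hR hp (x := x) (y := φ v) (by omega) hlv').1
      rw [a1, a2, a3, a4]
      exact ⟨i1, i2⟩
  · obtain ⟨i1, i2⟩ := IH x hx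
    rw [not_not.1 hφp] at i1 i2 lx ⊢
    obtain ⟨a1, a2⟩ := R_left hR hp lx hlv
    obtain ⟨b1, b2⟩ := R_left hR hp lx hlv'
    constructor
    · rw [a1, b2, i2]
    · rw [a2, b2, b1, i1, i2]

/-- The structure of special matchings needed for the recursion of the `R`-polynomials. -/
def Tractable (φ : BSM cs) (w : W) : Prop :=
  (∃ s, Gen cs s ∧ ∀ u, bruhatLE cs u w → Up φ u → φ u = u * s) ∨
  (∃ i j, InPar cs {i, j} w) ∨ HasGoodLeft φ w

theorem RRec.of_tractable
    (ht : ∀ (φ : BSM cs) (w : W), Down φ w → Tractable φ w ∨ Tractable (mirror φ) w⁻¹)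
    (hR : RAxioms cs R) (hw : Down φ w) : RRec R φ w := by
  have main : ∀ n (R : W → W → Polynomial ℤ) (φ : BSM cs) (w : W), RAxioms cs R → Down φ w →
      ℓ w = n → RRec R φ w := by
    intro n
    induction n using Nat.strong_induction_on with
    | _ n ih =>
      have step : ∀ (R : W → W → Polynomial ℤ) (φ : BSM cs) (w : W), RAxioms cs R → Down φ w →
          ℓ w = n → Tractable φ w → RRec R φ w := by
        rintro R φ w hR hw hn (⟨s, hs, h⟩ | ⟨i, j, h⟩ | h)
        · exact RRec.of_mul_right hR hs hw h
        · exact RRec.of_dihedral hR h hw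
        · exact RRec.of_hasGoodLeft hR hw h fun v hv hvd => ih _ (by omega) R φ v hR hvd rfl
      intro R φ w hR hw hn
      rcases ht φ w hw with h | h
      · exact step R φ w hR hw hn h
      · exact RRec.of_mirror (step _ _ _ (rAxioms_inv hR) (down_mirror.2 (by rwa [inv_inv]))
          (by rw [cs.length_inv, hn]) h)
  exact main _ R φ w hR hw rfl

end RPolynomials

section Local

local notation "ℓ" => CoxeterSystem.length cs
local infix:50 " ≼ " => bruhatLE cs

variable {a b b' b'' c d u v w x y z g h r p q k s t A : W} {J K : Set W} {φ : BSM cs}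

theorem inPar_singleton (h : InPar cs {k} g) : g = 1 ∨ g = k := by
  induction g using right_induction cs with
  | one => exact Or.inl rfl
  | mul g a ha hl ih =>
    have hak : a = k := h.descent ha (by rw [ha.cancel_right]; omega)
    subst hak
    rcases ih (h.of_ble (ble_mul_gen ha (by omega))) with rfl | rfl
    · right; simp
    · rw [ha.mul_self, cs.length_one] at hl; omega

theorem gen_ble_of_two_le (hg : InPar cs {p, k} g) (hk : Gen cs k) (hl : 2 ≤ ℓ g) : p ≼ g := by
  by_contra hp
  have : InPar cs {k} g := by
    intro a ha hag
    rcases hg a ha hag with rfl | h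
    · exact absurd hag hp
    · exact h
  rcases inPar_singleton this with rfl | rfl
  · simp at hl
  · rw [hk.length] at hl; omega

theorem comm_letters_of_comm (hr : Gen cs r) (hrK : r ∉ K) (hg : InPar cs K g)
    (h : r * g = g * r) : ∀ a, Gen cs a → a ≼ g → r * a = a * r := by
  refine extract_left hr hrK hg InPar.one (by simp) ?_
  rw [mul_one, ← h, hr.cancel_left, h, hg.length_mul hr hrK]
  omega

theorem NonComm.insert_lengths (hp : Gen cs p) (h : NonComm φ p b) (hb : InPar cs {p, k} b)
    (hr : Gen cs r) (hrK : r ∉ ({p, k} : Set W))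
    (hbb : b = b' * b'') (hl : ℓ b = ℓ b' + ℓ b'') (hu : u = b' * r * b'') :
    InPar cs {p, k} b' ∧ InPar cs {p, k} b'' ∧ ℓ u = ℓ b + 1 ∧ ℓ (p * u) = ℓ b + 2 ∧ r ≼ u ∧
      b ≼ u ∧ u ≼ p * u ∧ p * b ≼ p * u ∧ InPar cs (insert r {p, k}) u := by
  have hlt := h.lt
  have hpK : InPar cs {p, k} p := InPar.gen hp (by simp)
  obtain ⟨hb', hb''⟩ := (inPar_mul_iff (J := {p, k}) (by rw [← hbb, hl])).1 (hbb ▸ hb)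
  have hpb' : ℓ (p * b') = ℓ b' + 1 := by
    have h1 := cs.length_mul_le (p * b') b''
    rw [mul_assoc, ← hbb] at h1
    rcases hp.mul_length b' with h | h <;> omega
  have lu : ℓ u = ℓ b + 1 := by
    rw [hu, length_insert hr hrK hb' hb'' (by rw [← hbb, hl]), hl]; omega
  have hpu : p * u = p * b' * r * b'' := by simp only [hu, mul_assoc]
  have lpu : ℓ (p * u) = ℓ b + 2 := by
    rw [hpu, length_insert hr hrK (hpK.mul hb') hb'' (by rw [mul_assoc, ← hbb]; omega), hpb', hl]
    omega
  have lbr : ℓ (b' * r) = ℓ b' + 1 := hb'.length_mul hr hrK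
  have hru : r ≼ u := ble_trans (descent_ble (w := b' * r) hr (by rw [hr.cancel_right]; omega))
    (by rw [hu]; exact ble_left_mul (by rw [← hu, lu, lbr]; omega))
  have hbu : b ≼ u := by
    rw [hbb, hu]
    exact ble_mul_mono (by rw [← hu, lu, lbr]; omega) (ble_mul_gen hr (by omega)) (ble_refl _)
  have hupu : u ≼ p * u := ble_gen_mul hp (by omega)
  have hpbpu : p * b ≼ p * u := llift_up_up hbu hp (by omega)
  refine ⟨hb', hb'', lu, lpu, hru, hbu, hupu, hpbpu, ?_⟩
  rw [hu]
  exact ((hb'.mono (Set.subset_insert _ _)).mul (InPar.gen hr (Set.mem_insert _ _))).mul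
    (hb''.mono (Set.subset_insert _ _))

theorem NonComm.insert_up (hp : Gen cs p)
    (hs : φ 1 ∈ ({p, k} : Set W)) (h : NonComm φ p b) (hb : InPar cs {p, k} b)
    (hr : Gen cs r) (hrK : r ∉ ({p, k} : Set W))
    (lu : ℓ u = ℓ b + 1) (lpu : ℓ (p * u) = ℓ b + 2) (hru : r ≼ u)
    (hbu : b ≼ u) (hupu : u ≼ p * u) (hpbpu : p * b ≼ p * u) (hmem : p * u ∈ φ.dom) :
    Up φ u ∧ Up φ (p * u) := by
  have hlt := h.lt
  have hpK : InPar cs {p, k} p := InPar.gen hp (by simp)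
  have notK : ∀ {z}, u ≼ z → ¬ InPar cs {p, k} z := fun hz hzK =>
    hrK (hzK r hr (ble_trans hru hz))
  have hbup := h.up
  have hpbup := h.up_mul hp
  have hφb : InPar cs {p, k} (φ b) := hb.map hbup.1 hs
  have hφpb : InPar cs {p, k} (φ (p * b)) := (hpK.mul hb).map hpbup.1 hs
  have lb := hbup.2
  have lpb := hpbup.2
  have hup : Up φ u := by
    refine (up_or_down (φ.ideal hmem hupu)).resolve_right fun hd => ?_
    have := ble_eq (hd.map_up_ble hbu hbup) (by omega)
    rw [this] at hφb
    exact notK (ble_refl _) hφb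
  have hpup : Up φ (p * u) := by
    refine (up_or_down hmem).resolve_right fun hd => ?_
    have := ble_eq (hd.map_up_ble hpbpu hpbup) (by omega)
    rw [this] at hφpb
    exact notK hupu hφpb
  exact ⟨hup, hpup⟩

theorem NonComm.insert_left (hp : Gen cs p) (hk : Gen cs k) (hkp : k ≠ p)
    (hs : φ 1 ∈ ({p, k} : Set W)) (h : NonComm φ p b) (hb : InPar cs {p, k} b) (hb1 : b ≠ 1)
    (hr : Gen cs r) (hrK : r ∉ ({p, k} : Set W))
    (lu : ℓ u = ℓ b + 1) (lpu : ℓ (p * u) = ℓ b + 2) (hru : r ≼ u)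
    (hupu : u ≼ p * u) (hpbpu : p * b ≼ p * u)
    (huK : InPar cs (insert r {p, k}) u) (hpup : Up φ (p * u)) :
    ℓ (r * (p * u)) < ℓ (p * u) ∨
      (φ (p * u) = k * (p * u) ∧ ℓ (k * (p * u)) = ℓ b + 3) := by
  obtain ⟨e1, e2, -⟩ := h.structure hp hk hkp hs hb hb1
  have hlt := h.lt
  have hmem := hpup.1
  have hpK : InPar cs {p, k} p := InPar.gen hp (by simp)
  have notK : ∀ {z}, u ≼ z → ¬ InPar cs {p, k} z := fun hz hzK =>
    hrK (hzK r hr (ble_trans hru hz))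
  have hbup := h.up
  have hpbup := h.up_mul hp
  have hφb : InPar cs {p, k} (φ b) := hb.map hbup.1 hs
  have hφpb : InPar cs {p, k} (φ (p * b)) := (hpK.mul hb).map hpbup.1 hs
  have lb := hbup.2
  have lpb := hpbup.2
  have lZ := hpup.2
  have hZ : φ (p * b) ≼ φ (p * u) := hpup.map_ble hpbpu hpbup
  have hne : ∀ z : W, 0 < ℓ z → z ≠ 1 := by rintro z hz rfl; simp at hz
  have hk_pu : ℓ (k * (p * u)) = ℓ b + 3 := by
    rcases hk.mul_length (p * u) with h1 | h1
    · omega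
    · exfalso
      obtain ⟨P, A, -, -, -, -, -, -, hall⟩ := exists_dihedral_factor (u := p * u) hkp.symm hp hk
        (by rw [hp.cancel_left]; omega) (by omega)
      have := ble_eq (hall _ hφpb).2 (by omega)
      rw [this] at hφpb
      exact notK hupu hφpb
  obtain ⟨a, ha, hal⟩ := exists_gen_mul_lt (cs := cs) (hne (φ (p * u)) (by omega))
  have haK := (((hpK.mono (Set.subset_insert _ _)).mul huK).map hmem
    (Set.mem_insert_of_mem _ hs)).ldescent ha (by omega)
  have hZcov : Cov cs (φ (p * b)) (φ (p * u)) := ⟨hZ, by omega⟩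
  rcases haK with rfl | haK
  · left
    have h1 := hZcov.eq_gen_mul ha (by omega) (by rw [hφpb.mul_length ha hrK]; omega)
    by_contra hcon
    have h2 : φ (p * u) = a * (p * u) := hpup.cov.eq_gen_mul ha (by omega)
      (by rcases ha.mul_length (p * u) with h | h <;> omega)
    have h3 := mul_left_cancel (h1.symm.trans h2)
    rw [h3] at hφpb
    exact notK hupu hφpb
  by_cases hap : a = p
  · exfalso
    subst hap
    rcases ha.mul_length (φ (a * b)) with h1 | h1
    · have h2 := hZcov.eq_gen_mul ha (by omega) (by omega)
      have h3 := hpK.mul hφpb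
      rw [← h2] at h3
      exact notK (ble_trans hupu hpup.cov.1) h3
    · have h2 := hpK.mul hφb
      have h3 := h.length_mul_map hp
      have hk_desc : ℓ (k * φ (a * b)) < ℓ (φ (a * b)) := by rw [e1, hk.cancel_left]; omega
      refine h.ne' (dihedral_ext hφpb h2 (by omega) ha (by omega) ?_)
      rw [ha.cancel_left]; omega
  have hak : a = k := by
    simp only [Set.mem_insert_iff, Set.mem_singleton_iff] at haK; tauto
  subst hak
  have eZ : φ (p * u) = a * (p * u) := hpup.cov.eq_gen_mul ha (by omega) (by omega)
  exact Or.inr ⟨eZ, hk_pu⟩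

set_option maxHeartbeats 1000000 in
/-- Inserting a letter outside a dihedral subgroup in a non-commuting pair of that subgroup. -/
theorem NonComm.insert_letter (hp : Gen cs p) (hk : Gen cs k) (hkp : k ≠ p)
    (hs : φ 1 ∈ ({p, k} : Set W)) (h : NonComm φ p b) (hb : InPar cs {p, k} b) (hb1 : b ≠ 1)
    (hr : Gen cs r) (hrK : r ∉ ({p, k} : Set W)) (hrc : ¬ (r * p = p * r ∧ r * k = k * r))
    (hbb : b = b' * b'') (hl : ℓ b = ℓ b' + ℓ b'') (hu : u = b' * r * b'')
    (hmem : p * u ∈ φ.dom) :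
    ℓ (r * (p * u)) < ℓ (p * u) ∨
      (φ (p * u) = k * (p * u) ∧ φ u = φ b * r ∧ Up φ (p * u) ∧ Up φ u) := by
  obtain ⟨hb', hb'', lu, lpu, hru, hbu, hupu, hpbpu, huK⟩ :=
    h.insert_lengths hp hb hr hrK hbb hl hu
  obtain ⟨hup, hpup⟩ := h.insert_up hp hs hb hr hrK lu lpu hru hbu hupu hpbpu hmem
  refine (h.insert_left hp hk hkp hs hb hb1 hr hrK lu lpu hru hupu hpbpu huK hpup).imp_right ?_
  rintro ⟨eZ, hk_pu⟩
  refine ⟨eZ, ?_, hpup, hup⟩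
  obtain ⟨e1, e2, -, c, d, hc, hd, hcd, hKcd, e3, e4, e5⟩ := h.structure hp hk hkp hs hb hb1
  have hpK : InPar cs {p, k} p := InPar.gen hp (by simp)
  have hkK : InPar cs {p, k} k := InPar.gen hk (by simp)
  have hcK : InPar cs {p, k} c := InPar.gen hc (by simp [hKcd])
  have hdK : InPar cs {p, k} d := InPar.gen hd (by simp [hKcd])
  have notK : ∀ {z}, u ≼ z → ¬ InPar cs {p, k} z := fun hz hzK =>
    hrK (hzK r hr (ble_trans hru hz))
  have hφb : InPar cs {p, k} (φ b) := hb.map h.up.1 hs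
  have lb := h.up.2
  have lX := hup.2
  have hX : φ b ≼ φ u := hup.map_ble hbu h.up
  have hXZ : φ u ≼ φ (p * u) := hpup.map_ble hupu hup
  have hne : ∀ z : W, 0 < ℓ z → z ≠ 1 := by rintro z hz rfl; simp at hz
  have hKsw : ∀ {z}, InPar cs {p, k} z → InPar cs {c, d} z := fun hz => by rwa [← hKcd]
  -- right descents of the image of `u`
  have hXcov : Cov cs (φ b) (φ u) := ⟨hX, by omega⟩
  have Xd : ¬ ℓ (φ u * d) < ℓ (φ u) := by
    intro h1
    rcases hd.length_mul (φ b) with h2 | h2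
    · have h3 := hXcov.eq_mul_gen hd h1 (by omega)
      have h4 := hφb.mul hdK
      rw [← h3] at h4
      exact notK hup.cov.1 h4
    · have h3 := dihedral_longest (y := (φ b)⁻¹) (g := (p * φ b)⁻¹) hcd hc hd (hKsw hφb.inv)
        (by rw [hc.length_mul_inv, cs.length_inv, e3, hc.cancel_right]; omega)
        (by rw [hd.length_mul_inv, cs.length_inv]; omega) (hKsw (hpK.mul hφb).inv)
      have h4 := h.length_mul_map hp
      simp only [cs.length_inv] at h3
      omega
  have Xr : ℓ (φ u * r) < ℓ (φ u) → φ u = φ b * r := fun h1 =>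
    hXcov.eq_mul_gen hr h1 (by rw [hφb.length_mul hr hrK]; omega)
  obtain ⟨j, hj, hjl⟩ := exists_mul_gen_lt (cs := cs) (hne (φ u) (by omega))
  have hjK := (huK.map hup.1 (Set.mem_insert_of_mem _ hs)).descent hj (by omega)
  rcases hjK with rfl | hjK
  · exact Xr (by omega)
  rw [hKcd] at hjK
  by_cases hjd : j = d
  · subst hjd; exact absurd (by omega) Xd
  have hjc : j = c := by
    simp only [Set.mem_insert_iff, Set.mem_singleton_iff] at hjK; tauto
  subst hjc
  have u_desc : b'' ≠ 1 → ∀ x₁ : W, ℓ (x₁ * r * b'') = ℓ x₁ + 1 + ℓ b'' →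
      ℓ (x₁ * r * b'' * d) < ℓ (x₁ * r * b'') := by
    intro hb1'' x₁ hx₁
    obtain ⟨e, he, hel⟩ := exists_mul_gen_lt (cs := cs) hb1''
    have heK := hb''.descent he (by omega)
    rw [hKcd] at heK
    have hed : e = d := by
      by_contra hne
      have hec : e = j := by
        simp only [Set.mem_insert_iff, Set.mem_singleton_iff] at heK; tauto
      subst hec
      have h1 := cs.length_mul_le b' (b'' * e)
      rw [← mul_assoc, ← hbb] at h1
      omega
    subst hed
    have h1 := cs.length_mul_le (x₁ * r) (b'' * e)
    have h2 := cs.length_mul_le x₁ r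
    rw [← mul_assoc] at h1
    have := hr.length
    omega
  have hu_c : ℓ (u * j) = ℓ u + 1 := by
    rcases hj.length_mul u with h1 | h1
    · exact h1
    exfalso
    by_cases hb1'' : b'' = 1
    · subst hb1''
      rw [mul_one] at hbb
      subst hbb
      have hbr : u = b * r := by rw [hu, mul_one]
      have h2 := (two_ldescents (u := u⁻¹) hj hr (by rintro rfl; exact hrK (hKcd ▸ hjK))
        (by rw [hj.length_mul_inv, cs.length_inv]; omega)
        (by rw [hr.length_mul_inv, cs.length_inv, hbr, hr.cancel_right, ← hbr]; omega)).1
      have h3 : r * u⁻¹ = b⁻¹ := by rw [hbr, mul_inv_rev, hr.inv, hr.cancel_left]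
      rw [h3, hj.length_mul_inv, cs.length_inv] at h2
      omega
    · have h2 := u_desc hb1'' b' (by rw [← hu, lu]; omega)
      rw [← hu] at h2
      obtain ⟨P, A, -, -, -, -, -, -, hall⟩ := exists_dihedral_factor (u := u⁻¹) hcd hj hd
        (by rw [hj.length_mul_inv, cs.length_inv]; omega)
        (by rw [hd.length_mul_inv, cs.length_inv]; omega)
      have h3 := ble_inv_iff.1 (hall (φ b)⁻¹ (hKsw hφb.inv)).2
      have h4 := ble_eq h3 (by omega)
      rw [h4] at hφb
      exact notK (ble_refl _) hφb
  have eX : φ u = u * j := hup.cov.eq_mul_gen hj (by omega) (by omega)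
  -- compare the two images
  have lkpb' : ℓ (k * (p * b') * r * b'') = ℓ b + 3 := by
    rw [← hk_pu]; congr 1; simp only [hu, mul_assoc]
  have lkp : ℓ (k * (p * b')) = ℓ b' + 2 ∧ ℓ (r * b'') = ℓ b'' + 1 := by
    have h1 := cs.length_mul_le (k * (p * b')) (r * b'')
    have h2 := cs.length_mul_le k (p * b')
    have h3 := cs.length_mul_le r b''
    have h4 := cs.length_mul_le p b'
    have := hp.length
    have := hk.length
    have := hr.length
    rw [← mul_assoc] at h1
    omega
  rw [eX, eZ] at hXZ
  have hZs : k * (p * u) = k * (p * b') * (r * b'') := by simp only [hu, mul_assoc]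
  rw [hZs] at hXZ
  have hnK : ∀ {z}, InPar cs {p, k} z → u * j ≠ z := by
    rintro z hz rfl
    exact notK (ble_mul_gen hj (by omega)) hz
  obtain ⟨x₁, y, hxy, hx₁, hy, hly⟩ := ble_mul_split (by
    rw [← mul_assoc, lkpb', lkp.1, lkp.2]; omega) hXZ
  obtain ⟨y₁, x₃, hyy, hy₁, hx₃, hly'⟩ := ble_mul_split (by rw [lkp.2, hr.length]; omega) hy
  have hx₁K := (hkK.mul (hpK.mul hb')).of_ble hx₁
  have hx₃K := hb''.of_ble hx₃
  rcases ble_gen hr hy₁ with hy1 | hy1 <;> rw [hy1] at hyy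
  · rw [one_mul] at hyy
    exact absurd (by rw [hxy, hyy]) (hnK (hx₁K.mul hx₃K))
  have l1 := ble_length_le hx₁
  have l3 := ble_length_le hx₃
  have lr := hr.length
  rw [hyy, ← mul_assoc] at hxy
  rw [hyy] at hly
  have lt : ℓ x₁ + 1 + ℓ x₃ = ℓ b + 2 := by
    rw [← eX] at hly; rw [hyy, hy1] at hly'; omega
  by_cases hA : ℓ x₃ = ℓ b''
  · have := ble_eq hx₃ hA.ge
    subst this
    by_cases hb1'' : x₃ = 1
    · subst hb1''
      rw [mul_one] at hxy
      apply Xr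
      rw [eX, hxy, hr.cancel_right]
      have := congrArg ℓ hxy
      simp only [cs.length_one] at lt
      omega
    · have h1 := u_desc hb1'' x₁ (by rw [← hxy]; omega)
      rw [← hxy, ← eX] at h1
      exact absurd h1 Xd
  · exfalso
    have hx₁e := ble_eq hx₁ (by omega)
    set g := x₃ * (b'' * j)⁻¹ with hg
    have hgK : InPar cs {p, k} g := hx₃K.mul (hb''.mul hcK).inv
    have h1 : x₁ * r * g = b' * r := by
      rw [hg, ← mul_assoc, ← hxy, hu]; group
    have h2 : r * g * r = x₁⁻¹ * b' := by
      have : r * g = x₁⁻¹ * b' * r := by rw [mul_assoc, ← h1]; group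
      rw [this, hr.cancel_right]
    have hcomm := comm_of_conj_mem hr hrK hgK (by rw [h2]; exact hx₁K.inv.mul hb')
    have hlet := comm_letters_of_comm hr hrK hgK hcomm
    have h3 : g = x₁⁻¹ * b' := by rw [← h2, hcomm, hr.cancel_right]
    have h4 : 2 ≤ ℓ g := by
      have h5 := cs.length_mul_le b' g⁻¹
      have h6 : b' * g⁻¹ = x₁ := by rw [h3]; group
      rw [h6, cs.length_inv, hx₁e, lkp.1] at h5
      omega
    exact hrc ⟨hlet p hp (gen_ble_of_two_le hgK hk h4),
      hlet k hk (gen_ble_of_two_le (by rwa [Set.pair_comm]) hp h4)⟩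

end Local

section Types

local notation "ℓ" => CoxeterSystem.length cs
local infix:50 " ≼ " => bruhatLE cs

variable {a b b' b'' c d u v w x y z g h r p q k s t A : W} {J K : Set W} {φ : BSM cs}

/-- A letter on which `φ` acts by right multiplication only. -/
def IsR (φ : BSM cs) (q : W) : Prop :=
  Gen cs q ∧ q ∈ φ.dom ∧ φ q = q * φ 1 ∧ q * φ 1 ≠ φ 1 * q

/-- A letter on which `φ` acts by left multiplication only. -/
def IsL (φ : BSM cs) (q : W) : Prop :=
  Gen cs q ∧ q ∈ φ.dom ∧ φ q = φ 1 * q ∧ q * φ 1 ≠ φ 1 * q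

/-- A letter commuting with `φ 1`. -/
def IsC (φ : BSM cs) (q : W) : Prop :=
  Gen cs q ∧ q ∈ φ.dom ∧ q ≠ φ 1 ∧ q * φ 1 = φ 1 * q

theorem IsR.ne (h : IsR φ q) : q ≠ φ 1 := fun h' => h.2.2.2 (by rw [h'])

theorem IsL.ne (h : IsL φ q) : q ≠ φ 1 := fun h' => h.2.2.2 (by rw [h'])

theorem isR_mirror : IsR (mirror φ) q ↔ IsL φ q := by
  unfold IsR IsL
  refine and_congr_right fun hq => ?_
  rw [mem_mirror, hq.inv, mirror_one, mirror_apply, hq.inv]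
  refine and_congr_right fun hqd => ?_
  have hs := gen_map_one (one_mem hqd)
  rw [hs.inv, inv_eq_iff_eq_inv, mul_inv_rev, hq.inv, hs.inv]

theorem isL_mirror : IsL (mirror φ) q ↔ IsR φ q := by
  unfold IsR IsL
  refine and_congr_right fun hq => ?_
  rw [mem_mirror, hq.inv, mirror_one, mirror_apply, hq.inv]
  refine and_congr_right fun hqd => ?_
  have hs := gen_map_one (one_mem hqd)
  rw [hs.inv, inv_eq_iff_eq_inv, mul_inv_rev, hq.inv, hs.inv]

theorem isC_mirror : IsC (mirror φ) q ↔ IsC φ q := by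
  unfold IsC
  refine and_congr_right fun hq => ?_
  rw [mem_mirror, hq.inv, mirror_one]
  refine and_congr_right fun hqd => ?_
  rw [(gen_map_one (one_mem hqd)).inv]

theorem eq_mul_of_length_two (hp : Gen cs p) (hq : Gen cs q) (hpq : p ≠ q) (hl : ℓ u = 2)
    (h1 : p ≼ u) (h2 : q ≼ u) : u = p * q ∨ u = q * p := by
  obtain ⟨a, ha, hal⟩ := exists_mul_gen_lt (cs := cs) (w := u) (by rintro rfl; simp at hl)
  obtain ⟨b, hb, hbl⟩ := exists_mul_gen_lt (cs := cs) (w := u * a)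
    (by intro h; rw [h, cs.length_one] at hal; omega)
  have h3 : u * a * b = 1 := by rw [← cs.length_eq_zero_iff]; omega
  have h4 : u = b * a := by
    rw [← ha.cancel_right u, ← hb.cancel_right (u * a), h3, one_mul]
  rw [h4] at h1 h2 ⊢
  rcases gen_ble_mul hp h1 with h | h <;> rcases gen_ble_mul hq h2 with h' | h'
  · exact absurd ((hp.eq_of_ble hb h).trans (hq.eq_of_ble hb h').symm) hpq
  · left; rw [hp.eq_of_ble hb h, hq.eq_of_ble ha h']
  · right; rw [hp.eq_of_ble ha h, hq.eq_of_ble hb h']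
  · exact absurd ((hp.eq_of_ble ha h).trans (hq.eq_of_ble ha h').symm) hpq

theorem map_gen (hq : Gen cs q) (hqd : q ∈ φ.dom) (hne : q ≠ φ 1) :
    φ q = q * φ 1 ∨ φ q = φ 1 * q := by
  have hup := gen_up hq hqd hne
  have h2 := hup.2
  rw [hq.length] at h2
  exact eq_mul_of_length_two hq (gen_map_one (one_mem hqd)) hne h2 hup.cov.1 hup.down.ble

theorem letter_cases (hq : Gen cs q) (hqd : q ∈ φ.dom) :
    q = φ 1 ∨ IsC φ q ∨ IsR φ q ∨ IsL φ q := by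
  by_cases hne : q = φ 1
  · exact Or.inl hne
  by_cases hc : q * φ 1 = φ 1 * q
  · exact Or.inr (Or.inl ⟨hq, hqd, hne, hc⟩)
  rcases map_gen hq hqd hne with h | h
  · exact Or.inr (Or.inr (Or.inl ⟨hq, hqd, h, hc⟩))
  · exact Or.inr (Or.inr (Or.inr ⟨hq, hqd, h, hc⟩))

theorem IsC.map (h : IsC φ q) : φ q = q * φ 1 := by
  rcases map_gen h.1 h.2.1 h.2.2.1 with h' | h'
  · exact h'
  · rw [h', h.2.2.2]

theorem IsC.up (h : IsC φ q) : Up φ q := gen_up h.1 h.2.1 h.2.2.1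

theorem IsR.up (h : IsR φ q) : Up φ q := gen_up h.1 h.2.1 h.ne

/-- Letters commuting with `φ 1` are good. -/
theorem IsC.goodAt (hC : IsC φ p) (hw : Down φ w) (hpw : ℓ (p * w) < ℓ w) (hu : u ≼ w) :
    GoodAt φ p u := by
  by_contra hbad
  obtain ⟨k, b, hk, hkp, hor, hnc, -, hbK⟩ := exists_nonComm_dihedral hC.1 hw hpw hu hbad
  have hks : k = φ 1 := hor.resolve_left hC.2.2.1
  have hb1 : b ≠ 1 := by
    rintro rfl
    apply hnc.ne'
    rw [mul_one, hC.map]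
  obtain ⟨-, h2, h3, -⟩ := hnc.structure hC.1 hk hkp (by simp [hks]) hbK hb1
  have h4 : k * (p * b) = p * (k * b) := by
    rw [← mul_assoc, ← mul_assoc, hks, hC.2.2.2]
  have h5 := cs.length_mul_le p (k * b)
  have h6 := hC.1.length
  rw [h4] at h2
  omega

theorem NonComm.insert_isR (hp : Gen cs p) (hk : Gen cs k) (hkp : k ≠ p)
    (hs : φ 1 ∈ ({p, k} : Set W)) (h : NonComm φ p b) (hb : InPar cs {p, k} b) (hb1 : b ≠ 1)
    (hr : IsR φ r) (hrK : r ∉ ({p, k} : Set W))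
    (hbb : b = b' * b'') (hl : ℓ b = ℓ b' + ℓ b'') (hmem : p * (b' * r * b'') ∈ φ.dom) :
    ∀ a, Gen cs a → a ≼ p * b' → r * a = a * r := by
  have hpK : InPar cs {p, k} p := InPar.gen hp (by simp)
  obtain ⟨hb', hb'', lu, lpu, hru, hbu, hupu, hpbpu, huK⟩ :=
    h.insert_lengths hp hb hr.1 hrK hbb hl rfl
  have hlt := h.lt
  have hrc : ¬ (r * p = p * r ∧ r * k = k * r) := by
    rintro ⟨h1, h2⟩
    apply hr.2.2.2
    simp only [Set.mem_insert_iff, Set.mem_singleton_iff] at hs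
    rcases hs with h | h <;> rw [h] <;> assumption
  rcases h.insert_letter hp hk hkp hs hb hb1 hr.1 hrK hrc hbb hl rfl hmem with h1 | h1
  · refine extract_left (y := b'') hr.1 hrK (hpK.mul hb') hb'' ?_ ?_
    · have h2 := cs.length_mul_le (p * b') b''
      have h3 := cs.length_mul_le p b'
      have := hp.length
      rw [mul_assoc, ← hbb] at h2 ⊢
      omega
    · convert h1 using 2 <;> simp only [mul_assoc]
  · exfalso
    have h2 := h1.2.2.2.map_ble hru hr.up
    rw [h1.2.1, hr.2.2.1] at h2
    have hφb : InPar cs {p, k} (φ b) := hb.map h.up.1 hs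
    obtain ⟨y₁, y₂, hy, hy₁, hy₂, hyl⟩ := ble_mul_split
      (by rw [hφb.length_mul hr.1 hrK, hr.1.length]) h2
    have h4 := hφb.of_ble hy₁
    have hsG := gen_map_one (one_mem hr.2.1)
    have hrle : r ≼ r * φ 1 := ble_mul_gen hsG (by
      have := hr.up.2
      rw [hr.2.2.1] at this; omega)
    rcases ble_gen hr.1 hy₂ with rfl | rfl
    · rw [mul_one] at hy
      rw [← hy] at h4
      exact hrK (h4 r hr.1 hrle)
    · have h5 := hr.up.2
      rw [hr.2.2.1] at h5
      rw [hr.1.length] at h5 hyl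
      have hsle : φ 1 ≼ y₁ * y₂ := by
        rw [← hy, ← hr.2.2.1]; exact hr.up.down.ble
      rcases gen_ble_mul hsG hsle with h6 | h6
      · have h7 := ble_eq h6 (by rw [hsG.length]; omega)
        rw [← h7] at hy
        exact hr.2.2.2 hy
      · exact hr.ne (hsG.eq_of_ble hr.1 h6).symm

theorem NonComm.insert_isC (hp : Gen cs p) (hk : Gen cs k) (hkp : k ≠ p)
    (hs : φ 1 ∈ ({p, k} : Set W)) (h : NonComm φ p b) (hb : InPar cs {p, k} b) (hb1 : b ≠ 1)
    (hr : Gen cs r) (hrK : r ∉ ({p, k} : Set W)) (hrc : ¬ (r * p = p * r ∧ r * k = k * r))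
    (hbb : b = b' * b'') (hl : ℓ b = ℓ b' + ℓ b'') (hmem : p * (b' * r * b'') ∈ φ.dom) :
    (∀ a, Gen cs a → a ≼ p * b' → r * a = a * r) ∨ (∀ a, Gen cs a → a ≼ b'' → r * a = a * r) := by
  have hpK : InPar cs {p, k} p := InPar.gen hp (by simp)
  obtain ⟨hb', hb'', lu, lpu, hru, hbu, hupu, hpbpu, huK⟩ :=
    h.insert_lengths hp hb hr hrK hbb hl rfl
  have hlt := h.lt
  rcases h.insert_letter hp hk hkp hs hb hb1 hr hrK hrc hbb hl rfl hmem with h1 | h1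
  · left
    refine extract_left (y := b'') hr hrK (hpK.mul hb') hb'' ?_ ?_
    · have h2 := cs.length_mul_le (p * b') b''
      have h3 := cs.length_mul_le p b'
      have := hp.length
      rw [mul_assoc, ← hbb] at h2 ⊢
      omega
    · convert h1 using 2 <;> simp only [mul_assoc]
  · right
    obtain ⟨-, h2, -, h3⟩ := h1
    refine extract_right hr hrK hb'' hb' (by rw [← hbb, hl]) ?_
    by_contra hcon
    have h4 := h3.cov.eq_mul_gen hr (by
      have := h3.2
      have := h.up.2
      rw [h2, hr.cancel_right, ← h2]; omega)
      (by rcases hr.length_mul (b' * r * b'') with h | h <;> omega)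
    rw [h2] at h4
    have h5 := mul_right_cancel h4
    have hφb : InPar cs {p, k} (φ b) := hb.map h.up.1 hs
    rw [h5] at hφb
    exact hrK (hφb r hr hru)

end Types

section Deviation

local notation "ℓ" => CoxeterSystem.length cs
local infix:50 " ≼ " => bruhatLE cs

variable {a b b' b'' c d u v w x y z g h r p q k s t A m : W} {J K : Set W} {φ : BSM cs}

/-- `x = p * b` is a shortest element of the dihedral subgroup `⟨φ 1, t⟩` which is matched upwards
but not by right multiplication by `φ 1`. -/
structure Dev (φ : BSM cs) (t p k b x : W) : Prop where
  isR : IsR φ t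
  hp : Gen cs p
  hk : Gen cs k
  hkp : k ≠ p
  pair : ({p, k} : Set W) = {φ 1, t}
  nc : NonComm φ p b
  bK : InPar cs {p, k} b
  b1 : b ≠ 1
  eq : x = p * b
  up : Up φ x
  map : φ x = k * x
  lb : cs.length x = cs.length b + 1
  lk : cs.length (k * x) = cs.length x + 1
  mapb : φ b = b * φ 1
  bt : cs.length (b * t) + 1 = cs.length b
  xt : cs.length (x * t) + 1 = cs.length x
  xs : cs.length (x * φ 1) = cs.length x + 1
  ne : x * φ 1 ≠ k * x
  minimal : ∀ y, InPar cs {φ 1, t} y → Up φ y → cs.length y < cs.length x → φ y = y * φ 1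

theorem dihedral_ext_right (hg : InPar cs {p, q} g) (hh : InPar cs {p, q} h) (hl : ℓ g = ℓ h)
    (ha : Gen cs a) (hag : ℓ (g * a) < ℓ g) (hah : ℓ (h * a) < ℓ h) : g = h := by
  have := dihedral_ext hg.inv hh.inv (by simpa using hl) ha
    (by rwa [ha.length_mul_inv, cs.length_inv]) (by rwa [ha.length_mul_inv, cs.length_inv])
  exact inv_injective this

/-- Below a given length without deviation, up elements do not end in `φ 1`. -/
theorem length_mul_of_minimal_dev {n : ℕ} (hs : Gen cs (φ 1))
    (hmin : ∀ y, InPar cs {φ 1, t} y → Up φ y → ℓ y < n → φ y = y * φ 1)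
    (hz : InPar cs {φ 1, t} z) (hzu : Up φ z) (hl : ℓ z ≤ n) : ℓ (z * φ 1) = ℓ z + 1 := by
  rcases hs.length_mul z with h | h
  · exact h
  exfalso
  have hyz : z * φ 1 ≼ z := mul_gen_ble hs (by omega)
  have hyK := hz.of_ble hyz
  have hyd := φ.ideal hzu.1 hyz
  rcases up_or_down hyd with hy | hy
  · have h1 := hmin _ hyK hy (by omega)
    rw [hs.cancel_right] at h1
    have := hy.down
    rw [h1] at this
    exact hzu.not_down this
  · have h2 := hy.2
    have h1 := hmin _ (hyK.map hyd (by simp)) hy.up (by omega)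
    rw [φ.invol _ hyd] at h1
    rw [← mul_right_cancel h1] at h2
    omega

theorem exists_dev (ht : IsR φ t) (hu : Up φ u) (huK : InPar cs {φ 1, t} u)
    (hne : φ u ≠ u * φ 1) : ∃ p k b x, Dev φ t p k b x ∧ x ≼ u := by
  induction hn : ℓ u using Nat.strong_induction_on generalizing u with
  | _ n ih =>
  by_cases hex : ∃ y, InPar cs {φ 1, t} y ∧ Up φ y ∧ ℓ y < ℓ u ∧ φ y ≠ y * φ 1
  · obtain ⟨y, hyK, hy, hyl, hyne⟩ := hex
    obtain ⟨p, k, b, x, hD, hx⟩ := ih _ (by omega) hy hyK hyne rfl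
    exact ⟨p, k, b, x, hD, ble_trans hx (dihedral_ble hyK huK hyl)⟩
  have hmin : ∀ y, InPar cs {φ 1, t} y → Up φ y → ℓ y < ℓ u → φ y = y * φ 1 := by
    intro y h1 h2 h3
    by_contra h4
    exact hex ⟨y, h1, h2, h3, h4⟩
  clear ih hex hn
  have hs := gen_map_one (one_mem hu.1)
  have husl := length_mul_of_minimal_dev hs hmin huK hu le_rfl
  have hu1 : u ≠ 1 := by
    rintro rfl
    exact hne (by rw [one_mul])
  obtain ⟨p, hp, hpl⟩ := exists_gen_mul_lt (cs := cs) hu1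
  have hpb : p * (p * u) = u := hp.cancel_left u
  have hbu : p * u ≼ u := gen_mul_ble hp (by omega)
  have hbK := huK.of_ble hbu
  have hbd := φ.ideal hu.1 hbu
  have hpK := huK.ldescent hp (by omega)
  generalize p * u = b at *
  have hbs : ℓ (b * φ 1) = ℓ b + 1 := by
    rcases hs.length_mul b with h | h
    · exact h
    · exfalso
      have h1 := cs.length_mul_le p (b * φ 1)
      rw [← mul_assoc, hpb, hp.length] at h1
      omega
  have hb1 : b ≠ 1 := by
    rintro rfl
    rw [mul_one] at hpb
    subst hpb
    simp only [Set.mem_insert_iff, Set.mem_singleton_iff] at hpK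
    rcases hpK with rfl | rfl
    · rw [hs.mul_self, cs.length_one, hs.length] at husl
      omega
    · exact hne ht.2.2.1
  have hb : Up φ b := by
    rcases up_or_down hbd with h | h
    · exact h
    exfalso
    have h2 := h.2
    have h1 := hmin _ (hbK.map hbd (by simp)) h.up (by omega)
    rw [φ.invol _ hbd] at h1
    have h3 := hbs
    rw [h1, hs.cancel_right, ← h1] at h3
    omega
  have hφb := hmin _ hbK hb (by omega)
  have hnc : NonComm φ p b := by
    refine ⟨hb, by rw [hpb]; omega, by rw [hpb]; exact hu.1, ?_, ?_⟩
    · rw [hpb]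
      intro h
      have := hb.down
      rw [h] at this
      exact hu.not_down this
    · rw [hpb, hφb, ← mul_assoc, hpb]
      exact hne
  obtain ⟨k, hk, hkp, hpk⟩ : ∃ k, Gen cs k ∧ k ≠ p ∧ ({p, k} : Set W) = {φ 1, t} := by
    simp only [Set.mem_insert_iff, Set.mem_singleton_iff] at hpK
    rcases hpK with h | h
    · exact ⟨t, ht.1, h ▸ ht.ne, by rw [h]⟩
    · exact ⟨φ 1, hs, h ▸ ht.ne.symm, by rw [h, Set.pair_comm]⟩
  have hbK' : InPar cs {p, k} b := by rw [hpk]; exact hbK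
  obtain ⟨h1, h2, -, c, d, hc, hd, hcd, hpair, h3, -, h4⟩ :=
    hnc.structure hp hk hkp (by rw [hpk]; simp) hbK' hb1
  have hcs : c = φ 1 := mul_left_cancel (h3.symm.trans hφb)
  have hdt : d = t := by
    have : d ∈ ({φ 1, t} : Set W) := by rw [← hpk, hpair]; simp
    simp only [Set.mem_insert_iff, Set.mem_singleton_iff] at this
    rcases this with h | h
    · exact absurd (hcs.trans h.symm) hcd
    · exact h
  rw [hdt] at h4
  rw [hpb] at h1 h2
  have hut : ℓ (u * t) + 1 = ℓ u := by
    have h5 := cs.length_mul_le p (b * t)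
    rw [← mul_assoc, hpb, hp.length] at h5
    rcases ht.1.length_mul u with h | h <;> omega
  refine ⟨p, k, b, u, ⟨ht, hp, hk, hkp, hpk, hnc, hbK', hb1, hpb.symm, hu, h1, by omega, by omega, hφb, h4, hut,
    husl, ?_, hmin⟩, ble_refl u⟩
  rw [← h1]
  exact hne.symm

namespace Dev

theorem hsG (D : Dev φ t p k b x) : Gen cs (φ 1) := gen_map_one (one_mem D.up.1)

theorem hs (D : Dev φ t p k b x) : φ 1 ∈ ({p, k} : Set W) := by rw [D.pair]; simp

theorem ht (D : Dev φ t p k b x) : t ∈ ({p, k} : Set W) := by rw [D.pair]; simp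

theorem xK (D : Dev φ t p k b x) : InPar cs {φ 1, t} x := by
  rw [D.eq, ← D.pair]
  exact (InPar.gen D.hp (by simp)).mul D.bK

theorem kK (D : Dev φ t p k b x) : InPar cs {φ 1, t} k := by
  rw [← D.pair]
  exact InPar.gen D.hk (by simp)

theorem kxK (D : Dev φ t p k b x) : InPar cs {φ 1, t} (k * x) := D.kK.mul D.xK

theorem sK (D : Dev φ t p k b x) : InPar cs {φ 1, t} (φ 1) := InPar.gen D.hsG (by simp)

theorem tK (D : Dev φ t p k b x) : InPar cs {φ 1, t} t := InPar.gen D.isR.1 (by simp)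

theorem px (D : Dev φ t p k b x) : p * x = b := by rw [D.eq, D.hp.cancel_left]

theorem two_le (D : Dev φ t p k b x) : 2 ≤ ℓ x := by
  have h1 := D.lb
  have h2 : ℓ b ≠ 0 := fun h => D.b1 (cs.length_eq_zero_iff.1 h)
  omega

theorem t_ble (D : Dev φ t p k b x) : t ≼ x :=
  descent_ble D.isR.1 (by have := D.xt; omega)

theorem s_ble (D : Dev φ t p k b x) : φ 1 ≼ x :=
  gen_ble_of_two_le D.xK D.isR.1 D.two_le

theorem kx_s (D : Dev φ t p k b x) : ℓ (k * x * φ 1) = ℓ x + 2 := by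
  have h1 := D.lk
  have h2 := D.xs
  rcases D.hsG.length_mul (k * x) with h | h
  · omega
  · exact absurd (dihedral_ext_right (D.xK.mul D.sK) D.kxK (by omega) D.hsG
      (by rw [D.hsG.cancel_right]; omega) (by omega)) D.ne

theorem p_kx (D : Dev φ t p k b x) : ℓ (p * (k * x)) = ℓ x + 2 := by
  have h1 := D.lk
  have h2 := D.xs
  have h3 := D.lb
  rcases D.hp.mul_length (k * x) with h | h
  · omega
  · refine absurd (dihedral_ext (D.xK.mul D.sK) D.kxK (by omega) D.hp ?_ (by omega)) D.ne
    rw [← mul_assoc, D.px]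
    have h4 := cs.length_mul_le b (φ 1)
    rw [D.hsG.length] at h4
    omega

theorem mul_notMem (D : Dev φ t p k b x) (hr : IsR φ r) (hrt : r ≠ t) : x * r ∉ φ.dom := by
  intro hmem
  have hrK : r ∉ ({p, k} : Set W) := by
    rw [D.pair]; simp [hrt, hr.ne]
  have h := D.nc.insert_isR D.hp D.hk D.hkp D.hs D.bK D.b1 hr hrK (b' := b) (b'' := 1)
    (by simp) (by simp) (by rw [mul_one, ← mul_assoc, ← D.eq]; exact hmem)
  exact hr.2.2.2 (h _ D.hsG (by rw [← D.eq]; exact D.s_ble))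

end Dev

end Deviation

section Commuting

local notation "ℓ" => CoxeterSystem.length cs
local infix:50 " ≼ " => bruhatLE cs

variable {a b b' b'' c d u v w x y z g h r p q k s t A m : W} {J K : Set W} {φ : BSM cs}

theorem IsR.not_isC (h : IsR φ q) : ¬ IsC φ q := fun h' => h.2.2.2 h'.2.2.2

theorem IsL.not_isC (h : IsL φ q) : ¬ IsC φ q := fun h' => h.2.2.2 h'.2.2.2

theorem IsC.notMem_pair (hc : IsC φ c) (ht : ¬ IsC φ t) : c ∉ ({φ 1, t} : Set W) := by
  simp only [Set.mem_insert_iff, Set.mem_singleton_iff, not_or]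
  exact ⟨hc.2.2.1, fun h => ht (h ▸ hc)⟩

/-- Elements in the letters commuting with `φ 1`. -/
theorem lMin_of_inPar_isC (ht : ¬ IsC φ t) (hm : InPar cs {q | IsC φ q} m) :
    LMin cs {φ 1, t} m := by
  intro a ha haK
  rw [hm.mul_length ha (fun h => IsC.notMem_pair h ht haK)]
  omega

theorem ble_of_ble_mul_right (hg : InPar cs K g) (hm : LMin cs K m) (hmK : ∀ a, Gen cs a → a ∈ K → ¬ a ≼ m)
    (hx : InPar cs K x) (h : g ≼ x * m) : g ≼ x := by
  obtain ⟨g₁, g₂, rfl, h1, h2, hl⟩ := ble_mul_split (hm.length_mul hx) h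
  have h3 : InPar cs K g₂ := hg.of_ble (ble_right_mul hl)
  have h4 : g₂ = 1 := by
    by_contra hne
    obtain ⟨a, ha, hal⟩ := exists_gen_mul_lt (cs := cs) hne
    exact hmK a ha (h3.ldescent ha (by omega)) (ble_trans (ldescent_ble ha (by omega)) h2)
  rw [h4, mul_one]
  exact h1

theorem ble_of_ble_mul_isC (ht : ¬ IsC φ t) (hm : InPar cs {q | IsC φ q} m)
    (hg : InPar cs {φ 1, t} g) (hx : InPar cs {φ 1, t} x) (h : g ≼ x * m) : g ≼ x :=
  ble_of_ble_mul_right hg (lMin_of_inPar_isC ht hm)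
    (fun _ ha haK h' => IsC.notMem_pair (hm _ ha h') ht haK) hx h

/-- A left descent of `x * m` outside the parabolic subgroup containing `x` commutes with `x`. -/
theorem comm_of_ldescent_mul (hx : InPar cs K x) (hm : InPar cs J m) (ha : Gen cs a)
    (haK : a ∉ K) (hKJ : ∀ b, b ∈ K → b ∉ J) (hl : ℓ (x * m) = ℓ x + ℓ m)
    (hd : ℓ (a * (x * m)) < ℓ (x * m)) : a * x = x * a := by
  obtain ⟨g₁, g₂, hg, h1, h2, hgl⟩ := ble_mul_split hl (gen_mul_ble ha hd)
  have hgK := hx.of_ble h1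
  have hgJ := hm.of_ble h2
  have h3 : g₁⁻¹ * (a * x) = g₂ * m⁻¹ := by
    rw [← mul_left_cancel_iff (a := g₁), mul_inv_cancel_left, ← mul_assoc, ← hg]
    simp [mul_assoc]
  have hP : InPar cs {a} (g₁⁻¹ * (a * x)) := by
    intro b hb hbx
    have hbJ : b ∈ J := by
      rw [h3] at hbx
      exact (hgJ.mul hm.inv) b hb hbx
    have h4 : InPar cs (insert a K) (g₁⁻¹ * (a * x)) :=
      (hgK.inv.mono (Set.subset_insert _ _)).mul
        ((InPar.gen ha (by simp)).mul (hx.mono (Set.subset_insert _ _)))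
    rcases h4 b hb hbx with h | h
    · exact h
    · exact absurd hbJ (hKJ b h)
  rcases inPar_singleton hP with h | h
  · exfalso
    have h4 : a * x = g₁ := by
      rw [← mul_one g₁, ← h, mul_inv_cancel_left]
    have h5 := hx.mul_length ha haK
    apply haK
    refine hgK a ha ?_
    rw [← h4]
    refine ldescent_ble ha ?_
    rw [ha.cancel_left]; omega
  · have h4 : a * x = g₁ * a := by
      rw [← mul_left_cancel_iff (a := g₁⁻¹), h, inv_mul_cancel_left]
    have h5 := hx.mul_length ha haK
    have h6 := hgK.length_mul ha haK
    rw [h4, h6] at h5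
    rw [h4, ble_eq h1 (by omega)]

namespace Dev

theorem map_mul_isC (D : Dev φ t p k b x) (hm : InPar cs {q | IsC φ q} m)
    (hmem : x * m ∈ φ.dom) : Up φ (x * m) ∧ φ (x * m) = k * (x * m) := by
  induction hn : ℓ m using Nat.strong_induction_on generalizing m with
  | _ n ih =>
  have htC := D.isR.not_isC
  have hmL := lMin_of_inPar_isC htC hm
  have hlen := hmL.length_mul D.xK
  have hxv : x ≼ x * m := ble_left_mul hlen
  have hlk := D.lk
  have hno : ¬ k * x ≼ x * m := fun h => by
    have := ble_length_le (ble_of_ble_mul_isC htC hm D.kxK D.xK h)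
    omega
  have hup : Up φ (x * m) := by
    rcases up_or_down hmem with h | h
    · exact h
    · exact absurd (D.map ▸ h.map_up_ble hxv D.up) hno
  refine ⟨hup, ?_⟩
  have hkZ : k * x ≼ φ (x * m) := D.map ▸ hup.map_ble hxv D.up
  have hcov := hup.cov
  have hZd := hup.down
  have hinv := φ.invol _ hmem
  have hZ1 : φ (x * m) ≠ 1 := fun h => by
    have := hup.2
    rw [h, cs.length_one] at this; omega
  obtain ⟨a, ha, hal⟩ := exists_gen_mul_lt (cs := cs) hZ1
  have haZ : a ≼ φ (x * m) := ldescent_ble ha (by omega)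
  have haKC : a = p ∨ a = k ∨ IsC φ a := by
    have h1 : a ∈ ({p, k} : Set W) → a = p ∨ a = k ∨ IsC φ a := by
      rintro (h | h)
      · exact Or.inl h
      · exact Or.inr (Or.inl h)
    rcases gen_ble_map ha hmem haZ with h | h
    · rcases gen_ble_mul ha h with h | h
      · exact h1 (D.pair ▸ D.xK a ha h)
      · exact Or.inr (Or.inr (hm a ha h))
    · exact h1 (h ▸ D.hs)
  by_cases hak : a = k
  · subst hak
    refine hcov.eq_gen_mul ha (by omega) ?_
    rcases ha.mul_length (x * m) with h | h
    · omega
    · exact absurd (llift_up_left hxv ha (by omega)) hno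
  have hakx : ℓ (k * x) < ℓ (a * (k * x)) := by
    rcases haKC with rfl | h | h
    · rw [D.p_kx]; omega
    · exact absurd h hak
    · rw [D.kxK.mul_length ha (h.notMem_pair htC)]; omega
  have hkZ1 := llift_down_right hkZ ha hakx
  have hcovZ : Cov cs (a * φ (x * m)) (φ (x * m)) := by
    refine ⟨gen_mul_ble ha (by omega), by omega⟩
  have haa := ha.cancel_left (φ (x * m))
  rcases hZd.cov_cases hcovZ with h | ⟨hZ1d, hvcov⟩
  · rw [hinv] at h
    rw [h] at hkZ1
    exact absurd hkZ1 hno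
  have hxZ1 : x ≼ a * φ (x * m) := ble_trans (ble_gen_mul D.hk (by omega)) hkZ1
  have hxv' := hZ1d.ble_map hxZ1 D.up
  have hvup := hZ1d.up
  have hinv' := φ.invol _ hZ1d.1
  rw [hinv] at hvcov
  generalize a * φ (x * m) = Z1 at *
  obtain ⟨v₁, m', hv, hv1, hm', hvl⟩ := ble_mul_split hlen hvcov.1
  have hm'C := hm.of_ble hm'
  have hv1K := D.xK.of_ble hv1
  have h5 : v₁ = x := by
    refine (ble_antisymm (ble_of_ble_mul_isC htC hm'C D.xK hv1K ?_) hv1).symm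
    rw [← hv]; exact hxv'
  rw [h5] at hv hvl
  have hm'l : ℓ m' + 1 = ℓ m := by
    have := hvcov.2
    omega
  have h6 := (ih _ (by omega) hm'C (by rw [← hv]; exact hvup.1) rfl).2
  rw [← hv, hinv', hv] at h6
  have hmZ : m ≼ φ (x * m) := ble_trans (ble_right_mul hlen) hcov.1
  rw [← haa, h6] at hmZ
  clear ih hvup hinv' hZ1d hvcov hxv' hxZ1 hcovZ hkZ1
  rcases haKC with rfl | h | h
  · exfalso
    have h8 : InPar cs {φ 1, t} (a * (k * x)) :=
      InPar.mul (InPar.gen ha (by rw [← D.pair]; simp)) D.kxK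
    rw [← mul_assoc k, ← mul_assoc a] at hmZ
    have := ble_length_le (hmL.ble hmZ h8 ((lMin_of_inPar_isC htC hm'C).length_mul h8))
    omega
  · exact absurd h hak
  have haK := h.notMem_pair htC
  have hxZ : x * m ≼ a * (k * x * m') := by
    rw [mul_assoc k, ← h6, haa]
    exact hcov.1
  have hl7 : ℓ (a * (k * x * m')) = ℓ a + ℓ (k * x * m') := by
    rw [mul_assoc k, ← h6, haa, ha.length]
    omega
  have hkxm' := (lMin_of_inPar_isC htC hm'C).length_mul D.kxK
  obtain ⟨g0, g', hg, hg0, hg', hgl⟩ := ble_mul_split hl7 hxZ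
  rcases ble_gen ha hg0 with h9 | h9
  · exfalso
    rw [h9, one_mul] at hg
    rw [← hg] at hg'
    have := ble_length_le (hmL.ble (ble_trans (ble_right_mul hlen) hg') D.kxK hkxm')
    omega
  rw [h9, ha.length] at hgl
  rw [h9] at hg
  have hd : ℓ (a * (x * m)) < ℓ (x * m) := by
    rw [hg, ha.cancel_left, ← hg]; omega
  have hcomm := comm_of_ldescent_mul D.xK hm ha haK
    (fun c hc hc' => IsC.notMem_pair hc' htC hc) hlen hd
  have hkx : k ≼ x := by
    have : k ∈ ({φ 1, t} : Set W) := by rw [← D.pair]; simp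
    rcases this with h | h <;> rw [h]
    · exact D.s_ble
    · exact D.t_ble
  have hck := comm_letters_of_comm ha haK D.xK hcomm k D.hk hkx
  have h10 : a * Z1 = k * x * (a * m') := by
    rw [h6, ← mul_assoc a k, hck, mul_assoc k a, ← mul_assoc a x, hcomm]
    simp only [mul_assoc]
  have ham' : InPar cs {q | IsC φ q} (a * m') := (InPar.gen ha h).mul hm'C
  have h11 : m ≼ a * m' := by
    refine hmL.ble ?_ D.kxK ((lMin_of_inPar_isC htC ham').length_mul D.kxK)
    rw [← h10, h6]
    exact hmZ
  have h12 := ble_eq h11 (by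
    have := cs.length_mul_le a m'
    rw [ha.length] at this; omega)
  rw [← haa, h10, ← h12, mul_assoc]

end Dev

theorem IsC.length_mul_mul (hc : IsC φ c) (ht : IsR φ t) (hct : c * t ≠ t * c) :
    ℓ (c * t) = 2 ∧ ℓ (c * t * c) = 3 ∧ ℓ (c * t * φ 1) = 3 := by
  have hne : c ≠ t := fun h => hct (by rw [h])
  obtain ⟨h1, h2⟩ := comm_of_length hc.1 ht.1 hne
  refine ⟨h1, h2.resolve_left hct, ?_⟩
  have hs := gen_map_one (one_mem hc.2.1)
  have h3 : InPar cs {c, t} (c * t) :=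
    (InPar.gen hc.1 (by simp)).mul (InPar.gen ht.1 (by simp))
  rw [h3.length_mul hs, h1]
  simp only [Set.mem_insert_iff, Set.mem_singleton_iff, not_or]
  exact ⟨hc.2.2.1.symm, ht.ne.symm⟩

theorem IsR.notMem (ht : IsR φ t) : φ 1 ∉ insert t {q | IsC φ q} := by
  rintro (h | h)
  · exact ht.ne h.symm
  · exact h.2.2.1 rfl

/-- `c * t * φ 1` is not below a product with the letter `φ 1` only to the left of `c`. -/
theorem not_ble_mul (hc : IsC φ c) (ht : IsR φ t) (hct : c * t ≠ t * c)
    (hg : InPar cs {φ 1, t} g) (hy : InPar cs (insert t {q | IsC φ q}) y)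
    (hl : ℓ (g * y) = ℓ g + ℓ y) : ¬ c * t * φ 1 ≼ g * y := by
  intro h
  have hs := gen_map_one (one_mem hc.2.1)
  obtain ⟨l1, l2, l3⟩ := hc.length_mul_mul ht hct
  have hcK := hc.notMem_pair ht.not_isC
  obtain ⟨g₁, g₂, hgg, h1, h2, hgl⟩ := ble_mul_split hl h
  have hg1 := hg.of_ble h1
  have hg2 := hy.of_ble h2
  have hs1 : φ 1 ≼ g₁ := by
    have : φ 1 ≼ c * t * φ 1 := descent_ble hs (by rw [hs.cancel_right]; omega)
    rw [hgg] at this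
    exact (gen_ble_mul hs this).resolve_right fun h => ht.notMem (hg2 _ hs h)
  have hc2 : c ≼ g₂ := by
    have : c ≼ c * t * φ 1 := by
      refine ble_trans (ldescent_ble hc.1 ?_) (ble_mul_gen hs (by omega))
      rw [hc.1.cancel_left, ht.1.length]; omega
    rw [hgg] at this
    exact (gen_ble_mul hc.1 this).resolve_left fun h => hcK (hg1 _ hc.1 h)
  have e1 := ble_length_le hs1
  have e2 := ble_length_le hc2
  rw [hs.length] at e1
  rw [hc.1.length] at e2
  rcases Nat.lt_or_ge (ℓ g₂) 2 with h5 | h5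
  · have h6 := (ble_eq hc2 (by rw [hc.1.length]; omega)).symm
    rw [h6] at hgg
    have h7 : c * t * c * φ 1 = g₁ := by
      rw [mul_assoc _ c, hc.2.2.2, ← mul_assoc, hgg, hc.1.cancel_right]
    have h8 : InPar cs {φ 1, t} (c * t * c) := by
      have := hg1.mul (InPar.gen hs (by simp) : InPar cs {φ 1, t} (φ 1))
      rwa [← h7, hs.cancel_right] at this
    exact hct (comm_of_conj_mem hc.1 hcK (InPar.gen ht.1 (by simp)) h8)
  · have h6 := (ble_eq hs1 (by rw [hs.length]; omega)).symm
    rw [h6] at hgg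
    have h7 : c * g₂ = φ 1 * t * φ 1 := by
      rw [← hs.cancel_left g₂, ← hgg]
      simp only [← mul_assoc]
      rw [hc.2.2.2, mul_assoc (φ 1) c c, hc.1.mul_self, mul_one]
    have h8 : InPar cs (insert t {q | IsC φ q}) (φ 1 * t * φ 1) := by
      rw [← h7]
      exact (InPar.gen hc.1 (by right; exact hc)).mul hg2
    exact ht.2.2.2 (comm_of_conj_mem hs ht.notMem (InPar.gen ht.1 (by simp)) h8).symm

theorem IsC.map_mul_isR (hc : IsC φ c) (ht : IsR φ t) (hct : c * t ≠ t * c)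
    (hmem : c * t ∈ φ.dom) : Up φ (c * t) ∧ φ (c * t) = c * t * φ 1 := by
  have hs := gen_map_one (one_mem hc.2.1)
  obtain ⟨l1, l2, l3⟩ := hc.length_mul_mul ht hct
  have hK : InPar cs {c, t} (c * t) :=
    (InPar.gen hc.1 (by simp)).mul (InPar.gen ht.1 (by simp))
  have hup : Up φ (c * t) := by
    rcases up_or_down hmem with h | h
    · exact h
    · rcases hK _ hs h.ble with h | h
      · exact absurd h.symm hc.2.2.1
      · exact absurd h.symm ht.ne
  refine ⟨hup, ?_⟩
  have hX := hup.2
  have hcov := hup.cov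
  obtain ⟨a, ha, hal⟩ := exists_mul_gen_lt (cs := cs) (w := φ (c * t))
    (by intro h; rw [h, cs.length_one] at hX; omega)
  have htct : t ≼ c * t := descent_ble ht.1 (by rw [ht.1.cancel_right, hc.1.length]; omega)
  have hts : Cov cs (t * φ 1) (φ (c * t)) := by
    have h1 := hup.map_ble htct ht.up
    have h2 := ht.up.2
    rw [ht.2.2.1] at h1 h2
    exact ⟨h1, by rw [hX, h2, l1, ht.1.length]⟩
  have hstt : ℓ (t * φ 1) = 2 ∧ ℓ (t * φ 1 * t) = 3 := by
    obtain ⟨h1, h2⟩ := comm_of_length ht.1 hs ht.ne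
    exact ⟨h1, h2.resolve_left ht.2.2.2⟩
  have ha' : a = φ 1 ∨ a = t ∨ a = c := by
    rcases gen_ble_map ha hmem (descent_ble ha (by omega)) with h | h
    · rcases hK a ha h with h | h
      · exact Or.inr (Or.inr h)
      · exact Or.inr (Or.inl h)
    · exact Or.inl h
  rcases ha' with rfl | h0 | h0
  · exact hcov.eq_mul_gen ha (by omega) (by omega)
  · exfalso
    rw [h0] at ha hal
    have h1 := hts.eq_mul_gen ha (by omega) (by omega)
    have h2 : c ≼ t * φ 1 * t := by
      rw [← h1]
      refine ble_trans (ldescent_ble hc.1 ?_) hcov.1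
      rw [hc.1.cancel_left, ha.length]; omega
    have h3 : InPar cs {φ 1, t} (t * φ 1 * t) :=
      ((InPar.gen ha (by simp)).mul (InPar.gen hs (by simp))).mul (InPar.gen ha (by simp))
    exact hc.notMem_pair ht.not_isC (h3 c hc.1 h2)
  · exfalso
    rw [h0] at ha hal
    have h1 := hcov.eq_mul_gen ha (by omega) (by omega)
    have h2 : φ 1 ≼ c * t * c := by
      rw [← h1]
      refine ble_trans (descent_ble hs ?_) hts.1
      rw [hs.cancel_right, hstt.1, ht.1.length]; omega
    rcases (hK.mul (InPar.gen ha (by simp))) _ hs h2 with h | h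
    · exact hc.2.2.1 h.symm
    · exact ht.ne h.symm

end Commuting

section Obstructions

local notation "ℓ" => CoxeterSystem.length cs
local infix:50 " ≼ " => bruhatLE cs

variable {a b b' b'' c d u v w x y z g h r p q k s t A m : W} {J K : Set W} {φ : BSM cs}

theorem exists_dihedral_right (hpq : p ≠ q) (hp : Gen cs p) (hq : Gen cs q)
    (h1 : ℓ (u * p) < ℓ u) (h2 : ℓ (u * q) < ℓ u) (hg : InPar cs {p, q} g) : g ≼ u := by
  obtain ⟨_, _, _, _, _, _, _, _, h⟩ := exists_dihedral_factor (u := u⁻¹) hpq hp hq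
    (by rwa [hp.length_mul_inv, cs.length_inv]) (by rwa [hq.length_mul_inv, cs.length_inv])
  exact ble_inv_iff.1 (h _ hg.inv).2

theorem length_mul_mul_of_noncomm (hc : Gen cs c) (ht : Gen cs t) (hct : c * t ≠ t * c)
    (hg : InPar cs K g) (hcK : c ∉ K) (htK : t ∈ K) : ℓ (g * c * t) = ℓ g + 2 := by
  have h1 := hg.length_mul hc hcK
  rcases ht.length_mul (g * c) with h | h
  · omega
  exfalso
  have hne : t ≠ c := fun h => hct (by rw [h])
  have h2 := (two_ldescents (u := c * g⁻¹) ht hc hne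
    (by rw [← hc.inv, ← mul_inv_rev, ht.length_mul_inv, cs.length_inv]; omega)
    (by rw [hc.cancel_left, cs.length_inv, hc.length_mul_inv]; omega)).2 (Ne.symm hct)
  rw [hc.cancel_left, hc.length_mul_inv, h1] at h2
  have h3 := ((InPar.gen ht htK).mul hg.inv).mul_length hc hcK
  have h4 : ℓ (t * g⁻¹) = ℓ (g * t) := ht.length_mul_inv g
  rcases ht.length_mul g with h5 | h5 <;> omega

theorem mul_gen_le_of_ble (hgt : g ≼ x) (hxt : ℓ (x * t) + 1 = ℓ x)
    (h : ℓ (g * t) = ℓ g + 1) : ℓ (g * t) ≤ ℓ x := by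
  rcases ble_length hgt with rfl | h'
  · omega
  · omega

namespace Dev

theorem length_le_of_ble (D : Dev φ t p k b x) (hm : InPar cs {q | IsC φ q} m)
    (hl : ℓ (x * m * t) = ℓ (x * m) + 1) (hg : InPar cs {φ 1, t} g) (h : g ≼ x * m * t) :
    ℓ g ≤ ℓ x := by
  obtain ⟨g₁, g₂, hgg, h1, h2, hgl⟩ := ble_mul_split
    (by rw [hl, D.isR.1.length]) h
  rw [hgg] at hgl hg
  have h3 := ble_of_ble_mul_isC D.isR.not_isC hm (hg.of_ble (ble_left_mul hgl)) D.xK h1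
  have hxt := D.xt
  have h4 := ble_length_le h3
  rw [hgg]
  rcases ble_gen D.isR.1 h2 with h5 | h5
  · rw [h5, mul_one]; exact h4
  · rw [h5, D.isR.1.length] at hgl
    rw [h5]
    exact mul_gen_le_of_ble h3 D.xt hgl

theorem kx_not_ble (D : Dev φ t p k b x) (hm : InPar cs {q | IsC φ q} m)
    (hl : ℓ (x * m * t) = ℓ (x * m) + 1) : ¬ k * x ≼ x * m * t := fun h => by
  have := D.length_le_of_ble hm hl D.kxK h
  have := D.lk
  omega

theorem kx_not_ble_mul_mul (D : Dev φ t p k b x) (hm : InPar cs {q | IsC φ q} m)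
    (hl : ℓ (x * m * (t * φ 1)) = ℓ (x * m) + ℓ (t * φ 1))
    (h : k * x ≼ x * m * (t * φ 1)) : False := by
  have htG := D.isR.1
  obtain ⟨g₁, g₂, hgg, h1, h2, hgl⟩ := ble_mul_split hl h
  have hlk := D.lk
  have hkK := D.kxK
  rw [hgg] at hkK
  have h3 := ble_of_ble_mul_isC D.isR.not_isC hm
    (hkK.of_ble (ble_left_mul (by rw [← hgg]; exact hgl))) D.xK h1
  have h4 := ble_length_le h3
  have hts : ℓ (t * φ 1) = ℓ t + ℓ (φ 1) := by
    have := D.isR.up.2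
    rw [D.isR.2.2.1] at this
    rw [this, D.hsG.length]
  obtain ⟨f₁, f₂, hff, h5, h6, hfl⟩ := ble_mul_split hts h2
  rcases ble_gen D.hsG h6 with h7 | h7
  · rw [h7, mul_one] at hff
    rcases ble_gen htG h5 with h8 | h8
    · rw [hff, h8, cs.length_one] at hgl
      omega
    · rw [hff, h8, htG.length] at hgl
      have h9 := ble_eq h3 (by omega)
      rw [hff, h8, h9] at hgg
      have := D.xt
      rw [← hgg] at this
      omega
  · rcases ble_gen htG h5 with h8 | h8
    · rw [h8, h7, one_mul] at hff
      rw [hff, D.hsG.length] at hgl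
      have h9 := ble_eq h3 (by omega)
      rw [hff, h9] at hgg
      exact D.ne hgg.symm
    · have h9 := D.kx_s
      rw [hgg, hff, h8, h7, ← mul_assoc, D.hsG.cancel_right] at h9
      have := cs.length_mul_le g₁ t
      rw [htG.length] at this
      omega

theorem isR_descent_false (D : Dev φ t p k b x) (hm : InPar cs {q | IsC φ q} m)
    (hc : IsC φ c) (hct : c * t ≠ t * c) (hcm : c ≼ m) (hmem : x * m * t ∈ φ.dom)
    (hl : ℓ (x * m * t) = ℓ (x * m) + 1)
    (hd : ∀ a, IsC φ a → ℓ (x * m * t) < ℓ (x * m * t * a)) : False := by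
  have htG := D.isR.1
  have htC := D.isR.not_isC
  have hsG := D.hsG
  have hmL := lMin_of_inPar_isC htC hm
  have hlen := hmL.length_mul D.xK
  have hno := D.kx_not_ble hm hl
  have hxmv : x * m ≼ x * m * t := ble_mul_gen htG (by omega)
  obtain ⟨hxmu, hφxm⟩ := D.map_mul_isC hm (φ.ideal hmem hxmv)
  have hlk := D.lk
  have hkxm : ℓ (k * x * m) = ℓ (k * x) + ℓ m := hmL.length_mul D.kxK
  have hkxle : k * x ≼ k * (x * m) := by
    rw [← mul_assoc]; exact ble_left_mul hkxm
  have hup : Up φ (x * m * t) := by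
    rcases up_or_down hmem with h | h
    · exact h
    · refine absurd (ble_trans ?_ (h.map_up_ble hxmv hxmu)) hno
      rw [hφxm]; exact hkxle
  have hZ := hup.2
  have hkZ := hup.map_ble hxmv hxmu
  rw [hφxm] at hkZ
  obtain ⟨a, ha, hal⟩ := exists_mul_gen_lt (cs := cs) (w := φ (x * m * t))
    (by intro h; rw [h, cs.length_one] at hZ; omega)
  have haKC : a = φ 1 ∨ a = t ∨ IsC φ a := by
    rcases gen_ble_map ha hmem (descent_ble ha (by omega)) with h | h
    · rcases gen_ble_mul ha h with h | h
      · rcases gen_ble_mul ha h with h | h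
        · rcases D.xK a ha h with h | h
          · exact Or.inl h
          · exact Or.inr (Or.inl h)
        · exact Or.inr (Or.inr (hm a ha h))
      · exact Or.inr (Or.inl (ha.eq_of_ble htG h))
    · exact Or.inl h
  have hts2 : ℓ (t * φ 1) = 2 := by
    have := D.isR.up.2
    rw [D.isR.2.2.1, htG.length] at this
    exact this
  rcases haKC with h0 | h0 | h0
  · rw [h0] at ha hal
    have hvs : ℓ (x * m * t * φ 1) = ℓ (x * m * t) + 1 := by
      rcases hsG.length_mul (x * m * t) with h | h
      · exact h
      · refine absurd (exists_dihedral_right D.isR.ne.symm hsG htG (by omega) ?_ D.kxK) hno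
        rw [htG.cancel_right]; omega
    have h1 := hup.cov.eq_mul_gen ha (by omega) (by omega)
    rw [h1, mul_assoc (x * m)] at hkZ
    exact D.kx_not_ble_mul_mul hm (by rw [← mul_assoc, hts2]; omega) (ble_trans hkxle hkZ)
  · rw [h0] at ha hal
    have hkt : ℓ (k * (x * m) * t) = ℓ (k * (x * m)) + 1 := by
      rcases htG.length_mul (k * (x * m)) with h | h
      · exact h
      · exfalso
        have h2 := hxmu.cov
        rw [hφxm] at h2
        have h3 := h2.eq_mul_gen htG (by omega) (by omega)
        have h4 := hxmu.down
        rw [hφxm, h3] at h4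
        exact hup.not_down h4
    have hkl : ℓ (k * (x * m)) = ℓ x + ℓ m + 1 := by rw [← mul_assoc]; omega
    have h1 : Cov cs (k * (x * m)) (φ (x * m * t)) := ⟨hkZ, by omega⟩
    have h2 := h1.eq_mul_gen htG (by omega) (by omega)
    have hctle : c * t ≼ x * m * t :=
      lift_up_up (ble_trans hcm (ble_right_mul hlen)) htG (by omega)
    obtain ⟨hctu, hφct⟩ := hc.map_mul_isR D.isR hct (φ.ideal hmem hctle)
    have h3 := hup.map_ble hctle hctu
    rw [hφct, h2] at h3
    have h4 : k * (x * m) * t = k * x * (m * t) := by simp only [mul_assoc]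
    rw [h4] at h3
    refine not_ble_mul hc D.isR hct D.kxK ?_ ?_ h3
    · exact (hm.mono (Set.subset_insert _ _)).mul (InPar.gen htG (by simp))
    · rw [← h4, hkt, hm.length_mul htG htC]
      omega
  · have h1 := hd a h0
    have h2 := hup.cov.eq_mul_gen ha (by omega) h1
    rw [h2] at hkZ
    have h5 : ℓ (x * m * t * a) = ℓ (x * m * t) + ℓ a := by
      rw [ha.length]
      rcases ha.length_mul (x * m * t) with h | h <;> omega
    obtain ⟨g₁, g₂, hgg, h6, h7, hgl⟩ := ble_mul_split h5 (ble_trans hkxle hkZ)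
    rcases ble_gen ha h7 with h8 | h8
    · rw [h8, mul_one] at hgg
      rw [← hgg] at h6
      exact hno h6
    · have hkK := D.kxK
      rw [hgg] at hkK
      exact h0.notMem_pair htC (hkK a ha (by rw [← h8]; exact ble_right_mul (by rw [← hgg]; exact hgl)))

theorem up_xs (D : Dev φ t p k b x) (hmem : x * φ 1 ∈ φ.dom) : Up φ (x * φ 1) := by
  have hsG := D.hsG
  rcases up_or_down hmem with h | h
  · exact h
  exfalso
  have h1 := h.2
  have h2 := D.xs
  have h3 := D.xt
  have hzK : InPar cs {φ 1, t} (φ (x * φ 1)) := (D.xK.mul D.sK).map hmem (by simp)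
  have h4 := length_mul_of_minimal_dev hsG D.minimal hzK h.up (by omega)
  have hinv := φ.invol _ hmem
  have h5 : φ (x * φ 1) = x := by
    have h6 := D.two_le
    obtain ⟨a, ha, hal⟩ := exists_mul_gen_lt (cs := cs) (w := φ (x * φ 1))
      (by intro h; rw [h, cs.length_one] at h1; omega)
    have h7 : a = t := by
      rcases hzK.descent ha (by omega) with h | h
      · rw [h] at hal; omega
      · exact h
    rw [h7] at hal
    exact dihedral_ext_right hzK D.xK (by omega) D.isR.1 (by omega) (by omega)
  rw [h5, D.map] at hinv
  exact D.ne hinv.symm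

theorem map_xs (D : Dev φ t p k b x) (hmem : x * φ 1 ∈ φ.dom) :
    InPar cs {φ 1, t} (φ (x * φ 1)) ∧ ℓ (φ (x * φ 1)) = ℓ x + 2 := by
  refine ⟨(D.xK.mul D.sK).map hmem (by simp), ?_⟩
  rw [(D.up_xs hmem).2, D.xs]

theorem map_xsc (D : Dev φ t p k b x) (hc : IsC φ c) (hct : c * t ≠ t * c)
    (hmem : x * φ 1 * c ∈ φ.dom) :
    Up φ (x * φ 1 * c) ∧ φ (x * φ 1 * c) = φ (x * φ 1) * c := by
  have hsG := D.hsG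
  have htG := D.isR.1
  have htC := D.isR.not_isC
  have hcK := hc.notMem_pair htC
  have hcm : InPar cs {q | IsC φ q} c := InPar.gen hc.1 hc
  have hxsK := D.xK.mul D.sK
  have lxs := D.xs
  have lxsc := hxsK.length_mul hc.1 hcK
  have hle : x * φ 1 ≼ x * φ 1 * c := ble_mul_gen hc.1 (by omega)
  have hmem' := φ.ideal hmem hle
  have hxsu := D.up_xs hmem'
  obtain ⟨hgK, hgl⟩ := D.map_xs hmem'
  have hup : Up φ (x * φ 1 * c) := by
    rcases up_or_down hmem with h | h
    · exact h
    · exfalso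
      have h1 := ble_length_le
        (ble_of_ble_mul_isC htC hcm hgK hxsK (h.map_up_ble hle hxsu))
      omega
  refine ⟨hup, ?_⟩
  have hZ := hup.2
  have hgZ := hup.map_ble hle hxsu
  have hxxs : x ≼ x * φ 1 := ble_mul_gen hsG (by omega)
  have hxcle : x * c ≼ x * φ 1 * c := lift_up_up hxxs hc.1 (by omega)
  obtain ⟨hxcu, hφxc⟩ := D.map_mul_isC hcm (φ.ideal hmem hxcle)
  have hkZ := hup.map_ble hxcle hxcu
  have lk := D.lk
  have lkc : ℓ (k * x * c) = ℓ x + 2 := by rw [D.kxK.length_mul hc.1 hcK, lk]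
  rw [hφxc, ← mul_assoc] at hkZ
  have hkcov : Cov cs (k * x * c) (φ (x * φ 1 * c)) := ⟨hkZ, by omega⟩
  have lgc := hgK.length_mul hc.1 hcK
  have hfin : ℓ (φ (x * φ 1 * c) * c) < ℓ (φ (x * φ 1 * c)) →
      φ (x * φ 1 * c) = φ (x * φ 1) * c := fun h =>
    Cov.eq_mul_gen ⟨hgZ, by omega⟩ hc.1 h (by omega)
  obtain ⟨a, ha, hal⟩ := exists_mul_gen_lt (cs := cs) (w := φ (x * φ 1 * c))
    (by intro h; rw [h, cs.length_one] at hZ; omega)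
  have haKC : a = φ 1 ∨ a = t ∨ a = c := by
    rcases gen_ble_map ha hmem (descent_ble ha (by omega)) with h | h
    · rcases gen_ble_mul ha h with h | h
      · rcases hxsK a ha h with h | h
        · exact Or.inl h
        · exact Or.inr (Or.inl h)
      · exact Or.inr (Or.inr (ha.eq_of_ble hc.1 h))
    · exact Or.inl h
  rcases haKC with h0 | h0 | h0
  · rw [h0] at ha hal
    apply hfin
    have e1 : k * x * c * φ 1 = k * x * φ 1 * c := by
      rw [mul_assoc, hc.2.2.2, ← mul_assoc]
    have l1 : ℓ (k * x * φ 1 * c) = ℓ x + 3 := by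
      rw [(D.kxK.mul D.sK).length_mul hc.1 hcK, D.kx_s]
    have h1 := hkcov.eq_mul_gen ha (by omega) (by rw [e1]; omega)
    rw [h1, e1, hc.1.cancel_right, D.kx_s]
    omega
  · exfalso
    rw [h0] at ha hal
    have l1 := length_mul_mul_of_noncomm hc.1 htG hct D.kxK hcK (by simp)
    have h1 := hkcov.eq_mul_gen ha (by omega) (by omega)
    have h2 := ble_trans hle hup.cov.1
    rw [h1] at h2
    obtain ⟨g₁, g₂, hgg, h3, h4, hl⟩ := ble_mul_split (by rw [ha.length]; omega) h2
    have hK := hxsK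
    rw [hgg] at hK hl
    have h5 := ble_of_ble_mul_isC htC hcm (hK.of_ble (ble_left_mul hl)) D.kxK h3
    rcases ble_gen ha h4 with h6 | h6
    · rw [h6, mul_one] at hgg
      rw [← hgg] at h5
      exact D.ne (ble_eq h5 (by omega))
    · have h7 : ℓ (x * φ 1 * t) < ℓ (x * φ 1) := by
        rw [hgg, hl, h6, ha.cancel_right, ha.length]; omega
      have h8 := ble_length_le (exists_dihedral_right D.isR.ne.symm hsG htG
        (by rw [hsG.cancel_right]; omega) h7 hgK)
      omega
  · rw [h0] at hal
    exact hfin (by omega)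

theorem xst (D : Dev φ t p k b x) (hmem : x * φ 1 ∈ φ.dom) :
    ℓ (x * φ 1 * t) = ℓ x + 2 := by
  have h1 := D.xs
  obtain ⟨hgK, hgl⟩ := D.map_xs hmem
  rcases D.isR.1.length_mul (x * φ 1) with h | h
  · omega
  · have h8 := ble_length_le (exists_dihedral_right (u := x * φ 1) D.isR.ne.symm D.hsG D.isR.1
        (by rw [D.hsG.cancel_right]; omega) (by omega) hgK)
    omega

theorem map_ne_xst (D : Dev φ t p k b x) (hmem : x * φ 1 ∈ φ.dom) (hc : IsC φ c)
    (hct : c * t ≠ t * c) (hlen : ℓ (x * φ 1 * c * (t * φ 1)) = ℓ x + 4) :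
    ¬ φ (x * φ 1) * c ≼ x * φ 1 * c * (t * φ 1) := by
  intro h
  have htG := D.isR.1
  have hsG := D.hsG
  have hcK := hc.notMem_pair D.isR.not_isC
  obtain ⟨hgK, hgl⟩ := D.map_xs hmem
  have lgc := hgK.length_mul hc.1 hcK
  have hxsK := D.xK.mul D.sK
  have hxs := D.xs
  have hctsl : ℓ (c * (t * φ 1)) = ℓ c + ℓ (t * φ 1) := by
    rw [(D.tK.mul D.sK).mul_length hc.1 hcK, hc.1.length, add_comm]
  have hts := D.isR.up.2
  rw [D.isR.2.2.1, htG.length] at hts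
  have hl : ℓ (x * φ 1 * (c * (t * φ 1))) = ℓ (x * φ 1) + ℓ (c * (t * φ 1)) := by
    rw [← mul_assoc, hlen, hctsl, hc.1.length, hts]
    omega
  rw [mul_assoc] at h
  obtain ⟨h₁, h', e1, hh1, hh', el1⟩ := ble_mul_split hl h
  obtain ⟨h₂, h₃, e2, hh2, hh3, el2⟩ := ble_mul_split hctsl hh'
  have h1K := hxsK.of_ble hh1
  have h3K := (D.tK.mul D.sK).of_ble hh3
  have hcle : c ≼ φ (x * φ 1) * c :=
    descent_ble hc.1 (by rw [hc.1.cancel_right]; omega)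
  have hc2 : h₂ = c := by
    rcases ble_gen hc.1 hh2 with h0 | h0
    · exfalso
      rw [e1, e2, h0, one_mul] at hcle
      exact hcK ((h1K.mul h3K) c hc.1 hcle)
    · exact h0
  rw [e2, hc2, ← mul_assoc] at e1
  have hconj : InPar cs {φ 1, t} (c * h₃ * c) := by
    have : c * h₃ * c = h₁⁻¹ * φ (x * φ 1) := by
      rw [eq_inv_mul_iff_mul_eq, ← hc.1.cancel_right (φ (x * φ 1)), e1]
      simp only [mul_assoc]
    rw [this]
    exact h1K.inv.mul hgK
  have hcom := comm_of_conj_mem hc.1 hcK h3K hconj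
  have ht3 : ¬ t ≼ h₃ := fun h => hct (comm_letters_of_comm hc.1 hcK h3K hcom t htG h)
  have h3s : InPar cs {φ 1} h₃ := by
    intro a ha hale
    rcases h3K a ha hale with h | h
    · exact h
    · exact absurd (h ▸ hale) ht3
  have hh1l := ble_length_le hh1
  rw [e2, hc2] at el1
  rw [e2, hc2] at el2
  rw [hc.1.length] at el2
  rcases inPar_singleton h3s with h0 | h0
  · rw [h0, cs.length_one] at el2
    rw [h0] at el1
    omega
  · rw [h0, hsG.length] at el2
    rw [h0] at el1
    have h5 := ble_eq hh1 (by omega)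
    rw [h0, h5, mul_assoc, hc.2.2.2, mul_assoc, hsG.cancel_left] at e1
    rw [mul_right_cancel e1] at hgl
    omega

theorem xsct_notMem (D : Dev φ t p k b x) (hc : IsC φ c) (hct : c * t ≠ t * c) :
    x * φ 1 * c * t ∉ φ.dom := by
  intro hmem
  have htG := D.isR.1
  have hsG := D.hsG
  have htC := D.isR.not_isC
  have hcK := hc.notMem_pair htC
  have hxsK := D.xK.mul D.sK
  have lxs := D.xs
  have lxsc := hxsK.length_mul hc.1 hcK
  have lv := length_mul_mul_of_noncomm hc.1 htG hct hxsK hcK (by simp)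
  have hle1 : x * φ 1 ≼ x * φ 1 * c := ble_mul_gen hc.1 (by omega)
  have hle2 : x * φ 1 * c ≼ x * φ 1 * c * t := ble_mul_gen htG (by omega)
  have hmem2 := φ.ideal hmem hle2
  have hmem1 := φ.ideal hmem2 hle1
  obtain ⟨hup2, hφ2⟩ := D.map_xsc hc hct hmem2
  obtain ⟨hgK, hgl⟩ := D.map_xs hmem1
  have lgc := hgK.length_mul hc.1 hcK
  have lgct := length_mul_mul_of_noncomm hc.1 htG hct hgK hcK (by simp)
  have hup : Up φ (x * φ 1 * c * t) := by
    rcases up_or_down hmem with h | h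
    · exact h
    · exfalso
      have h1 := h.map_up_ble hle2 hup2
      rw [hφ2] at h1
      have h2 := ble_eq h1 (by omega)
      rw [h2, htG.cancel_right] at lgct
      omega
  have hZ := hup.2
  have hgZ := hup.map_ble hle2 hup2
  rw [hφ2] at hgZ
  have lxst := D.xst hmem1
  have hctle : c * t ≼ x * φ 1 * c * t :=
    lift_up_up (descent_ble hc.1 (by rw [hc.1.cancel_right]; omega)) htG (by omega)
  obtain ⟨hctu, hφct⟩ := hc.map_mul_isR D.isR hct (φ.ideal hmem hctle)
  have hctsZ := hup.map_ble hctle hctu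
  rw [hφct] at hctsZ
  have hcJ : InPar cs (insert t {q | IsC φ q}) c := InPar.gen hc.1 (by right; exact hc)
  have htJ : InPar cs (insert t {q | IsC φ q}) t := InPar.gen htG (by simp)
  obtain ⟨l1, l2, l3⟩ := hc.length_mul_mul D.isR hct
  have hctK : InPar cs {c, t} (c * t) :=
    (InPar.gen hc.1 (by simp)).mul (InPar.gen htG (by simp))
  obtain ⟨a, ha, hal⟩ := exists_mul_gen_lt (cs := cs) (w := φ (x * φ 1 * c * t))
    (by intro h; rw [h, cs.length_one] at hZ; omega)
  have haKC : a = φ 1 ∨ a = t ∨ a = c := by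
    rcases gen_ble_map ha hmem (descent_ble ha (by omega)) with h | h
    · rcases gen_ble_mul ha h with h | h
      · rcases gen_ble_mul ha h with h | h
        · rcases hxsK a ha h with h | h
          · exact Or.inl h
          · exact Or.inr (Or.inl h)
        · exact Or.inr (Or.inr (ha.eq_of_ble hc.1 h))
      · exact Or.inr (Or.inl (ha.eq_of_ble htG h))
    · exact Or.inl h
  rcases haKC with h0 | h0 | h0
  · rw [h0] at ha hal
    have hvs : ℓ (x * φ 1 * c * t * φ 1) = ℓ (x * φ 1 * c * t) + 1 := by
      rcases hsG.length_mul (x * φ 1 * c * t) with h | h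
      · exact h
      exfalso
      have e1 : x * φ 1 * c * t = x * c * φ 1 * t := by
        rw [mul_assoc x c, hc.2.2.2, ← mul_assoc]
      have h2 := (two_ldescents (u := (x * c * φ 1 * t)⁻¹) hsG htG D.isR.ne.symm
        (by rw [hsG.length_mul_inv, cs.length_inv, ← e1]; omega)
        (by rw [htG.length_mul_inv, cs.length_inv, htG.cancel_right, ← e1, mul_assoc x c,
              hc.2.2.2, ← mul_assoc]; omega)).2 D.isR.2.2.2.symm
      have e2 : t * (φ 1 * (t * (x * c * φ 1 * t)⁻¹)) = (x * c * t)⁻¹ := by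
        simp only [mul_inv_rev, htG.inv, hsG.inv]
        rw [htG.cancel_left, hsG.cancel_left]
      have l4 := length_mul_mul_of_noncomm hc.1 htG hct D.xK hcK (by simp)
      rw [e2, cs.length_inv, cs.length_inv, ← e1] at h2
      omega
    have h1 := hup.cov.eq_mul_gen ha (by omega) (by omega)
    rw [h1, mul_assoc _ t] at hgZ
    exact D.map_ne_xst hmem1 hc hct (by rw [← mul_assoc]; omega) hgZ
  · rw [h0] at hal
    have h1 : Cov cs (φ (x * φ 1) * c) (φ (x * φ 1 * c * t)) := ⟨hgZ, by omega⟩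
    have h2 := h1.eq_mul_gen htG (by omega) (by omega)
    rw [h2, mul_assoc (φ _)] at hctsZ
    refine not_ble_mul hc D.isR hct hgK (hcJ.mul htJ) ?_ hctsZ
    rw [← mul_assoc, lgct, l1]
  · rw [h0] at hal
    have l4 : ℓ (x * φ 1 * (c * t * c)) = ℓ (x * φ 1) + ℓ (c * t * c) := by
      have hR : RMin cs {c, t} (x * φ 1) := by
        rintro a' ha' (h | h)
        · rw [h]; omega
        · rw [h]; omega
      exact hR.length_mul (hctK.mul (InPar.gen hc.1 (by simp)))
    have e1 : x * φ 1 * c * t * c = x * φ 1 * (c * t * c) := by simp only [mul_assoc]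
    have h2 := hup.cov.eq_mul_gen hc.1 (by omega) (by rw [e1]; omega)
    rw [h2, e1] at hctsZ
    exact not_ble_mul hc D.isR hct hxsK ((hcJ.mul htJ).mul hcJ) l4 hctsZ

end Dev

end Obstructions

section Chains

local notation "ℓ" => CoxeterSystem.length cs
local infix:50 " ≼ " => bruhatLE cs

variable {a b c d u v w x y z g h r p q k s t A m X : W} {J K : Set W} {φ : BSM cs} {L L' ω : List W}

/-- A reduced word, as a list of letters in the group. -/
def RedWord (cs : CoxeterSystem M W) (ω : List W) : Prop :=
  (∀ a ∈ ω, Gen cs a) ∧ cs.length ω.prod = ω.length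

theorem length_prod_le (h : ∀ a ∈ ω, Gen cs a) : ℓ ω.prod ≤ ω.length := by
  induction ω with
  | nil => simp
  | cons a ω ih =>
    have h1 := cs.length_mul_le a ω.prod
    have h2 := ih fun b hb => h b (by simp [hb])
    rw [(h a (by simp)).length] at h1
    simp only [List.prod_cons, List.length_cons]
    omega

theorem RedWord.tail (h : RedWord cs (a :: ω)) : RedWord cs ω := by
  have h0 : ∀ b ∈ ω, Gen cs b := fun b hb => h.1 b (by simp [hb])
  refine ⟨h0, ?_⟩
  have h1 := cs.length_mul_le a ω.prod
  have h2 := length_prod_le h0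
  have h3 := h.2
  rw [(h.1 a (by simp)).length] at h1
  simp only [List.prod_cons, List.length_cons] at h3
  omega

theorem RedWord.init (h : RedWord cs (ω ++ [d])) : RedWord cs ω := by
  have h0 : ∀ b ∈ ω, Gen cs b := fun b hb => h.1 b (by simp [hb])
  refine ⟨h0, ?_⟩
  have h1 := cs.length_mul_le ω.prod d
  have h2 := length_prod_le h0
  have h3 := h.2
  rw [(h.1 d (by simp)).length] at h1
  simp only [List.prod_append, List.length_append, List.prod_singleton, List.length_singleton] at h3
  omega

theorem RedWord.prod_ble (h : RedWord cs ω) (hL : L.Sublist ω) : L.prod ≼ ω.prod := by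
  induction hL with
  | slnil => exact ble_refl _
  | cons a hL ih =>
    have h1 := h.2
    have h2 := h.tail.2
    simp only [List.prod_cons, List.length_cons] at h1 ⊢
    exact ble_trans (ih h.tail) (ble_gen_mul (h.1 a (by simp)) (by omega))
  | cons_cons a hL ih =>
    have h1 := h.2
    have h2 := h.tail.2
    simp only [List.prod_cons, List.length_cons] at h1 ⊢
    exact llift_up_up (ih h.tail) (h.1 a (by simp)) (by omega)

theorem exists_redWord (cs : CoxeterSystem M W) (w : W) : ∃ ω, RedWord cs ω ∧ ω.prod = w := by
  induction w using left_induction cs with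
  | one => exact ⟨[], ⟨by simp, by simp⟩, rfl⟩
  | mul w a ha hl ih =>
    obtain ⟨ω, hω, rfl⟩ := ih
    refine ⟨a :: ω, ⟨?_, ?_⟩, by simp⟩
    · simpa [ha] using hω.1
    · rw [List.prod_cons, hl, hω.2]; simp

theorem mem_of_ble_prod (hω : ∀ a ∈ ω, Gen cs a) (ha : Gen cs a) (h : a ≼ ω.prod) : a ∈ ω := by
  induction ω with
  | nil => exact absurd h (by simpa using ha.ble_one)
  | cons b ω ih =>
    rw [List.prod_cons] at h
    rcases gen_ble_mul ha h with h | h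
    · rw [ha.eq_of_ble (hω b (by simp)) h]; simp
    · exact List.mem_cons_of_mem _ (ih (fun c hc => hω c (by simp [hc])) h)

theorem card_le_length (E : Finset W) (hE : ∀ a ∈ E, Gen cs a ∧ a ≼ w) : E.card ≤ ℓ w := by
  classical
  induction w using left_induction cs generalizing E with
  | one =>
    rw [Finset.card_eq_zero.2]
    · simp
    · exact Finset.eq_empty_of_forall_notMem fun a ha => (hE a ha).1.ble_one (hE a ha).2
  | mul w b hb hl ih =>
    have h1 := ih (E.erase b) fun a ha => ⟨(hE a (Finset.mem_of_mem_erase ha)).1, by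
      rcases gen_ble_mul (hE a (Finset.mem_of_mem_erase ha)).1
        (hE a (Finset.mem_of_mem_erase ha)).2 with h | h
      · exact absurd ((hE a (Finset.mem_of_mem_erase ha)).1.eq_of_ble hb h)
          (Finset.ne_of_mem_erase ha)
      · exact h⟩
    have h2 := Finset.pred_card_le_card_erase (s := E) (a := b)
    omega

/-- A nontrivial element has a letter which is not preceded by a noncommuting one. -/
theorem false_of_pred (hX : X ≠ 1) (E : Finset W) (hE : ∀ a ∈ E, Gen cs a ∧ a ≼ X)
    (hcard : ℓ X ≤ E.card)
    (hpred : ∀ a, Gen cs a → a ≼ X → a ∈ E ∧ ∃ a', Gen cs a' ∧ a' * a ≠ a * a' ∧ a' * a ≼ X) : False := by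
  obtain ⟨a, ha, hal⟩ := exists_gen_mul_lt (cs := cs) hX
  have hY : X = a * (a * X) := (ha.cancel_left X).symm
  have hnot : ¬ a ≼ a * X := by
    intro h
    have := card_le_length E (w := a * X) fun b hb => ⟨(hE b hb).1, by
      have h1 := (hE b hb).2
      rw [hY] at h1
      rcases gen_ble_mul (hE b hb).1 h1 with h1 | h1
      · rw [(hE b hb).1.eq_of_ble ha h1]; exact h
      · exact h1⟩
    omega
  obtain ⟨-, a', ha', hne, hle⟩ := hpred a ha (ldescent_ble ha (by omega))
  have hne' : a' ≠ a := fun h => hne (by rw [h])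
  have h2 := (comm_of_length ha' ha hne').1
  rw [hY] at hle
  obtain ⟨g₁, g₂, hg, h3, h4, hl⟩ := ble_mul_split (by rw [ha.cancel_left, ha.length]; omega) hle
  rcases ble_gen ha h3 with h5 | h5
  · rw [h5, one_mul] at hg
    rw [← hg] at h4
    exact hnot (ble_trans (descent_ble ha (by rw [ha.cancel_right, ha'.length]; omega)) h4)
  · rw [h5, ha.length] at hl
    rw [h5] at hg
    have h6 : a' ≼ a' * a := ble_mul_gen ha (by rw [ha'.length]; omega)
    rw [hg] at h6
    have h7 := (gen_ble_mul ha' h6).resolve_left fun h => hne' (ha'.eq_of_ble ha h)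
    have h8 := ble_eq h7 (by rw [ha'.length]; omega)
    rw [← h8] at hg
    exact hne hg

/-- Consecutive letters do not commute. -/
def NonCommChain (L : List W) : Prop := L.IsChain fun a b => a * b ≠ b * a

theorem RedWord.exists_chain (h : RedWord cs ω) (ha : a ∈ ω) :
    ∃ L r, NonCommChain (a :: L) ∧ (a :: L).Sublist ω ∧ (a :: L).getLast? = some r ∧
      ℓ (ω.prod * r) < ℓ ω.prod := by
  induction ω using List.reverseRecOn with
  | nil => simp at ha
  | append_singleton ω d ih =>
    have hd := h.1 d (by simp)
    have h1 := h.2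
    have h2 := h.init.2
    simp only [List.prod_append, List.length_append, List.prod_singleton, List.length_singleton]
      at h1
    have hlast : ℓ ((ω ++ [d]).prod * d) < ℓ (ω ++ [d]).prod := by
      simp only [List.prod_append, List.prod_singleton]
      rw [hd.cancel_right]; omega
    rcases List.mem_append.1 ha with h0 | h0
    · obtain ⟨L, r, hL, hsub, hr, hrd⟩ := ih h.init h0
      have hrG : Gen cs r := h.init.1 r (hsub.subset (List.mem_of_getLast? hr))
      by_cases hcomm : r * d = d * r
      · refine ⟨L, r, hL, hsub.trans (List.sublist_append_left _ _), hr, ?_⟩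
        simp only [List.prod_append, List.prod_singleton]
        rw [mul_assoc, ← hcomm, ← mul_assoc]
        have := cs.length_mul_le (ω.prod * r) d
        rw [hd.length] at this
        omega
      · refine ⟨L ++ [d], d, ?_, ?_, by rw [← List.cons_append, List.getLast?_concat], hlast⟩
        · rw [← List.cons_append]
          refine List.isChain_append.2 ⟨hL, List.isChain_singleton _, ?_⟩
          intro x hx y hy
          rw [hr] at hx
          simp only [Option.mem_def, Option.some.injEq, List.head?_cons] at hx hy
          rw [← hx, ← hy]
          exact hcomm
        · rw [← List.cons_append]
          exact hsub.append (List.Sublist.refl _)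
    · rw [List.mem_singleton.1 h0]
      exact ⟨[], d, List.isChain_singleton _, List.sublist_append_right _ _, rfl, hlast⟩

end Chains

section LeftRight

local notation "ℓ" => CoxeterSystem.length cs
local infix:50 " ≼ " => bruhatLE cs

variable {a b c d l u v w x y z g h r p q k s t A m X : W} {J K : Set W} {φ : BSM cs}
  {C L L' ω : List W}

theorem ble_of_ble_gen_mul (h : u ≼ a * v) (ha : Gen cs a) (hu : ℓ u < ℓ (a * u)) : u ≼ v := by
  have := llift_down_right h ha hu
  rwa [ha.cancel_left] at this

theorem length_mul_three (hl : Gen cs l) (hs : Gen cs s) (ht : Gen cs t) (hls : l * s ≠ s * l)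
    (hst : t * s ≠ s * t) (hlt : l * t = t * l) (hne : l ≠ t) :
    ℓ (l * s * t) = 3 ∧ ∀ a, Gen cs a → a ≠ l → ℓ (a * (l * s * t)) = 4 := by
  have h0 : l ≠ s := fun h => hls (by rw [h])
  have h1 : t ≠ s := fun h => hst (by rw [h])
  have hP : InPar cs {l, s} (l * s) :=
    (InPar.gen hl (by simp)).mul (InPar.gen hs (by simp))
  have hnot : t ∉ ({l, s} : Set W) := by simp [hne.symm, h1]
  have h3 : ℓ (l * s * t) = 3 := by
    rw [hP.length_mul ht hnot, (comm_of_length hl hs h0).1]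
  refine ⟨h3, fun a ha hal => ?_⟩
  rcases eq_or_ne a s with h4 | h4
  · rw [h4, show s * (l * s * t) = s * l * s * t by group,
      InPar.length_mul (J := {l, s}) _ ht hnot]
    · rw [((comm_of_length hs hl h0.symm).2).resolve_left hls.symm]
    · exact ((InPar.gen hs (by simp)).mul (InPar.gen hl (by simp))).mul (InPar.gen hs (by simp))
  rcases eq_or_ne a t with h5 | h5
  · rw [h5, show t * (l * s * t) = l * (t * s * t) by rw [← mul_assoc, ← mul_assoc, ← hlt]; group,
      InPar.mul_length (J := {t, s}) _ hl (by simp [hne, h0])]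
    · rw [((comm_of_length ht hs h1).2).resolve_left hst]
    · exact ((InPar.gen ht (by simp)).mul (InPar.gen hs (by simp))).mul (InPar.gen ht (by simp))
  · rw [InPar.mul_length (J := {l, s, t}) _ ha (by simp [h4, h5, hal]), h3]
    exact ((InPar.gen hl (by simp)).mul (InPar.gen hs (by simp))).mul (InPar.gen ht (by simp))

/-- A letter acting on the left and a commuting letter acting on the right are not joined
by `φ 1`. -/
theorem IsL.mul_notMem (hl : IsL φ l) (ht : IsR φ t) (hlt : l * t = t * l) :
    l * φ 1 * t ∉ φ.dom := by
  intro hmem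
  set s := φ 1 with hs'
  have hs : Gen cs s := gen_map_one (one_mem hmem)
  have hne : l ≠ t := by
    intro h
    have h1 := hl.2.2.1
    rw [h, ht.2.2.1] at h1
    exact ht.2.2.2 h1
  have hls := hl.2.2.2
  have hts := ht.2.2.2
  obtain ⟨h3, hup⟩ := length_mul_three hl.1 hs ht.1 hls hts hlt hne
  obtain ⟨h3', hup'⟩ := length_mul_three ht.1 hs hl.1 hts hls hlt.symm hne.symm
  have hl2 := (comm_of_length hl.1 ht.1 hne).1
  have hls2 := comm_of_length hl.1 hs hl.ne
  have hts2 := comm_of_length ht.1 hs ht.ne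
  have hsl2 := comm_of_length hs hl.1 hl.ne.symm
  have hst2 := comm_of_length hs ht.1 ht.ne.symm
  have hle : l * t ≼ l * s * t := by
    refine lift_up_up ?_ ht.1 (by rw [h3, hls2.1]; omega)
    exact ble_mul_gen hs (by rw [hls2.1, hl.1.length]; omega)
  have hltD : l * t ∈ φ.dom := φ.ideal hmem hle
  have hUl : Up φ l := gen_up hl.1 hl.2.1 hl.ne
  have hUt : Up φ t := gen_up ht.1 ht.2.1 ht.ne
  have hUlt : Up φ (l * t) := by
    rcases up_or_down hltD with h | h
    · exact h
    · rcases gen_ble_mul hs h.ble with h | h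
      · exact absurd (hs.eq_of_ble hl.1 h) hl.ne.symm
      · exact absurd (hs.eq_of_ble ht.1 h) ht.ne.symm
  have hl_lt : l ≼ l * t := ble_mul_gen ht.1 (by rw [hl.1.length, hl2]; omega)
  have ht_lt : t ≼ l * t := ble_gen_mul hl.1 (by rw [ht.1.length, hl2]; omega)
  have hneq : t * s * l ≠ l * s * t := by
    intro h
    have := hup t ht.1 hne.symm
    rw [← h, show t * (t * s * l) = t * t * s * l by group, ht.1.mul_self, one_mul] at this
    omega
  have hts_ne : ∀ z, InPar cs {t, s} z → ¬ l ≼ z := fun z hz h => by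
    have := hz l hl.1 h
    exact (by simpa [hne] using this : l = s) |> hl.ne
  have hls_ne : ∀ z, InPar cs {l, s} z → ¬ t ≼ z := fun z hz h => by
    have := hz t ht.1 h
    exact (by simpa [hne.symm] using this : t = s) |> ht.ne
  have hY : φ (l * t) = t * s * l := by
    have h4 : s * l ≼ φ (l * t) := by
      rw [← hl.2.2.1]; exact hUlt.map_ble hl_lt hUl
    have h5 : t * s ≼ φ (l * t) := by
      rw [← ht.2.2.1]; exact hUlt.map_ble ht_lt hUt
    have h6 : ℓ (φ (l * t)) = 3 := by rw [hUlt.2, hl2]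
    obtain ⟨a, ha, hal⟩ := exists_gen_mul_lt (cs := cs) (w := φ (l * t))
      (by intro h; rw [h, cs.length_one] at h6; omega)
    have h7 : φ (l * t) = a * (a * φ (l * t)) := (ha.cancel_left _).symm
    have h8 : ℓ (a * φ (l * t)) = 2 := by omega
    generalize a * φ (l * t) = Z at h7 h8 hal
    rw [h7] at h4 h5 h6 ⊢
    have hl_sl : l ≼ s * l := ble_gen_mul hs (by rw [hl.1.length, hsl2.1]; omega)
    by_cases hat : a = t
    · rw [hat] at h4 ⊢
      have h9 := ble_of_ble_gen_mul h4 ht.1 (by rw [← mul_assoc, h3', hsl2.1]; omega)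
      rw [← ble_eq h9 (by omega), mul_assoc]
    · exfalso
      have h9 := ble_of_ble_gen_mul h5 ha (by
        rcases eq_or_ne a s with h | h
        · rw [h, ← mul_assoc, hst2.2.resolve_left hts.symm, hts2.1]; omega
        · rw [InPar.mul_length (J := {t, s}) _ ha (by simp [hat, h])]
          · omega
          · exact (InPar.gen ht.1 (by simp)).mul (InPar.gen hs (by simp)))
      have hZ := ble_eq h9 (by omega)
      have hTS : InPar cs {t, s} Z := by
        rw [← hZ]
        exact (InPar.gen ht.1 (by simp)).mul (InPar.gen hs (by simp))
      rcases gen_ble_mul hl.1 (ble_trans hl_sl h4) with h | h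
      · have hla := hl.1.eq_of_ble ha h
        rw [← hla] at h4
        have h10 := ble_of_ble_gen_mul h4 hl.1 (by
          rw [← mul_assoc, hls2.2.resolve_left hls, hsl2.1]; omega)
        exact hts_ne _ hTS (ble_trans hl_sl h10)
      · exact hts_ne _ hTS h
  have hU : Up φ (l * s * t) := by
    rcases up_or_down hmem with h | h
    · exact h
    · exfalso
      have h1 := h.map_up_ble hle hUlt
      rw [hY] at h1
      exact hneq (ble_eq h1 (by omega))
  have h4 : t * s * l ≼ φ (l * s * t) := by
    rw [← hY]; exact hU.map_ble hle hUlt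
  have h5 : l * s * t ≼ φ (l * s * t) := hU.cov.1
  have h6 : ℓ (φ (l * s * t)) = 4 := by rw [hU.2, h3]
  obtain ⟨a, ha, hal⟩ := exists_gen_mul_lt (cs := cs) (w := φ (l * s * t))
    (by intro h; rw [h, cs.length_one] at h6; omega)
  have h7 : φ (l * s * t) = a * (a * φ (l * s * t)) := (ha.cancel_left _).symm
  have h8 : ℓ (a * φ (l * s * t)) = 3 := by omega
  generalize a * φ (l * s * t) = Z at h7 h8 hal
  rw [h7] at h4 h5
  by_cases hat : a = t
  · have hal' : a ≠ l := fun h => hne (h.symm.trans hat)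
    have h9 := ble_eq (ble_of_ble_gen_mul h5 ha (by rw [hup a ha hal', h3]; omega)) (by omega)
    rw [← h9, hat, show t * (l * s * t) = l * (t * s * t) by
      rw [← mul_assoc, ← mul_assoc, ← hlt]; group] at h4
    have h10 := ble_of_ble_gen_mul h4 hl.1 (by rw [hup' l hl.1 hne, h3']; omega)
    refine hts_ne (t * s * t) ?_ (ble_trans (descent_ble hl.1 ?_) h10)
    · exact ((InPar.gen ht.1 (by simp)).mul (InPar.gen hs (by simp))).mul (InPar.gen ht.1 (by simp))
    · rw [hl.1.cancel_right, hts2.1, h3']; omega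
  · have h9 := ble_eq (ble_of_ble_gen_mul h4 ha (by rw [hup' a ha hat, h3']; omega)) (by omega)
    by_cases hal' : a = l
    · rw [← h9, hal', show l * (t * s * l) = t * (l * s * l) by
        rw [← mul_assoc, ← mul_assoc, hlt]; group] at h5
      have h10 := ble_of_ble_gen_mul h5 ht.1 (by rw [hup t ht.1 hne.symm, h3]; omega)
      refine hls_ne (l * s * l) ?_ (ble_trans (descent_ble ht.1 ?_) h10)
      · exact ((InPar.gen hl.1 (by simp)).mul (InPar.gen hs (by simp))).mul
          (InPar.gen hl.1 (by simp))
      · rw [ht.1.cancel_right, hls2.1, h3]; omega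
    · have h10 := ble_eq (ble_of_ble_gen_mul h5 ha (by rw [hup a ha hal', h3]; omega)) (by omega)
      exact hneq (h9.trans h10.symm)

theorem RedWord.of_nodup (h : ∀ a ∈ ω, Gen cs a) (hn : ω.Nodup) : RedWord cs ω := by
  induction ω with
  | nil => exact ⟨h, by simp⟩
  | cons a ω ih =>
    have h1 := ih (fun b hb => h b (by simp [hb])) (List.nodup_cons.1 hn).2
    refine ⟨h, ?_⟩
    have h2 : InPar cs {b | b ∈ ω} ω.prod := fun b hb hbl => mem_of_ble_prod h1.1 hb hbl
    rw [List.prod_cons, h2.mul_length (h a (by simp)) (List.nodup_cons.1 hn).1, h1.2]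
    simp

/-- A chain joining a letter acting on the left to a letter acting on the right. -/
structure LRChain (φ : BSM cs) (C : List W) : Prop where
  chain : NonCommChain C
  head : ∃ l, C.head? = some l ∧ IsL φ l
  last : ∃ r, C.getLast? = some r ∧ IsR φ r
  word : ∃ ω, RedWord cs ω ∧ ω.prod ∈ φ.dom ∧ C.Sublist ω

theorem LRChain.gen (h : LRChain φ C) (ha : a ∈ C) : Gen cs a ∧ a ∈ φ.dom := by
  obtain ⟨ω, hω, hD, hsub⟩ := h.word
  refine ⟨hω.1 a (hsub.subset ha), φ.ideal hD ?_⟩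
  have := hω.prod_ble (L := [a]) (List.singleton_sublist.2 (hsub.subset ha))
  simpa using this

/-- A chain joining a letter acting on the left to a letter acting on the right, of minimal
length. -/
def MinLRChain (φ : BSM cs) (C : List W) : Prop :=
  LRChain φ C ∧ ∀ C', LRChain φ C' → C.length ≤ C'.length

theorem MinLRChain.isL_left (h : MinLRChain φ (L ++ a :: L')) (ha : IsL φ a) : L = [] := by
  have h1 : LRChain φ (a :: L') := by
    refine ⟨?_, ⟨a, rfl, ha⟩, ?_, ?_⟩
    · exact (List.isChain_append.1 h.1.chain).2.1
    · obtain ⟨r, hr, hr'⟩ := h.1.last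
      exact ⟨r, by simpa using hr, hr'⟩
    · obtain ⟨ω, hω, hD, hsub⟩ := h.1.word
      exact ⟨ω, hω, hD, (List.sublist_append_right _ _).trans hsub⟩
  have h2 := h.2 _ h1
  rw [List.length_append] at h2
  exact List.length_eq_zero_iff.1 (by omega)

theorem MinLRChain.isR_right (h : MinLRChain φ (L ++ a :: L')) (ha : IsR φ a) : L' = [] := by
  have h1 : LRChain φ (L ++ [a]) := by
    have h0 : (L ++ [a]).Sublist (L ++ a :: L') :=
      (List.Sublist.refl L).append (List.singleton_sublist.2 (by simp))
    refine ⟨?_, ?_, ⟨a, by simp, ha⟩, ?_⟩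
    · have h1 := List.isChain_append.1 h.1.chain
      exact List.isChain_append.2 ⟨h1.1, List.isChain_singleton _, h1.2.2⟩
    · obtain ⟨r, hr, hr'⟩ := h.1.head
      refine ⟨r, ?_, hr'⟩
      cases L <;> simpa using hr
    · obtain ⟨ω, hω, hD, hsub⟩ := h.1.word
      exact ⟨ω, hω, hD, h0.trans hsub⟩
  have h2 := h.2 _ h1
  simp only [List.length_append, List.length_cons, List.length_nil] at h2
  exact List.length_eq_zero_iff.1 (by omega)

theorem MinLRChain.nodup (h : MinLRChain φ C) : C.Nodup := by
  rw [List.nodup_iff_sublist]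
  intro a hsub
  obtain ⟨r₁, r₂, hC, h1, h2⟩ := List.cons_sublist_iff.1 hsub
  obtain ⟨L₁, L₂, h3⟩ := List.append_of_mem h1
  obtain ⟨L₃, L₄, h4⟩ := List.append_of_mem (List.singleton_sublist.1 h2)
  have hC' : C = (L₁ ++ (a :: L₂)) ++ (L₃ ++ (a :: L₄)) := by rw [hC, h3, h4]
  clear hC h1 h2 h3 h4 hsub
  subst hC'
  have h1 : LRChain φ (L₁ ++ a :: L₄) := by
    have h0 : (L₁ ++ a :: L₄).Sublist ((L₁ ++ (a :: L₂)) ++ (L₃ ++ (a :: L₄))) := by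
      refine List.Sublist.append ?_ ?_
      · exact List.sublist_append_left _ _
      · exact List.sublist_append_right _ _
    have h5 := List.isChain_append.1 h.1.chain
    have h6 := List.isChain_append.1 h5.1
    have h7 := List.isChain_append.1 h5.2.1
    refine ⟨?_, ?_, ?_, ?_⟩
    · exact List.isChain_append.2 ⟨h6.1, h7.2.1, h6.2.2⟩
    · obtain ⟨r, hr, hr'⟩ := h.1.head
      refine ⟨r, ?_, hr'⟩
      cases L₁ <;> simpa using hr
    · obtain ⟨r, hr, hr'⟩ := h.1.last
      refine ⟨r, ?_, hr'⟩
      rw [← hr, ← List.append_assoc, List.getLast?_append_cons, List.getLast?_append_cons]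
    · obtain ⟨ω, hω, hD, hsub⟩ := h.1.word
      exact ⟨ω, hω, hD, h0.trans hsub⟩
  have h2 := h.2 _ h1
  simp only [List.length_append, List.length_cons] at h2
  omega

theorem MinLRChain.false_of_mem (h : MinLRChain φ C) (hs : φ 1 ∈ C) : False := by
  obtain ⟨L, L', rfl⟩ := List.append_of_mem hs
  obtain ⟨l, hl, hl'⟩ := h.1.head
  obtain ⟨r, hr, hr'⟩ := h.1.last
  have hch := List.isChain_append.1 h.1.chain
  have hL : L ≠ [] := by
    rintro rfl
    simp only [List.nil_append, List.head?_cons, Option.some.injEq] at hl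
    exact hl'.ne hl.symm
  have hL' : L' ≠ [] := by
    rintro rfl
    simp only [List.getLast?_append_cons, List.getLast?_singleton, Option.some.injEq] at hr
    exact hr'.ne hr.symm
  obtain ⟨L₁, q, rfl⟩ : ∃ L₁ q, L = L₁ ++ [q] :=
    ⟨L.dropLast, L.getLast hL, (List.dropLast_append_getLast hL).symm⟩
  obtain ⟨t, L₂, rfl⟩ := List.exists_cons_of_ne_nil hL'
  have hqs : q * φ 1 ≠ φ 1 * q := hch.2.2 q (by simp) _ (by simp)
  have hst : φ 1 * t ≠ t * φ 1 := (List.isChain_cons_cons.1 hch.2.1).1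
  have hq := h.1.gen (a := q) (by simp)
  have ht := h.1.gen (a := t) (by simp)
  have h1 : L₁ ++ [q] ++ φ 1 :: t :: L₂ = L₁ ++ q :: (φ 1 :: t :: L₂) := by simp
  have h2 : L₁ ++ [q] ++ φ 1 :: t :: L₂ = (L₁ ++ [q] ++ [φ 1]) ++ t :: L₂ := by simp
  have hqL : IsL φ q := by
    rcases letter_cases hq.1 hq.2 with h0 | h0 | h0 | h0
    · exact absurd (by rw [h0]) hqs
    · exact absurd h0.2.2.2 hqs
    · rw [h1] at h
      exact absurd (h.isR_right h0) (by simp)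
    · exact h0
  have htR : IsR φ t := by
    rcases letter_cases ht.1 ht.2 with h0 | h0 | h0 | h0
    · exact absurd (by rw [h0]) hst
    · exact absurd h0.2.2.2.symm hst
    · exact h0
    · rw [h2] at h
      exact absurd (h.isL_left h0) (by simp)
  have hL1 : L₁ = [] := by rw [h1] at h; exact h.isL_left hqL
  have hL2 : L₂ = [] := by rw [h2] at h; exact h.isR_right htR
  subst hL1 hL2
  obtain ⟨ω, hω, hD, hsub⟩ := h.1.word
  by_cases hc : q * t = t * q
  · refine hqL.mul_notMem htR hc (φ.ideal hD ?_)
    have := hω.prod_ble hsub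
    simpa [mul_assoc] using this
  · have h3 : LRChain φ [q, t] := by
      refine ⟨?_, ⟨q, rfl, hqL⟩, ⟨t, rfl, htR⟩, ω, hω, hD, List.Sublist.trans ?_ hsub⟩
      · exact List.isChain_cons_cons.2 ⟨hc, List.isChain_singleton _⟩
      · simp
    have := h.2 _ h3
    simp at this

theorem MinLRChain.false_of_notMem (h : MinLRChain φ C) (hs : φ 1 ∉ C) : False := by
  classical
  obtain ⟨ω, hω, hD, hsub⟩ := h.1.word
  obtain ⟨l, hl, hl'⟩ := h.1.head
  obtain ⟨t, ht, ht'⟩ := h.1.last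
  have hC : RedWord cs C := .of_nodup (fun a ha => (h.1.gen ha).1) h.nodup
  have hmemC : ∀ a ∈ C, a ≼ C.prod := fun a ha => by
    simpa using hC.prod_ble (List.singleton_sublist.2 ha)
  have hsG : Gen cs (φ 1) := gen_map_one (one_mem hD)
  have hCD : C.prod ∈ φ.dom := φ.ideal hD (hω.prod_ble hsub)
  have hU : Up φ C.prod := by
    rcases up_or_down hCD with h0 | h0
    · exact h0
    · exact absurd (mem_of_ble_prod hC.1 hsG h0.ble) hs
  have hlC : l ∈ C := List.mem_of_mem_head? hl
  have htC : t ∈ C := List.mem_of_getLast? ht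
  have hle : C.prod ≼ φ C.prod := hU.cov.1
  have hX : ℓ (φ C.prod) = C.length + 1 := by rw [hU.2, hC.2]
  refine false_of_pred (cs := cs) (X := φ C.prod) ?_ (insert (φ 1) C.toFinset) ?_ ?_ ?_
  · intro h0
    rw [h0, cs.length_one] at hX
    omega
  · intro a ha
    rcases Finset.mem_insert.1 ha with h0 | h0
    · rw [h0]; exact ⟨hsG, hU.down.ble⟩
    · rw [List.mem_toFinset] at h0
      exact ⟨hC.1 a h0, ble_trans (hmemC a h0) hle⟩
  · rw [Finset.card_insert_of_notMem (by simpa using hs), List.toFinset_card_of_nodup h.nodup, hX]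
  · intro a ha hal
    rcases gen_ble_map ha hCD hal with h0 | h0
    · have haC := mem_of_ble_prod hC.1 ha h0
      refine ⟨by simp [haC], ?_⟩
      obtain ⟨L, L', hLL⟩ := List.append_of_mem haC
      rcases List.eq_nil_or_concat L with h1 | ⟨L₁, q, h1⟩
      · rw [hLL, h1] at hl
        simp only [List.nil_append, List.head?_cons, Option.some.injEq] at hl
        rw [hl]
        refine ⟨φ 1, hsG, hl'.2.2.2.symm, ?_⟩
        rw [← hl'.2.2.1]
        exact hU.map_ble (hmemC l hlC) (gen_up hl'.1 hl'.2.1 hl'.ne)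
      · rw [h1] at hLL
        refine ⟨q, hC.1 q (by simp [hLL]), ?_, ?_⟩
        · have := h.1.chain
          rw [hLL] at this
          exact (List.isChain_append.1 this).2.2 q (by simp) a (by simp)
        · refine ble_trans ?_ hle
          have h2 : [q, a].Sublist C := by
            rw [hLL]
            have : L₁ ++ [q] ++ a :: L' = L₁ ++ ([q, a] ++ L') := by simp
            rw [List.concat_eq_append, this]
            exact (List.sublist_append_left _ _).trans (List.sublist_append_right _ _)
          simpa using hC.prod_ble h2
    · refine ⟨by simp [h0], t, ht'.1, ?_, ?_⟩
      · rw [h0]; exact ht'.2.2.2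
      · rw [h0, ← ht'.2.2.1]
        exact hU.map_ble (hmemC t htC) (gen_up ht'.1 ht'.2.1 ht'.ne)

/-- An element all of whose right descents act on the right has no letter acting on the
left. -/
theorem not_isL_of_descents (hA : A ∈ φ.dom) (hd : ∀ a, Gen cs a → ℓ (A * a) < ℓ A → IsR φ a)
    (hl : IsL φ l) : ¬ l ≼ A := by
  intro hle
  obtain ⟨ω, hω, rfl⟩ := exists_redWord cs A
  obtain ⟨L, r, hL, hsub, hr, hrd⟩ := hω.exists_chain (mem_of_ble_prod hω.1 hl.1 hle)
  have hex : ∃ n C, LRChain φ C ∧ C.length = n :=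
    ⟨_, l :: L, ⟨hL, ⟨l, rfl, hl⟩, ⟨r, hr, hd r (hω.1 r (hsub.subset (List.mem_of_getLast? hr)))
      hrd⟩, ω, hω, hA, hsub⟩, rfl⟩
  classical
  obtain ⟨C, hC, hn⟩ := Nat.find_spec hex
  have hmin : MinLRChain φ C :=
    ⟨hC, fun C' hC' => by rw [hn]; exact Nat.find_min' hex ⟨C', hC', rfl⟩⟩
  by_cases hs : φ 1 ∈ C
  · exact hmin.false_of_mem hs
  · exact hmin.false_of_notMem hs

end LeftRight

section Wild

local notation "ℓ" => CoxeterSystem.length cs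
local infix:50 " ≼ " => bruhatLE cs

variable {a b b' c d l u v w x x' y z g h r p p' q k k' s t t' A m X : W} {J K : Set W} {φ : BSM cs}

/-- A letter acting on the right, such that `φ` is not a right multiplication on the dihedral
subgroup it generates with `φ 1`. -/
def Wild (φ : BSM cs) (t : W) : Prop := ∃ p k b x, Dev φ t p k b x

theorem Wild.isR (h : Wild φ t) : IsR φ t := by
  obtain ⟨_, _, _, _, D⟩ := h
  exact D.isR

theorem map_eq_of_not_wild (ht : IsR φ t) (hw : ¬ Wild φ t) (hu : Up φ u)
    (hK : InPar cs {φ 1, t} u) : φ u = u * φ 1 := by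
  by_contra hne
  obtain ⟨p, k, b, x, D, -⟩ := exists_dev ht hu hK hne
  exact hw ⟨p, k, b, x, D⟩

theorem Dev.descent (D : Dev φ t p k b x) (ha : Gen cs a) (h : ℓ (x * a) < ℓ x) : a = t := by
  rcases D.xK.descent ha h with h1 | h1
  · have := D.xs
    rw [h1] at h
    omega
  · exact h1

theorem Dev.rMin (D : Dev φ t p k b x) (hJ : t ∉ J) : RMin cs J x := by
  intro a ha haJ
  by_contra h
  have hl := ha.length_mul x
  exact hJ (D.descent ha (by omega) ▸ haJ)

theorem Dev.kx_rMin (D : Dev φ t p k b x) (hJ : t ∉ J) : RMin cs J (k * x) := by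
  intro a ha haJ
  by_contra h
  have hl := ha.length_mul (k * x)
  rcases D.kxK.descent ha (by omega) with h1 | h1
  · have := D.kx_s
    have := D.lk
    rw [h1] at hl h
    omega
  · exact hJ (by rwa [← h1])

theorem Dev.map_mem (D : Dev φ t p k b x) : k * x ∈ φ.dom := by
  rw [← D.map]; exact φ.maps _ D.up.1

theorem Wild.unique (hw : w ∈ φ.dom) (hD : ∀ u ∈ φ.dom, u ≼ w) (h : Wild φ t) (h' : Wild φ t') :
    t = t' := by
  by_contra hne
  obtain ⟨p, k, b, x, D⟩ := h
  obtain ⟨p', k', b', x', D'⟩ := h'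
  obtain ⟨A, y, hwA, hA, hy, hl⟩ := exists_rmin cs {a | a ≠ t ∧ a ≠ t'} w
  have hx : x ≼ A := (D.rMin (by simp)).ble (hwA ▸ hD x D.up.1) hy (by rw [← hwA, hl])
  have hx' : x' ≼ A := (D'.rMin (by simp)).ble (hwA ▸ hD x' D'.up.1) hy (by rw [← hwA, hl])
  have hAw : A ≼ w := by
    rw [hwA]; exact ble_left_mul (by rw [← hwA, hl])
  have hA1 : A ≠ 1 := by
    intro h
    rw [h] at hx
    have := ble_length_le hx
    have := D.two_le
    rw [cs.length_one] at *
    omega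
  obtain ⟨a, ha, hal⟩ := exists_mul_gen_lt (cs := cs) hA1
  by_cases h1 : a = t
  · rw [h1] at hal
    refine D'.mul_notMem D.isR hne (φ.ideal hw (ble_trans ?_ hAw))
    exact lift_up_left hx' D.isR.1 (by omega)
  by_cases h2 : a = t'
  · rw [h2] at hal
    refine D.mul_notMem D'.isR (Ne.symm hne) (φ.ideal hw (ble_trans ?_ hAw))
    exact lift_up_left hx D'.isR.1 (by omega)
  · have := hA a ha ⟨h1, h2⟩
    omega

theorem Dev.mirror_map (D : Dev (mirror φ) l p' k' b' z) : φ z⁻¹ = z⁻¹ * k' := by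
  have := D.map
  rw [mirror_apply, inv_eq_iff_eq_inv, mul_inv_rev, D.hk.inv] at this
  exact this

theorem Dev.split_ble (D : Dev φ t p k b x) (D' : Dev (mirror φ) l p' k' b' z) (hX : X ∈ φ.dom)
    (h1 : k * x ≼ X) (h2 : z⁻¹ * k' ≼ X) :
    ∃ A y, X = A * y ∧ ℓ X = ℓ A + ℓ y ∧ InPar cs {a | ¬ IsR φ a} y ∧ k * x ≼ A ∧ z⁻¹ * k' ≼ y := by
  obtain ⟨A, y, hXA, hA, hy, hl⟩ := exists_rmin cs {a | ¬ IsR φ a} X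
  have hlA : ℓ (A * y) = ℓ A + ℓ y := by rw [← hXA, hl]
  have hAX : A ≼ X := by
    rw [hXA]; exact ble_left_mul hlA
  refine ⟨A, y, hXA, hl, hy,
    (D.kx_rMin (by simpa using D.isR)).ble (hXA ▸ h1) hy hlA, ?_⟩
  have hL : IsL φ l := isR_mirror.1 D'.isR
  have hnl : ¬ l ≼ A := by
    refine not_isL_of_descents (φ.ideal hX hAX) (fun a ha hd => ?_) hL
    by_contra hR
    have := hA a ha hR
    omega
  obtain ⟨g₁, g₂, hg, hg1, hg2, hgl⟩ := ble_mul_split hlA (hXA ▸ h2)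
  rw [hg]
  suffices g₁ = 1 by rwa [this, one_mul]
  by_contra hne
  obtain ⟨a, ha, hal⟩ := exists_gen_mul_lt (cs := cs) hne
  have hs : mirror φ 1 = φ 1 := by
    rw [mirror_one, (gen_map_one (one_mem hX)).inv]
  have hK : InPar cs {φ 1, l} (z⁻¹ * k') := by
    have := D'.kxK.inv
    rwa [mul_inv_rev, D'.hk.inv, hs] at this
  have hd : ℓ (a * (z⁻¹ * k')) < ℓ (z⁻¹ * k') := by
    have := cs.length_mul_le (a * g₁) g₂
    rw [hgl, hg, ← mul_assoc]
    omega
  rcases hK.ldescent ha hd with h3 | h3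
  · have h4 := D'.kx_s
    have h5 := D'.lk
    rw [← cs.length_inv, mul_inv_rev, mul_inv_rev, D'.hk.inv, D'.hsG.inv, hs] at h4
    rw [← cs.length_inv, mul_inv_rev, D'.hk.inv] at h5
    rw [h3] at hd
    omega
  · exact hnl (h3 ▸ ble_trans (ldescent_ble ha (by omega)) hg1)

theorem Wild.not_mirror (hw : w ∈ φ.dom) (hD : ∀ u ∈ φ.dom, u ≼ w) (h : Wild φ t)
    (h' : Wild (mirror φ) l) : False := by
  obtain ⟨p, k, b, x, D⟩ := h
  obtain ⟨p', k', b', z, D'⟩ := h'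
  have hzu : Up φ z⁻¹ := up_mirror.1 D'.up
  have hkz : z⁻¹ * k' ∈ φ.dom := by
    rw [← D'.mirror_map]; exact φ.maps _ hzu.1
  have hxk : x ≼ k * x := ble_gen_mul D.hk (by rw [D.lk]; omega)
  have hlz : ℓ (z⁻¹ * k') = ℓ z + 1 := by
    rw [← cs.length_inv, mul_inv_rev, D'.hk.inv, inv_inv, D'.lk]
  have hzk : z⁻¹ ≼ z⁻¹ * k' := ble_mul_gen D'.hk (by rw [hlz, cs.length_inv]; omega)
  obtain ⟨A, y, hwA, hl, hy, h1, h2⟩ := D.split_ble D' hw (hD _ D.map_mem) (hD _ hkz)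
  have hmem : x * z⁻¹ ∈ φ.dom := by
    refine φ.ideal hw ?_
    rw [hwA]
    exact ble_mul_mono (by rw [← hwA, hl]) (ble_trans hxk h1) (ble_trans hzk h2)
  have hlxz : ℓ (x * z⁻¹) = ℓ x + ℓ z := by
    rw [(D.rMin (J := {a | ¬ IsR φ a}) (by simpa using D.isR)).length_mul
      (hy.of_ble (ble_trans hzk h2)), cs.length_inv]
  have key : ∀ X ∈ φ.dom, k * x ≼ X → z⁻¹ * k' ≼ X → ℓ x + ℓ z + 2 ≤ ℓ X := by
    intro X hX h3 h4
    obtain ⟨A, y, -, hl, -, h5, h6⟩ := D.split_ble D' hX h3 h4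
    have h7 := ble_length_le h5
    have h8 := ble_length_le h6
    rw [D.lk] at h7
    rw [hlz] at h8
    omega
  have hx : x ≼ x * z⁻¹ := ble_left_mul (by rw [hlxz, cs.length_inv])
  have hz : z⁻¹ ≼ x * z⁻¹ := ble_right_mul (by rw [hlxz, cs.length_inv])
  rcases up_or_down hmem with h | h
  · have := key _ (φ.maps _ hmem) (by rw [← D.map]; exact h.map_ble hx D.up)
      (by rw [← D'.mirror_map]; exact h.map_ble hz hzu)
    rw [h.2] at this
    omega
  · have := key _ hmem (by rw [← D.map]; exact h.map_up_ble hx D.up)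
      (by rw [← D'.mirror_map]; exact h.map_up_ble hz hzu)
    omega

end Wild

section NonWild

local notation "ℓ" => CoxeterSystem.length cs
local infix:50 " ≼ " => bruhatLE cs

variable {a b b' c d l u v w x x' y z g h r p p' q k k' s t t' A m X : W} {J K : Set W} {φ : BSM cs}

theorem inPar_pair_of_comm (hp : Gen cs p) (hq : Gen cs q) (hc : p * q = q * p)
    (h : InPar cs {p, q} g) : g = 1 ∨ g = p ∨ g = q ∨ g = q * p := by
  induction g using right_induction cs with
  | one => exact Or.inl rfl
  | mul g a ha hl ih =>
    have h1 := ih (h.of_ble (ble_mul_gen ha (by omega)))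
    have h2 : a = p ∨ a = q := h.descent ha (by rw [ha.cancel_right]; omega)
    rcases h2 with h2 | h2 <;> rw [h2] <;> rcases h1 with h1 | h1 | h1 | h1 <;> rw [h1]
    · simp
    · rw [hp.mul_self]; simp
    · simp
    · rw [hp.cancel_right]; simp
    · simp
    · rw [hc]; simp
    · rw [hq.mul_self]; simp
    · rw [← hc, hq.cancel_right]; simp

/-- Without letters acting on the left and without deviations, `φ` is a right multiplication. -/
theorem map_eq_mul_right (hA : A ∈ φ.dom) (hL : ∀ l, IsL φ l → ¬ l ≼ A)
    (hdev : ∀ t p k b x, Dev φ t p k b x → ¬ x ≼ A) (hu : Up φ u) (huA : u ≼ A) :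
    φ u = u * φ 1 := by
  refine eq_mul_right_of_dihedral hA (fun t ht u hu hK hle => ?_) hu huA
  have hs : Gen cs (φ 1) := gen_map_one (one_mem hA)
  have h1 : ¬ t ≼ u ∨ t = φ 1 → φ u = u * φ 1 := by
    intro h
    have : InPar cs {φ 1} u := by
      intro a ha hau
      rcases hK a ha hau with h2 | h2
      · exact h2
      · rw [Set.mem_singleton_iff] at h2
        rcases h with h | h
        · exact absurd (h2 ▸ hau) h
        · rw [h2, h]; rfl
    rcases inPar_singleton this with h2 | h2
    · rw [h2, one_mul]
    · rw [h2] at hu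
      exact absurd (up_one (one_mem hA)).down hu.not_down
  by_cases htu : t ≼ u
  · rcases letter_cases ht (φ.ideal hu.1 htu) with h | h | h | h
    · exact h1 (Or.inr h)
    · rcases inPar_pair_of_comm hs ht h.2.2.2.symm hK with h2 | h2 | h2 | h2
      · rw [h2, one_mul]
      · rw [h2] at hu
        exact absurd (up_one (one_mem hA)).down hu.not_down
      · rw [h2, h.map]
      · rw [h2, ← h.map] at hu
        exact absurd h.up.down hu.not_down
    · by_contra hne
      obtain ⟨p, k, b, x, D, hx⟩ := exists_dev h hu hK hne
      exact hdev _ _ _ _ _ D (ble_trans hx hle)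
    · exact absurd (ble_trans htu hle) (hL t h)
  · exact h1 (Or.inl htu)

theorem NonComm.ne_one (h : NonComm φ p b) (hp : Gen cs p) (hL : ¬ IsL φ p) : b ≠ 1 := by
  rintro rfl
  have h1 := h.mem
  have h2 := h.ne
  have h3 := h.ne'
  rw [mul_one] at h1 h2 h3
  rcases letter_cases hp h1 with h4 | h4 | h4 | h4
  · exact h2 h4.symm
  · exact h3 h4.map
  · exact h3 h4.2.2.1
  · exact hL h4

/-- A noncommuting pair does not occur in a dihedral subgroup on which `φ` is a right
multiplication. -/
theorem NonComm.not_of_not_wild (h : NonComm φ p b) (hp : Gen cs p) (ht : IsR φ t)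
    (hw : ¬ Wild φ t) (hpK : p ∈ ({φ 1, t} : Set W)) (hb : InPar cs {φ 1, t} b) : False := by
  have h1 := map_eq_of_not_wild ht hw h.up hb
  have h2 := map_eq_of_not_wild ht hw (h.up_mul hp) ((InPar.gen hp hpK).mul hb)
  exact h.ne' (by rw [h1, h2, mul_assoc])

/-- A minimal left coset representative on which `φ` moves up bounds the matched element. -/
theorem gen_mul_ne_map (hw : Down φ w) (hwA : w = A * y) (hl : ℓ w = ℓ A + ℓ y)
    (hA : RMin cs J A) (hy : InPar cs J y) (hup : Up φ A) (hpA : ℓ (p * A) < ℓ A)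
    (hpw : ℓ (p * w) + 1 = ℓ w) (hp : Gen cs p) : p * w ≠ φ w := by
  intro h
  have h1 : A ≼ φ w := hw.ble_map (by rw [hwA]; exact ble_left_mul (by rw [← hwA, hl])) hup
  rw [← h, hwA, ← mul_assoc] at h1
  have h2 := hA.ble h1 hy (by
    rw [mul_assoc, ← hwA]
    have := hp.mul_length A
    omega)
  have := ble_length_le h2
  omega

theorem exists_left_cancel (hp : Gen cs p) (hwA : w = A * y) (hl : ℓ w = ℓ A + ℓ y)
    (hpA : ℓ (p * A) < ℓ A) : w = p * (p * A * y) ∧ ℓ (p * w) + 1 = ℓ w ∧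
      ℓ (p * A * y) = ℓ (p * A) + ℓ y ∧ ℓ (p * A) + 1 = ℓ A := by
  have h1 := hp.mul_length A
  have h2 := cs.length_mul_le (p * A) y
  have h3 : p * w = p * A * y := by rw [hwA, mul_assoc]
  have h4 := hp.mul_length w
  rw [h3] at h4
  refine ⟨by rw [← h3, hp.cancel_left], ?_, ?_, ?_⟩ <;> (try rw [h3]) <;> omega

theorem NonComm.goodLeft_aux (hp : Gen cs p) (hk : Gen cs k) (hkp : k ≠ p)
    (hs : φ 1 ∈ ({p, k} : Set W)) (h : NonComm φ p b) (hb : InPar cs {p, k} b) (hb1 : b ≠ 1)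
    (hr : IsR φ r) (hrK : r ∉ ({p, k} : Set W)) (hA : ℓ (A * r) < ℓ A) (hl : ℓ (A * y) = ℓ A + ℓ y)
    (hbw : b ≼ A * y) (hup : ∀ u, u ≼ A * y → p * u ∈ φ.dom) :
    k = φ 1 ∧ b ≼ y ∧ r * p = p * r := by
  have hrl := hr.1.length_mul A
  obtain ⟨b', b'', hbb, h1, h2, hbl⟩ := ble_mul_split hl hbw
  have hbK : InPar cs {p, k} b' := hb.of_ble (by
    rw [hbb]; exact ble_left_mul (by rw [← hbb, hbl]))
  have h3 : b' * r ≼ A := lift_up_left h1 hr.1 (by omega)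
  have h4 := h.insert_isR hp hk hkp hs hb hb1 hr hrK hbb hbl
    (hup _ (ble_mul_mono hl h3 h2))
  have hpb' : p ≼ p * b' := by
    apply ble_left_mul
    rw [hp.length]
    have h5 := hp.mul_length b'
    have h6 := cs.length_mul_le (p * b') b''
    rw [mul_assoc, ← hbb, h.lt] at h6
    omega
  have hrp := h4 p hp hpb'
  have hpk : k = φ 1 := by
    rcases hs with h5 | h5
    · exact absurd (h5 ▸ hrp) hr.2.2.2
    · exact h5.symm
  refine ⟨hpk, ?_, hrp⟩
  rcases eq_or_ne b' 1 with h5 | h5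
  · rw [hbb, h5, one_mul]; exact h2
  · exfalso
    obtain ⟨a, ha, hal⟩ := exists_gen_mul_lt (cs := cs) h5
    have h6 : ℓ (a * b) < ℓ b := by
      have := cs.length_mul_le (a * b') b''
      rw [mul_assoc, ← hbb] at this
      omega
    have h7 : a ≼ b' := ldescent_ble ha (by omega)
    rcases hb.ldescent ha h6 with h8 | h8
    · have := h.lt
      rw [h8] at h6
      omega
    · have h9 : b' ≼ p * b' := ble_gen_mul hp (by
        have h5 := hp.mul_length b'
        have h6 := cs.length_mul_le (p * b') b''
        rw [mul_assoc, ← hbb, h.lt] at h6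
        omega)
      have := h4 a ha (ble_trans h7 h9)
      rw [h8, hpk] at this
      exact hr.2.2.2 this

theorem hasGoodLeft_of_not_wild (hw : Down φ w) (hD : ∀ u ∈ φ.dom, u ≼ w) (hr₀ : IsR φ r)
    (hrw : ¬ Wild φ r) : HasGoodLeft φ w := by
  obtain ⟨A, y, hwA, hA, hy, hl⟩ := exists_rmin cs {a | ¬ (IsR φ a ∧ ¬ Wild φ a)} w
  have hlA : ℓ (A * y) = ℓ A + ℓ y := by rw [← hwA, hl]
  have hAw : A ≼ w := by rw [hwA]; exact ble_left_mul hlA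
  have hdom : ∀ {u}, u ≼ w → u ∈ φ.dom := fun h => φ.ideal hw.1 h
  have hAD := hdom hAw
  have hs := gen_map_one (one_mem hAD)
  have hA1 : A ≠ 1 := by
    intro h
    rw [hwA, h, one_mul] at hD
    exact hy r hr₀.1 (hD r hr₀.2.1) ⟨hr₀, hrw⟩
  have hdes : ∀ a, Gen cs a → ℓ (A * a) < ℓ A → IsR φ a ∧ ¬ Wild φ a := by
    intro a ha hal
    by_contra h
    have := hA a ha h
    omega
  have hL : ∀ l, IsL φ l → ¬ l ≼ A := fun l =>
    not_isL_of_descents hAD fun a ha hal => (hdes a ha hal).1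
  have hdev : ∀ t p k b x, Dev φ t p k b x → ¬ x ≼ A := by
    intro t p k b x D hx
    obtain ⟨a, ha, hal⟩ := exists_mul_gen_lt (cs := cs) hA1
    have h1 := hdes a ha (by omega)
    refine D.mul_notMem h1.1 (fun h => h1.2 (h ▸ ⟨_, _, _, _, D⟩)) (φ.ideal hAD ?_)
    exact lift_up_left hx ha (by omega)
  have hup : Up φ A := by
    rcases up_or_down hAD with h | h
    · exact h
    · exfalso
      have h1 := map_eq_mul_right hAD hL hdev h.up h.cov.1
      rw [φ.invol A hAD] at h1
      have h2 := (hdes (φ 1) hs (by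
        conv_lhs => rw [h1, hs.cancel_right]
        have := h.2
        omega)).1
      exact h2.ne rfl
  obtain ⟨p, hp, hpl⟩ := exists_gen_mul_lt (cs := cs) hA1
  have hpA : ℓ (p * A) < ℓ A := by omega
  obtain ⟨hw', hpw, hlA', -⟩ := exists_left_cancel hp hwA hl hpA
  refine ⟨p, hp, by omega, gen_mul_ne_map hw hwA hl hA hy hup hpA hpw hp, fun u hu => ?_⟩
  by_contra hbad
  obtain ⟨k, b, hk, hkp, hor, hnc, hpb, hbK⟩ := exists_nonComm_dihedral hp hw (by omega) hu hbad
  have hpleA : p ≼ A := ldescent_ble hp hpA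
  have hpL : ¬ IsL φ p := fun h => hL p h hpleA
  have hb1 := hnc.ne_one hp hpL
  have hsK : φ 1 ∈ ({p, k} : Set W) := by
    rcases hor with h | h
    · rw [h]; simp
    · rw [h]; simp
  have hA0 : RMin cs {a | ¬ (IsR φ a ∧ ¬ Wild φ a)} (p * A) := hA.gen_mul hp hpA
  have hA0A : p * A ≼ A := gen_mul_ble hp hpA
  -- letters of the dihedral subgroup are not tame
  have htame : ∀ a, a ∈ ({p, k} : Set W) → IsR φ a → Wild φ a := by
    intro a haK haR
    by_contra hw
    have hpair : ({p, k} : Set W) = {φ 1, a} := by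
      rcases haK with h | h
      · rcases hor with h1 | h1
        · exact absurd (h.trans h1) haR.ne
        · rw [h, h1, Set.pair_comm]
      · rw [Set.mem_singleton_iff] at h
        rcases hor with h1 | h1
        · rw [h, h1]
        · exact absurd (h.trans h1) haR.ne
    exact hnc.not_of_not_wild hp haR hw (hpair ▸ by simp) (hpair ▸ hbK)
  have hA01 : p * A ≠ 1 := by
    intro h
    have h1 : A = p := by rw [← hp.cancel_left A, h, mul_one]
    have h2 := hdes p hp (by rw [h1, hp.mul_self, hp.length, cs.length_one]; omega)
    exact h2.2 (htame p (by simp) h2.1)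
  obtain ⟨r, hr, hrl⟩ := exists_mul_gen_lt (cs := cs) hA01
  have hrR : IsR φ r ∧ ¬ Wild φ r := by
    by_contra h
    have := hA0 r hr h
    omega
  have hrK : r ∉ ({p, k} : Set W) := fun h => hrR.2 (htame r h hrR.1)
  have hbw : b ≼ p * A * y := by
    rw [hw'] at hpb
    have := llift_down_down hpb hp (by rw [hp.cancel_left, hnc.lt]; omega)
    rwa [hp.cancel_left, hp.cancel_left] at this
  have hins : ∀ u, u ≼ p * A * y → p * u ∈ φ.dom := by
    intro u hu
    refine hdom (llift_up_left (ble_trans hu ?_) hp (by omega))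
    conv_rhs => rw [hw']
    refine ble_gen_mul hp ?_
    rw [← hw', hlA']
    omega
  obtain ⟨hks, hby, hrp⟩ := hnc.goodLeft_aux hp hk hkp hsK hbK hb1 hrR.1 hrK (by omega) hlA' hbw hins
  have hpdom : p ∈ φ.dom := hdom (ble_trans hpleA hAw)
  have hbs : b ≠ φ 1 := by
    intro h
    have := hnc.up
    rw [h] at this
    exact this.not_down (up_one (one_mem hAD)).down
  have hpleb : p ≼ b := by
    by_contra h
    rcases inPar_singleton (k := φ 1) (g := b) (fun a ha hab => by
      rcases hbK a ha hab with h1 | h1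
      · exact absurd (h1 ▸ hab) h
      · rw [← hks]; exact h1) with h1 | h1
    · exact hb1 h1
    · exact hbs h1
  -- some letter of the rest does not commute with `p`
  obtain ⟨q, hq, hqA, hqp⟩ : ∃ q, Gen cs q ∧ q ≼ p * A ∧ q * p ≠ p * q := by
    by_contra hcon
    push Not at hcon
    have h1 := comm_of_letters (r := p) (g := p * A) fun a ha hal => (hcon a ha hal).symm
    rw [hp.cancel_left] at h1
    have h2 := hdes p hp (by
      conv_lhs => rw [h1, hp.cancel_right]
      omega)
    exact h2.2 (htame p (by simp) h2.1)
  have hqdom : q ∈ φ.dom := hdom (ble_trans hqA (ble_trans hA0A hAw))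
  have hqins : p * (1 * q * b) ∈ φ.dom := hins _ (by
    rw [one_mul]; exact ble_mul_mono hlA' hqA hby)
  have hqK : q ≠ φ 1 → q ∉ ({p, k} : Set W) := by
    rintro h1 (h2 | h2)
    · exact hqp (by rw [h2])
    · exact h1 (h2.trans hks)
  rcases letter_cases hq hqdom with h1 | h1 | h1 | h1
  · obtain ⟨-, -, h3, -⟩ := hnc.structure hp hk hkp hsK hbK hb1
    have hkb : b = k * (k * b) := (hk.cancel_left b).symm
    have hsA : k * r ≼ p * A := by
      have h4 : q ≼ p * A * r := by
        have := lift_down_right hqA hr (by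
          rw [(comm_of_length hq hr (fun h => hrR.1.ne (h.symm.trans h1))).1, hq.length]; omega)
        exact this
      have h5 := lift_up_up h4 hr (by rw [hr.cancel_right]; omega)
      rw [hr.cancel_right, h1, ← hks] at h5
      exact h5
    have h6 := hnc.insert_isR hp hk hkp hsK hbK hb1 hrR.1 hrK hkb
      (by rw [hk.length]; omega)
      (hins _ (ble_mul_mono hlA' hsA (ble_trans (gen_mul_ble hk (by omega)) hby)))
    have h7 := h6 k hk (ble_right_mul (by rw [(comm_of_length hp hk hkp.symm).1, hp.length, hk.length]))
    rw [hks] at h7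
    exact hrR.1.2.2.2 h7
  · rcases hnc.insert_isC hp hk hkp hsK hbK hb1 hq (hqK h1.2.2.1) (fun h => hqp h.1)
      (one_mul b).symm (by simp) hqins with h2 | h2
    · exact hqp (h2 p hp (by rw [mul_one]; exact ble_refl p))
    · exact hqp (h2 p hp hpleb)
  · have h2 := hnc.insert_isR hp hk hkp hsK hbK hb1 h1 (hqK h1.ne)
      (one_mul b).symm (by simp) hqins
    exact hqp (h2 p hp (by rw [mul_one]; exact ble_refl p))
  · exact hL q h1 (ble_trans hqA hA0A)

end NonWild

section WildCase

local notation "ℓ" => CoxeterSystem.length cs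
local infix:50 " ≼ " => bruhatLE cs

variable {a b b' c d l u v w x x' y z g h r p p' q k k' s t t' A m X Y : W} {J K : Set W} {φ : BSM cs}

theorem rMin_of_inPar_isC (ht : ¬ IsC φ t) (hg : InPar cs {φ 1, t} g) :
    RMin cs {q | IsC φ q} g := by
  intro a ha haC
  rw [hg.length_mul ha (IsC.notMem_pair haC ht)]
  omega

theorem comm_of_inPar_isC (hm : InPar cs {q | IsC φ q} m) : φ 1 * m = m * φ 1 :=
  comm_of_letters (cs := cs) fun a ha ham => ((hm a ha ham).2.2.2).symm

/-- If no letter of type `C` precedes the wild letter without commuting with it, then the mirror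
image has a good left descent. -/
theorem hasGoodLeft_mirror_of_wild (hw : Down φ w)
    (hlet : ∀ a, Gen cs a → a ∈ φ.dom → a = φ 1 ∨ a = t ∨ IsC φ a)
    (hnc : ∀ c, IsC φ c → c * t ≠ t * c → c * t ∉ φ.dom) (hnK : ¬ InPar cs {φ 1, t} w) :
    HasGoodLeft (mirror φ) w⁻¹ := by
  obtain ⟨y, A, hwA, hA, hy, hl⟩ := exists_lmin cs {φ 1, t} w
  have hlA : ℓ (y * A) = ℓ y + ℓ A := by rw [← hwA, hl]
  have hAw : A ≼ w := by rw [hwA]; exact ble_right_mul hlA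
  have hAdom : A ∈ φ.dom := φ.ideal hw.1 hAw
  have hA1 : A ≠ 1 := by
    rintro rfl
    exact hnK (by rwa [hwA, mul_one])
  have hAC : InPar cs {q | IsC φ q} A := by
    obtain ⟨m, Y, hAm, hY, hm, hlm⟩ := exists_lmin cs {q | IsC φ q} A
    have hlm' : ℓ (m * Y) = ℓ m + ℓ Y := by rw [← hAm, hlm]
    by_cases hY1 : Y = 1
    · rwa [hAm, hY1, mul_one]
    exfalso
    obtain ⟨a, ha, hal⟩ := exists_gen_mul_lt (cs := cs) hY1
    have haY : a ≼ Y := ldescent_ble ha (by omega)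
    have hYA : Y ≼ A := by rw [hAm]; exact ble_right_mul hlm'
    have hcomm : a ∈ ({φ 1, t} : Set W) → ¬ a * m = m * a := by
      intro h1 h2
      have h3 := hA a ha h1
      rw [hAm, ← mul_assoc, h2, mul_assoc] at h3
      have := cs.length_mul_le m (a * Y)
      omega
    rcases hlet a ha (φ.ideal hAdom (ble_trans haY hYA)) with h | h | h
    · exact hcomm (Or.inl h) (by rw [h]; exact comm_of_inPar_isC hm)
    · refine hcomm (Or.inr h) (comm_of_letters (cs := cs) fun c hc hcm => ?_)
      by_contra hne
      have hcC : IsC φ c := hm c hc hcm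
      refine hnc c hcC (by rw [← h]; exact Ne.symm hne) (φ.ideal hAdom ?_)
      rw [hAm]
      exact ble_mul_mono hlm' hcm (h ▸ haY)
    · have := hY a ha h
      omega
  have hup : Up φ A := by
    refine (up_or_down hAdom).resolve_right fun h => ?_
    have h1 : IsC φ (φ 1) := hAC _ (gen_map_one (one_mem hAdom)) h.ble
    exact h1.2.2.1 rfl
  obtain ⟨p, hp, hpl⟩ := exists_mul_gen_lt (cs := cs) hA1
  have hpC : IsC φ p := hAC.descent hp (by omega)
  have h2 := cs.length_mul_le y (A * p)
  have h3 : w * p = y * (A * p) := by rw [hwA, mul_assoc]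
  have h4 := hp.length_mul w
  rw [h3] at h4
  have hpw : ℓ (p * w⁻¹) < ℓ w⁻¹ := by
    rw [hp.length_mul_inv, cs.length_inv, h3]
    omega
  refine ⟨p, hp, hpw, ?_, fun u hu => (isC_mirror.2 hpC).goodAt (down_mirror.2 (by rwa [inv_inv])) hpw hu⟩
  intro h5
  rw [mirror_apply, inv_inv, ← hp.inv, ← mul_inv_rev, inv_inj] at h5
  have h6 : A ≼ φ w := hw.ble_map hAw hup
  rw [← h5, h3] at h6
  have := ble_length_le (hA.ble h6 hy (by omega))
  omega

/-- The factorization of the top element in presence of a wild letter `t`. -/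
structure WildFactor (φ : BSM cs) (w t c X m d z : W) : Prop where
  down : Down φ w
  isR : IsR φ t
  letter : ∀ a, Gen cs a → a ∈ φ.dom → a = φ 1 ∨ a = t ∨ IsC φ a
  isC : IsC φ c
  ne : c * t ≠ t * c
  eq : w = X * m * d * z
  hl : ℓ w = ℓ (X * m * d) + ℓ z
  hld : ℓ (X * m * d) = ℓ (X * m) + ℓ d
  hlm : ℓ (X * m) = ℓ X + ℓ m
  mC : InPar cs {q | IsC φ q} m
  mc : ℓ (m * c) + 1 = ℓ m
  rX : RMin cs {q | IsC φ q} X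
  tX : X ≠ 1 → ℓ (X * t) + 1 = ℓ X
  dK : InPar cs {φ 1, t} d
  dt : ℓ (d * t) + 1 = ℓ d
  rA : RMin cs {a | a ≠ t} (X * m * d)
  zJ : InPar cs {a | a ≠ t} z
  rXm : RMin cs {φ 1, t} (X * m)
  desc : ∀ a, Gen cs a → ℓ (X * m * a) < ℓ (X * m) → IsC φ a ∧ a * t ≠ t * a

theorem rMin_mul_of_noncomm (hc : IsC φ c) (ht : IsR φ t) (hct : c * t ≠ t * c) :
    RMin cs {a | a ≠ t} (c * t) := by
  intro a ha hat
  by_contra h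
  obtain ⟨h1, h2, -⟩ := hc.length_mul_mul ht hct
  have hl := ha.length_mul (c * t)
  have hK : InPar cs {c, t} (c * t) := (InPar.gen hc.1 (Or.inl rfl)).mul (InPar.gen ht.1 (Or.inr rfl))
  rcases hK.descent ha (by omega) with h3 | h3
  · rw [h3] at h; omega
  · exact hat h3

theorem exists_wildFactor (hw : Down φ w) (hD : ∀ u ∈ φ.dom, u ≼ w) (ht : IsR φ t)
    (hlet : ∀ a, Gen cs a → a ∈ φ.dom → a = φ 1 ∨ a = t ∨ IsC φ a)
    (hc : IsC φ c) (hct : c * t ≠ t * c) (hmem : c * t ∈ φ.dom) :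
    ∃ c X m d z, WildFactor φ w t c X m d z := by
  obtain ⟨A, z, hwA, hA, hz, hl⟩ := exists_rmin cs {a | a ≠ t} w
  have hlA : ℓ (A * z) = ℓ A + ℓ z := by rw [← hwA, hl]
  have hAw : A ≼ w := by rw [hwA]; exact ble_left_mul hlA
  have hdescA : ∀ a, Gen cs a → ℓ (A * a) < ℓ A → a = t := by
    intro a ha h
    by_contra hne
    have := hA a ha hne
    omega
  have hctA : c * t ≼ A := (rMin_mul_of_noncomm hc ht hct).ble (hwA ▸ hD _ hmem) hz hlA
  obtain ⟨A₁, d, hAd, hA₁, hd, hld⟩ := exists_rmin cs {φ 1, t} A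
  have hld' : ℓ (A₁ * d) = ℓ A₁ + ℓ d := by rw [← hAd, hld]
  have hA₁A : A₁ ≼ A := by rw [hAd]; exact ble_left_mul hld'
  have hA1 : A ≠ 1 := by
    rintro rfl
    have h1 := ble_length_le hctA
    rw [(hc.length_mul_mul ht hct).1, cs.length_one] at h1
    omega
  have hdt : ℓ (d * t) + 1 = ℓ d := by
    obtain ⟨a, ha, hal⟩ := exists_mul_gen_lt (cs := cs) hA1
    obtain rfl := hdescA a ha (by omega)
    have h1 : InPar cs {φ 1, a} (d * a) := hd.mul (InPar.gen ha (Or.inr rfl))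
    have h2 := hA₁.length_mul h1
    rw [← mul_assoc, ← hAd] at h2
    omega
  have hA₁1 : A₁ ≠ 1 := by
    rintro rfl
    rw [hAd, one_mul] at hctA
    exact hc.notMem_pair ht.not_isC (hd c hc.1 (ble_trans (ble_left_mul (by
      rw [(hc.length_mul_mul ht hct).1, hc.1.length, ht.1.length])) hctA))
  have hdesc : ∀ a, Gen cs a → ℓ (A₁ * a) < ℓ A₁ → IsC φ a ∧ a * t ≠ t * a := by
    intro a ha h
    have haA : a ≼ A := ble_trans (descent_ble ha h) hA₁A
    have hnot : a ∉ ({φ 1, t} : Set W) := fun h1 => by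
      have := hA₁ a ha h1
      omega
    have haC : IsC φ a := by
      rcases hlet a ha (φ.ideal hw.1 (ble_trans haA hAw)) with h1 | h1 | h1
      · exact absurd (Or.inl h1) hnot
      · exact absurd (Or.inr h1) hnot
      · exact h1
    refine ⟨haC, fun hcomm => ?_⟩
    have h2 : a * d = d * a := comm_of_letters (cs := cs) fun e he hed => by
      rcases hd e he hed with h3 | h3
      · rw [h3]; exact haC.2.2.2
      · rw [h3]; exact hcomm
    refine hnot (Or.inr (hdescA a ha ?_))
    rw [hAd, mul_assoc, ← h2, ← mul_assoc]
    have := cs.length_mul_le (A₁ * a) d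
    omega
  obtain ⟨X, m, hXm, hX, hm, hlm⟩ := exists_rmin cs {q | IsC φ q} A₁
  have hlm' : ℓ (X * m) = ℓ X + ℓ m := by rw [← hXm, hlm]
  have hXA : X ≼ A₁ := by rw [hXm]; exact ble_left_mul hlm'
  have htX : X ≠ 1 → ℓ (X * t) + 1 = ℓ X := by
    intro h
    obtain ⟨a, ha, hal⟩ := exists_mul_gen_lt (cs := cs) h
    have haX : a ≼ X := descent_ble ha (by omega)
    rcases hlet a ha (φ.ideal hw.1 (ble_trans haX (ble_trans hXA (ble_trans hA₁A hAw)))) with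
      h1 | h1 | h1
    · exfalso
      have h2 := hA₁ a ha (Or.inl h1)
      rw [hXm, mul_assoc, h1, ← comm_of_inPar_isC hm, ← h1, ← mul_assoc] at h2
      have := cs.length_mul_le (X * a) m
      omega
    · rw [← h1]; exact hal
    · have := hX a ha h1
      omega
  have hm1 : m ≠ 1 := by
    rintro rfl
    rw [mul_one] at hXm
    have h1 := htX (hXm ▸ hA₁1)
    exact ht.not_isC (hdesc t ht.1 (by rw [hXm]; omega)).1
  obtain ⟨c', hc', hcl⟩ := exists_mul_gen_lt (cs := cs) hm1
  have hc'd := hdesc c' hc' (by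
    rw [hXm, mul_assoc]
    have := cs.length_mul_le X (m * c')
    omega)
  refine ⟨c', X, m, d, z, hw, ht, hlet, hc'd.1, hc'd.2, ?_, ?_, ?_, hlm', hm, hcl, hX, htX, hd, hdt,
    ?_, hz, ?_, ?_⟩
  · rw [← hXm, ← hAd, hwA]
  · rw [← hXm, ← hAd, hl]
  · rw [← hXm, hld']
  · rw [← hXm, ← hAd]; exact hA
  · rw [← hXm]; exact hA₁
  · rw [← hXm]; exact hdesc

end WildCase

section WildFactorization

local notation "ℓ" => CoxeterSystem.length cs
local infix:50 " ≼ " => bruhatLE cs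

variable {a b b' c d l u v w x x' x'' y z g h r p p' q k k' s t t' A m X Y : W} {J K : Set W} {φ : BSM cs}

theorem WildFactor.ble_top (F : WildFactor φ w t c X m d z) : X * m * d ≼ w := by
  rw [F.eq]
  exact ble_left_mul (by rw [← F.eq, F.hl])

theorem WildFactor.mem (F : WildFactor φ w t c X m d z) (h : u ≼ X * m * d) : u ∈ φ.dom :=
  φ.ideal F.down.1 (ble_trans h F.ble_top)

theorem WildFactor.not_isC (F : WildFactor φ w t c X m d z) : ¬ IsC φ t := F.isR.not_isC

theorem WildFactor.c_ble (F : WildFactor φ w t c X m d z) : c ≼ m :=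
  descent_ble F.isC.1 (by have := F.mc; omega)

theorem WildFactor.t_ble (F : WildFactor φ w t c X m d z) : t ≼ d :=
  descent_ble F.isR.1 (by have := F.dt; omega)

theorem WildFactor.isGen (F : WildFactor φ w t c X m d z) : Gen cs (φ 1) :=
  gen_map_one (one_mem F.down.1)

theorem WildFactor.mc_descent (F : WildFactor φ w t c X m d z) :
    ℓ (X * m * c) + 1 = ℓ (X * m) := by
  have h1 := cs.length_mul_le X (m * c)
  have h2 := F.isC.1.length_mul (X * m)
  have := F.mc
  have := F.hlm
  rw [← mul_assoc] at h1
  omega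

theorem WildFactor.st_ble (F : WildFactor φ w t c X m d z) (hd : d ≠ t) : φ 1 * t ≼ d := by
  have h1 : d * t ≠ 1 := by
    intro h
    refine hd ?_
    rw [← F.isR.1.inv]
    exact eq_inv_of_mul_eq_one_left h
  obtain ⟨a, ha, hal⟩ := exists_mul_gen_lt (cs := cs) h1
  have hdt := F.dt
  have hK : InPar cs {φ 1, t} (d * t) := F.dK.mul (InPar.gen F.isR.1 (Or.inr rfl))
  have h2 : a = φ 1 := by
    rcases hK.descent ha (by omega) with h2 | h2
    · exact h2
    · rw [h2, F.isR.1.cancel_right] at hal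
      omega
  have h3 : φ 1 ≼ d := by
    rw [← h2]
    exact ble_trans (descent_ble ha (by omega)) (mul_gen_ble F.isR.1 (by omega))
  exact lift_up_left h3 F.isR.1 (by omega)

theorem WildFactor.ble_X (F : WildFactor φ w t c X m d z) (hg : InPar cs {φ 1, t} g)
    (h : g ≼ X * m) : g ≼ X :=
  (rMin_of_inPar_isC F.not_isC hg).ble h F.mC F.hlm

theorem WildFactor.mul_t_ble (F : WildFactor φ w t c X m d z) (hg : InPar cs {φ 1, t} g)
    (h : g ≼ X * m) (h1 : g ≠ 1) : g * t ≼ X := by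
  have h2 := F.ble_X hg h
  refine lift_up_left h2 F.isR.1 ?_
  have := F.tX (by
    rintro rfl
    refine h1 (ble_eq h2 (by rw [cs.length_one]; omega)))
  omega

theorem WildFactor.length_mul (F : WildFactor φ w t c X m d z) (hg : InPar cs {φ 1, t} g) :
    ℓ (X * m * g) = ℓ (X * m) + ℓ g := F.rXm.length_mul hg

/-- Dihedral elements below the top element split along the factorization. -/
theorem WildFactor.split (F : WildFactor φ w t c X m d z) (hg : InPar cs {φ 1, t} g)
    (h : g ≼ X * m * d) : ∃ u v, g = u * v ∧ u ≼ X ∧ v ≼ d ∧ ℓ g = ℓ u + ℓ v := by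
  obtain ⟨u, v, h1, h2, h3, h4⟩ := ble_mul_split F.hld h
  refine ⟨u, v, h1, F.ble_X ?_ h2, h3, h4⟩
  exact hg.of_ble (by rw [h1]; exact ble_left_mul (by rw [← h1, h4]))

theorem Dev.pair_cases (D : Dev φ t p k b x) :
    (p = φ 1 ∧ k = t) ∨ (p = t ∧ k = φ 1) := by
  have h1 : p ∈ ({φ 1, t} : Set W) := D.pair ▸ Or.inl rfl
  have h2 : k ∈ ({φ 1, t} : Set W) := D.pair ▸ Or.inr rfl
  have h3 := D.hkp
  rcases h1 with h1 | h1 <;> rcases h2 with h2 | h2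
  · exact absurd (h2.trans h1.symm) h3
  · exact Or.inl ⟨h1, h2⟩
  · exact Or.inr ⟨h1, h2⟩
  · exact absurd (h2.trans h1.symm) h3

theorem WildFactor.noncomm (F : WildFactor φ w t c X m d z) (D : Dev φ t p k b x) :
    ¬ (c * p = p * c ∧ c * k = k * c) := by
  rintro ⟨h1, h2⟩
  rcases D.pair_cases with ⟨h3, h4⟩ | ⟨h3, h4⟩
  · exact F.ne (h4 ▸ h2)
  · exact F.ne (h3 ▸ h1)

theorem WildFactor.dev_ble (F : WildFactor φ w t c X m d z) (D : Dev φ t p k b x) (h : x ≼ w) :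
    x ≼ X * m * d :=
  (D.rMin (J := {a | a ≠ t}) (by simp)).ble (F.eq ▸ h) F.zJ (by rw [← F.eq, F.hl])

theorem WildFactor.not_dev_ble (F : WildFactor φ w t c X m d z) (D : Dev φ t p k b x) :
    ¬ x ≼ X * m := by
  intro hx
  have hxX : x ≼ X := F.ble_X D.xK hx
  have hx1 : x ≠ 1 := by
    rintro rfl
    have := D.two_le
    rw [cs.length_one] at this
    omega
  have htX := F.tX (by
    rintro rfl
    refine hx1 (ble_eq hxX (by rw [cs.length_one]; omega)))
  by_cases hdt : d = t
  · have hd := F.hld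
    have hrA := F.rA
    have hlm := F.hlm
    have htl := F.isR.1.length
    rw [hdt, htl] at hd
    rw [hdt] at hrA
    set T := t * m * t with hT
    have e1 : X * m * t = X * t * T := by simp [hT, mul_assoc, F.isR.1.cancel_left]
    have e2 : x * m * t = x * t * T := by simp [hT, mul_assoc, F.isR.1.cancel_left]
    have e3 : x * m = x * t * (t * m) := by simp [mul_assoc, F.isR.1.cancel_left]
    have h1 := cs.length_mul_le (X * t) T
    have h2 := F.isR.1.mul_length m
    have h3 := F.isR.1.length_mul (t * m)
    rw [← hT] at h3
    rw [e1] at hd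
    have hTl : ℓ T = ℓ m + 2 := by omega
    have hTr : RMin cs {a | a ≠ t} T := by
      rw [e1] at hrA
      exact hrA.right_factor (by omega)
    have hJ : InPar cs (insert t {q | IsC φ q}) T :=
      ((InPar.gen F.isR.1 (Or.inl rfl)).mul (F.mC.mono (Set.subset_insert _ _))).mul
        (InPar.gen F.isR.1 (Or.inl rfl))
    have hJ' : InPar cs (insert t {q | IsC φ q}) (t * m) :=
      (InPar.gen F.isR.1 (Or.inl rfl)).mul (F.mC.mono (Set.subset_insert _ _))
    have hxt := D.xt
    have hxr : RMin cs (insert t {q | IsC φ q}) (x * t) := by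
      have hK : InPar cs {φ 1, t} (x * t) := D.xK.mul (InPar.gen F.isR.1 (Or.inr rfl))
      intro a ha haJ
      by_contra h
      have hal := ha.length_mul (x * t)
      rcases haJ with h4 | h4
      · rw [h4, F.isR.1.cancel_right] at h
        omega
      · exact IsC.notMem_pair h4 F.not_isC (hK.descent ha (by omega))
    refine D.isR_descent_false F.mC F.isC F.ne F.c_ble (F.mem ?_) ?_ ?_
    · rw [hdt]
      exact ble_mul_mono (by rw [← hdt, F.hld, hdt]) (ble_mul_mono F.hlm hxX (ble_refl m))
        (ble_refl t)
    · rw [e2, e3, hxr.length_mul hJ, hxr.length_mul hJ']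
      omega
    · intro a ha
      have hat : a ≠ t := fun h => F.not_isC (h ▸ ha)
      have haJ : InPar cs (insert t {q | IsC φ q}) (T * a) :=
        hJ.mul (InPar.gen ha.1 (Or.inr ha))
      rw [e2, mul_assoc (x * t) T a, hxr.length_mul hJ, hxr.length_mul haJ]
      have := hTr a ha.1 hat
      omega
  · refine D.xsct_notMem F.isC F.ne (F.mem ?_)
    have : x * φ 1 * c * t = x * c * (φ 1 * t) := by
      have := F.isC.2.2.2
      simp only [mul_assoc]
      rw [← mul_assoc c (φ.toFun 1) t, this]
      simp only [mul_assoc]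
    rw [this]
    exact ble_mul_mono F.hld (ble_mul_mono F.hlm hxX F.c_ble) (F.st_ble hdt)

theorem WildFactor.mul_t_mem (F : WildFactor φ w t c X m d z) : X * m * t ≼ X * m * d :=
  ble_mul_mono F.hld (ble_refl _) F.t_ble

theorem WildFactor.not_dev_ble_mul (F : WildFactor φ w t c X m d z) (D : Dev φ t p k b x) :
    ¬ x ≼ X * m * t := by
  intro hx
  have hl := F.length_mul (InPar.gen F.isR.1 (Or.inr rfl))
  rw [F.isR.1.length] at hl
  have hxt := D.xt
  have h1 : x * t ≼ X * m := by
    have := lift_down_down hx F.isR.1 (by omega)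
    rwa [F.isR.1.cancel_right] at this
  have h2 : x * t * c ≼ X * m := lift_up_left h1 F.isC.1 (by have := F.mc_descent; omega)
  have h3 : p * (b * t * c * t) ∈ φ.dom := by
    have : p * (b * t * c * t) = x * t * c * t := by rw [D.eq]; simp [mul_assoc]
    rw [this]
    exact F.mem (ble_trans (ble_mul_mono (by rw [hl, F.isR.1.length]) h2 (ble_refl t)) F.mul_t_mem)
  have hcK : c ∉ ({p, k} : Set W) := by
    rw [D.pair]
    exact F.isC.notMem_pair F.not_isC
  have hbt := D.bt
  rcases D.nc.insert_isC D.hp D.hk D.hkp (D.pair ▸ Or.inl rfl) D.bK D.b1 F.isC.1 hcK (F.noncomm D)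
    (F.isR.1.cancel_right b).symm (by rw [F.isR.1.length]; omega) h3 with h4 | h4
  · have hK : InPar cs {φ 1} (x * t) := by
      have hK : InPar cs {φ 1, t} (x * t) := D.xK.mul (InPar.gen F.isR.1 (Or.inr rfl))
      intro a ha hax
      rcases hK a ha hax with h5 | h5
      · exact h5
      · refine absurd (h4 t F.isR.1 ?_) F.ne
        rw [← mul_assoc, ← D.eq]
        exact h5 ▸ hax
    have hx2 := D.two_le
    rcases inPar_singleton hK with h5 | h5
    · rw [h5, cs.length_one] at hxt
      omega
    · have h6 := F.mul_t_ble (InPar.gen F.isGen (Or.inl rfl)) (h5 ▸ h1) F.isGen.ne_one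
      rw [← h5, F.isR.1.cancel_right] at h6
      exact F.not_dev_ble D (ble_trans h6 (ble_left_mul F.hlm))
  · exact F.ne (h4 t F.isR.1 (ble_refl t))

theorem WildFactor.not_isL (F : WildFactor φ w t c X m d z) : ¬ IsL φ l := by
  intro h
  rcases F.letter l h.1 h.2.1 with h1 | h1 | h1
  · exact h.ne h1
  · have := h.2.2.1
    rw [h1, F.isR.2.2.1] at this
    exact F.isR.2.2.2 this
  · exact h.not_isC h1

theorem WildFactor.isR_eq (F : WildFactor φ w t c X m d z) (h : IsR φ r) : r = t := by
  rcases F.letter r h.1 h.2.1 with h1 | h1 | h1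
  · exact absurd h1 h.ne
  · exact h1
  · exact absurd h1 h.not_isC

theorem WildFactor.map_eq (F : WildFactor φ w t c X m d z) (hu : Up φ u) (h : u ≼ X * m * t) :
    φ u = u * φ 1 := by
  refine map_eq_mul_right (F.mem F.mul_t_mem) (fun l hl => absurd hl F.not_isL) ?_ hu h
  intro t' p k b x D
  obtain rfl := F.isR_eq D.isR
  exact F.not_dev_ble_mul D

theorem WildFactor.s_up (F : WildFactor φ w t c X m d z) : ℓ (X * m * φ 1) = ℓ (X * m) + 1 := by
  rw [F.length_mul (InPar.gen F.isGen (Or.inl rfl)), F.isGen.length]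

theorem WildFactor.t_up (F : WildFactor φ w t c X m d z) : ℓ (X * m * t) = ℓ (X * m) + 1 := by
  rw [F.length_mul (InPar.gen F.isR.1 (Or.inr rfl)), F.isR.1.length]

theorem WildFactor.up_mul_t (F : WildFactor φ w t c X m d z) : Up φ (X * m * t) := by
  refine (up_or_down (F.mem F.mul_t_mem)).resolve_right fun h => ?_
  have h2 := h.up
  have h3 := F.map_eq h2 (by
    have := h2.cov.1
    rwa [φ.invol _ h.1] at this)
  rw [φ.invol _ h.1] at h3
  have hK : InPar cs {φ 1, t} (t * φ 1) :=
    (InPar.gen F.isR.1 (Or.inr rfl)).mul (InPar.gen F.isGen (Or.inl rfl))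
  have h4 := F.length_mul hK
  rw [← mul_assoc, (comm_of_length F.isR.1 F.isGen F.isR.ne).1, h3, F.isGen.cancel_right] at h4
  have h5 := F.t_up
  have := h.2
  omega

end WildFactorization

section WildDescent

local notation "ℓ" => CoxeterSystem.length cs
local infix:50 " ≼ " => bruhatLE cs

variable {a b b' c d l u v w x x' x'' y z g h r p p' q k k' s t t' A m X Y : W} {J K : Set W} {φ : BSM cs}

theorem two_descents (hr : Gen cs r) (hj : Gen cs k) (hrj : r ≠ k) (h1 : ℓ (u * r) < ℓ u)
    (h2 : ℓ (u * k) < ℓ u) :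
    ℓ (u * k * r) + 2 = ℓ u ∧ (r * k ≠ k * r → ℓ (u * k * r * k) + 3 = ℓ u) := by
  have e1 : ∀ g a, Gen cs a → ℓ (a * g⁻¹) = ℓ (g * a) := fun g a ha => ha.length_mul_inv g
  have e2 : k * u⁻¹ = (u * k)⁻¹ := by rw [mul_inv_rev, hj.inv]
  have e3 : r * (u * k)⁻¹ = (u * k * r)⁻¹ := by rw [mul_inv_rev (u * k), hr.inv]
  have h3 := two_ldescents (u := u⁻¹) hr hj hrj (by rw [e1 _ _ hr, cs.length_inv]; exact h1)
    (by rw [e1 _ _ hj, cs.length_inv]; exact h2)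
  rw [e2, e3, e1 _ _ hj, cs.length_inv, cs.length_inv] at h3
  exact h3

theorem WildFactor.rMin_mul_st (F : WildFactor φ w t c X m d z) (D : Dev φ t p k b x)
    (hd : d ≠ t) : RMin cs {a | a ≠ t} (X * m * φ 1 * t) := by
  have hs := F.isGen
  have ht := F.isR.1
  have hst : φ 1 * t ≠ t * φ 1 := fun h => F.isR.2.2.2 h.symm
  have hts : φ 1 ≠ t := fun h => F.isR.ne h.symm
  have hsK : InPar cs {φ 1, t} (φ 1) := InPar.gen hs (Or.inl rfl)
  have htK : InPar cs {φ 1, t} t := InPar.gen ht (Or.inr rfl)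
  have hcl := comm_of_length hs ht hts
  have hl2 : ℓ (X * m * φ 1 * t) = ℓ (X * m) + 2 := by
    rw [mul_assoc (X * m), F.length_mul (hsK.mul htK), hcl.1]
  have hl1 := F.s_up
  have hle : X * m * φ 1 * t ≼ X * m * d := by
    rw [mul_assoc (X * m)]
    exact ble_mul_mono F.hld (ble_refl _) (F.st_ble hd)
  intro q hq hqt
  by_contra hlq
  have hlq' := hq.length_mul (X * m * φ 1 * t)
  have hqd : ℓ (X * m * φ 1 * t * q) < ℓ (X * m * φ 1 * t) := by omega
  rcases F.letter q hq (F.mem (ble_trans (descent_ble hq hqd) hle)) with h | h | hqC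
  · rw [h, mul_assoc (X * m), mul_assoc (X * m), F.length_mul ((hsK.mul htK).mul hsK),
      ← mul_assoc (X * m), hl2, hcl.2.resolve_left hst] at hqd
    omega
  · exact hqt h
  · have hqs := hqC.2.2.2
    have htd : ℓ (X * m * φ 1 * t * t) < ℓ (X * m * φ 1 * t) := by
      rw [ht.cancel_right]; omega
    obtain ⟨h1, h2⟩ := two_descents hq ht hqt hqd htd
    rw [ht.cancel_right] at h1 h2
    have hs2 : ℓ (X * m * φ 1 * φ 1) < ℓ (X * m * φ 1) := by
      rw [hs.cancel_right]; omega
    obtain ⟨h3, -⟩ := two_descents hq hs hqC.2.2.1 (by omega) hs2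
    rw [hs.cancel_right] at h3
    obtain ⟨-, hqc⟩ := F.desc q hq (by omega)
    have h4 := h2 hqc
    have e1 : X * m * q * φ 1 = X * m * φ 1 * q := by
      rw [mul_assoc, hqs, ← mul_assoc]
    have hx : x ≼ X * m * q * φ 1 := by
      refine exists_dihedral_right hts hs ht ?_ ?_ D.xK
      · rw [hs.cancel_right, e1]; omega
      · rw [e1]; omega
    have hx2 : x ≼ X * m * q := by
      refine (RMin.ble (J := {φ 1}) ?_ hx (InPar.gen hs rfl) (by rw [e1, hs.length]; omega))
      intro a ha has
      rw [Set.mem_singleton_iff.1 has, D.xs]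
      omega
    exact F.not_dev_ble D (ble_trans hx2 (mul_gen_ble hq (by omega)))

theorem WildFactor.up_mul_st (F : WildFactor φ w t c X m d z) (hd : d ≠ t) :
    Up φ (X * m * φ 1 * t) := by
  have hs := F.isGen
  have ht := F.isR.1
  have hsK : InPar cs {φ 1, t} (φ 1) := InPar.gen hs (Or.inl rfl)
  have htK : InPar cs {φ 1, t} t := InPar.gen ht (Or.inr rfl)
  have hl2 : ℓ (X * m * (φ 1 * t)) = ℓ (X * m) + ℓ (φ 1 * t) := F.length_mul (hsK.mul htK)
  have h12 := (comm_of_length hs ht (fun h => F.isR.ne h.symm)).1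
  have hle : X * m * φ 1 * t ≼ X * m * d := by
    rw [mul_assoc (X * m)]
    exact ble_mul_mono F.hld (ble_refl _) (F.st_ble hd)
  refine (up_or_down (F.mem hle)).resolve_right fun h => ?_
  have hcov : Cov cs (X * m * t) (X * m * φ 1 * t) := by
    refine ⟨?_, ?_⟩
    · rw [mul_assoc (X * m)]
      exact ble_mul_mono hl2 (ble_refl _) (ble_right_mul (by rw [h12, hs.length, ht.length]))
    · rw [mul_assoc (X * m) (φ.toFun 1), hl2, h12, F.t_up]
  have h3 : φ (X * m * t) = X * m * φ 1 * t := by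
    rcases h.cov_cases hcov with h1 | h1
    · rw [h1, φ.invol _ h.1]
    · exact absurd h1.1 F.up_mul_t.not_down
  rw [F.map_eq F.up_mul_t (ble_refl _), mul_assoc (X * m), mul_assoc (X * m), mul_right_inj] at h3
  exact F.isR.2.2.2 h3

theorem WildFactor.gen_mul_ne (F : WildFactor φ w t c X m d z) (D : Dev φ t p' k b x)
    (hp : Gen cs p) (hpl : ℓ (p * (X * m)) < ℓ (X * m)) :
    ℓ (p * w) < ℓ w ∧ p * w ≠ φ w := by
  have hpA : ℓ (p * (X * m * d)) < ℓ (X * m * d) := by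
    rw [F.hld, ← mul_assoc]
    have := cs.length_mul_le (p * (X * m)) d
    omega
  obtain ⟨-, h1, h2, h3⟩ := exists_left_cancel hp F.eq F.hl hpA
  refine ⟨by omega, ?_⟩
  by_cases hd : d = t
  · exact gen_mul_ne_map F.down F.eq F.hl F.rA F.zJ (hd ▸ F.up_mul_t) hpA h1 hp
  · intro h
    have hst := F.st_ble hd
    have hle : X * m * φ 1 * t ≼ X * m * d := by
      rw [mul_assoc (X * m)]
      exact ble_mul_mono F.hld (ble_refl _) hst
    have h4 : X * m * φ 1 * t ≼ φ w :=
      F.down.ble_map (ble_trans hle F.ble_top) (F.up_mul_st hd)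
    rw [← h, F.eq, ← mul_assoc] at h4
    have h5 := (F.rMin_mul_st D hd).ble h4 F.zJ h2
    have h6 : X * m ≼ p * (X * m) * d := by
      rw [← mul_assoc] at h5
      refine ble_trans ?_ h5
      rw [mul_assoc (X * m) (φ.toFun 1)]
      exact ble_left_mul (F.length_mul ((InPar.gen F.isGen (Or.inl rfl)).mul
        (InPar.gen F.isR.1 (Or.inr rfl))))
    have h7 := F.rXm.ble h6 F.dK (by
      have := cs.length_mul_le (p * (X * m)) d
      have := F.hld
      have := hp.mul_length (X * m)
      rw [← mul_assoc] at h3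
      omega)
    have := ble_length_le h7
    omega

/-- A deviation does not split along the factorization with the wild letter on both sides. -/
theorem WildFactor.split_false (F : WildFactor φ w t c X m d z) (D : Dev φ t p k b x)
    (h : x = u * v) (hl : ℓ x = ℓ u + ℓ v) (hu : u ≼ X) (hv : v ≼ d) (htu : t ≼ u)
    (hv1 : v ≠ 1) : False := by
  have hu1 : u ≠ 1 := by
    rintro rfl
    have := ble_length_le htu
    rw [F.isR.1.length, cs.length_one] at this
    omega
  obtain ⟨a, ha, hal⟩ := exists_gen_mul_lt (cs := cs) hu1
  have hxlt : ℓ (a * x) < ℓ x := by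
    rw [h, ← mul_assoc, ← h]
    have := cs.length_mul_le (a * u) v
    omega
  have hap : a = p := by
    have hK : InPar cs {p, k} x := by rw [D.pair]; exact D.xK
    rcases hK.ldescent ha hxlt with h1 | h1
    · exact h1
    · have := D.lk
      rw [h1] at hxlt
      omega
  rw [hap] at hal
  have hb : b = p * u * v := by
    rw [mul_assoc, ← h, D.eq, D.hp.cancel_left]
  have hmem : p * (p * u * c * v) ∈ φ.dom := by
    have : p * (p * u * c * v) = u * c * v := by
      rw [mul_assoc p u, mul_assoc p (u * c), D.hp.cancel_left]
    rw [this]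
    exact F.mem (ble_mul_mono F.hld (ble_mul_mono F.hlm hu F.c_ble) hv)
  have hlb := D.lb
  rcases D.nc.insert_isC D.hp D.hk D.hkp (D.pair ▸ Or.inl rfl) D.bK D.b1 F.isC.1
    (by rw [D.pair]; exact F.isC.notMem_pair F.not_isC) (F.noncomm D) hb (by omega) hmem
    with h1 | h1
  · exact F.ne (h1 t F.isR.1 (by rwa [D.hp.cancel_left]))
  · obtain ⟨e, he, hel⟩ := exists_mul_gen_lt (cs := cs) hv1
    have het : e = t := by
      refine D.descent he ?_
      rw [h, mul_assoc, ← h]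
      have := cs.length_mul_le u (v * e)
      omega
    exact F.ne (h1 t F.isR.1 (het ▸ descent_ble he (by omega)))

theorem WildFactor.dev_shape (F : WildFactor φ w t c X m d z) (D : Dev φ t p k b x)
    (hx : x ≼ w) (hX : X ≠ 1) : ¬ φ 1 ≼ X * m := by
  intro hsX
  obtain ⟨u, v, h, hu, hv, hl⟩ := F.split D.xK (F.dev_ble D hx)
  have hv1 : v ≠ 1 := by
    rintro rfl
    rw [mul_one] at h
    exact F.not_dev_ble D (ble_trans (h ▸ hu) (ble_left_mul F.hlm))
  have htX := F.tX hX
  have htX' : t ≼ X := descent_ble F.isR.1 (by omega)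
  by_cases htu : t ≼ u
  · exact F.split_false D h hl hu hv htu hv1
  have huK : InPar cs {φ 1, t} u := D.xK.of_ble (by rw [h]; exact ble_left_mul (by rw [← h, hl]))
  have hus : u = 1 ∨ u = φ 1 := by
    refine inPar_singleton (cs := cs) fun a ha hau => ?_
    rcases huK a ha hau with h1 | h1
    · exact h1
    · exact absurd (h1 ▸ hau) htu
  have hbx : b ≼ x := by
    have := D.lb
    rw [D.eq]
    exact ble_gen_mul D.hp (by rw [← D.eq]; omega)
  have hlb := D.lb
  rcases D.pair_cases with ⟨hp, hk⟩ | ⟨hp, hk⟩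
  · have hbd : b ≼ d := by
      rcases hus with h1 | h1
      · rw [h1, one_mul] at h
        exact ble_trans hbx (h ▸ hv)
      · have : b = v := by
          have h2 := D.eq
          rw [h, h1, hp, mul_right_inj] at h2
          exact h2.symm
        rw [this]; exact hv
    obtain ⟨a, ha, hal⟩ := exists_gen_mul_lt (cs := cs) D.b1
    have hat : a = t := by
      rcases D.bK.ldescent ha (by omega) with h1 | h1
      · rw [h1, ← D.eq] at hal
        omega
      · exact h1.trans hk
    rw [hat] at hal
    have hst := (comm_of_length F.isGen F.isR.1 (fun h => F.isR.ne h.symm)).1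
    have hsT : φ 1 * t ≼ X := F.mul_t_ble (InPar.gen F.isGen (Or.inl rfl)) hsX F.isGen.ne_one
    have hxe : x = φ 1 * t * (t * b) := by
      rw [D.eq, hp, mul_assoc, F.isR.1.cancel_left]
    refine F.split_false D hxe (by omega) hsT
      (ble_trans (gen_mul_ble F.isR.1 (by omega)) hbd) ?_ ?_
    · exact ble_right_mul (by rw [hst, F.isGen.length, F.isR.1.length])
    · intro h1
      rw [h1, mul_one] at hxe
      exact F.not_dev_ble D (ble_trans (hxe ▸ hsT) (ble_left_mul F.hlm))
  · have hu1 : u = 1 := by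
      refine hus.resolve_right fun h1 => ?_
      have h2 := D.lk
      have h3 := cs.length_mul_le (k * u) v
      rw [mul_assoc, ← h, hk, h1, F.isGen.mul_self, cs.length_one] at h3
      rw [h1, F.isGen.length] at hl
      rw [hk] at h2
      omega
    rw [hu1, one_mul] at h
    refine F.split_false D (hp ▸ D.eq) (by rw [F.isR.1.length]; omega) htX'
      (ble_trans hbx (h ▸ hv)) (ble_refl t) D.b1

theorem WildFactor.goodAt (F : WildFactor φ w t c X m d z) (D : Dev φ t p' k' b' x)
    (hx : x ≼ w) (hp : Gen cs p) (hpl : ℓ (p * (X * m)) < ℓ (X * m)) (hu : u ≼ w) :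
    GoodAt φ p u := by
  have hpX : p ≼ X * m := ldescent_ble hp hpl
  have hXA : X * m ≼ X * m * d := ble_left_mul F.hld
  have hpw := (F.gen_mul_ne D hp hpl).1
  have hX1 : ¬ IsC φ p → X ≠ 1 := by
    rintro hpC rfl
    rw [one_mul] at hpX
    exact hpC (F.mC p hp hpX)
  rcases F.letter p hp (F.mem (ble_trans hpX hXA)) with h | h | h
  · refine absurd (h ▸ hpX) (F.dev_shape D hx (hX1 ?_))
    exact fun hC => hC.2.2.1 h
  · have hX := hX1 (h ▸ F.not_isC)
    have hsX := F.dev_shape D hx hX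
    subst h
    by_contra hbad
    obtain ⟨k, b, hk, hkp, hpk, hnc, hbw, hbK⟩ := exists_nonComm_dihedral hp F.down hpw hu hbad
    have hks : k = φ 1 := hpk.resolve_left F.isR.ne
    have hb1 := hnc.ne_one hp F.not_isL
    have hsK : φ 1 ∈ ({p, k} : Set W) := Or.inr hks.symm
    obtain ⟨-, -, h3, -⟩ := hnc.structure hp hk hkp hsK hbK hb1
    have hlt := hnc.lt
    have hlA : ℓ (X * m * (d * z)) = ℓ (X * m) + ℓ (d * z) := by
      have h4 := F.hl
      have h5 := F.hld
      have h6 := cs.length_mul_le (X * m) (d * z)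
      have h7 := cs.length_mul_le d z
      rw [F.eq, mul_assoc (X * m)] at h4
      omega
    have hwe : w = X * m * (d * z) := by rw [F.eq, mul_assoc (X * m)]
    have hbz : b ≼ d * z := by
      have hble : b ≼ X * m * (d * z) := by
        rw [← hwe]
        exact ble_trans (ble_gen_mul hp (by omega)) hbw
      obtain ⟨u₁, u₂, h4, h5, h6, h7⟩ := ble_mul_split hlA hble
      by_cases h8 : u₁ = 1
      · rwa [h4, h8, one_mul]
      exfalso
      obtain ⟨a, ha, hal⟩ := exists_gen_mul_lt (cs := cs) h8
      have hab : ℓ (a * b) < ℓ b := by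
        have := cs.length_mul_le (a * u₁) u₂
        rw [mul_assoc, ← h4] at this
        omega
      rcases hbK.ldescent ha hab with h9 | h9
      · rw [h9] at hab
        omega
      · refine hsX (ble_trans ?_ h5)
        rw [← hks, ← h9]
        exact ldescent_ble ha (by omega)
    have hpX' : p ≼ X := F.ble_X (InPar.gen hp (Or.inr rfl)) hpX
    have hmem : p * (1 * c * b) ∈ φ.dom := by
      rw [one_mul, ← mul_assoc]
      refine φ.ideal F.down.1 ?_
      rw [hwe]
      exact ble_mul_mono hlA (ble_mul_mono F.hlm hpX' F.c_ble) hbz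
    have hcK : c ∉ ({p, k} : Set W) := by
      rintro (h4 | h4)
      · exact F.not_isC (h4 ▸ F.isC)
      · exact F.isC.2.2.1 (h4.trans hks)
    rcases hnc.insert_isC hp hk hkp hsK hbK hb1 F.isC.1 hcK (fun h => F.ne h.1)
      (one_mul b).symm (by simp) hmem with h4 | h4
    · exact F.ne (h4 p hp (by rw [mul_one]; exact ble_refl p))
    · refine F.ne (h4 p hp ?_)
      by_contra hpb
      have : InPar cs {k} b := by
        intro a ha hab
        rcases hbK a ha hab with h5 | h5
        · exact absurd (h5 ▸ hab) hpb
        · exact h5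
      rcases inPar_singleton this with h5 | h5
      · exact hb1 h5
      · have h6 := hnc.up
        rw [h5, hks] at h6
        exact (up_one (one_mem F.down.1)).down |> h6.not_down
  · exact h.goodAt F.down hpw hu

theorem WildFactor.hasGoodLeft (F : WildFactor φ w t c X m d z) (D : Dev φ t p' k' b' x)
    (hx : x ≼ w) : HasGoodLeft φ w := by
  have h1 : X * m ≠ 1 := by
    intro h
    have := F.mc_descent
    rw [h, cs.length_one] at this
    omega
  obtain ⟨p, hp, hpl⟩ := exists_gen_mul_lt (cs := cs) h1
  have hpl' : ℓ (p * (X * m)) < ℓ (X * m) := by omega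
  obtain ⟨h2, h3⟩ := F.gen_mul_ne D hp hpl'
  exact ⟨p, hp, h2, h3, fun u hu => F.goodAt D hx hp hpl' hu⟩

end WildDescent

section Main

local notation "ℓ" => CoxeterSystem.length cs
local infix:50 " ≼ " => bruhatLE cs

variable {l r t u w : W} {φ : BSM cs}

theorem tractable_of_wild (hw : Down φ w) (hD : ∀ u ∈ φ.dom, u ≼ w) (h : Wild φ t)
    (hR : ∀ r, IsR φ r → Wild φ r) (hL : ∀ l, IsL φ l → Wild (mirror φ) l) :
    Tractable φ w ∨ HasGoodLeft (mirror φ) w⁻¹ := by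
  have ht := h.isR
  have hlet : ∀ a, Gen cs a → a ∈ φ.dom → a = φ 1 ∨ a = t ∨ IsC φ a := by
    intro a ha had
    rcases letter_cases ha had with h1 | h1 | h1 | h1
    · exact Or.inl h1
    · exact Or.inr (Or.inr h1)
    · exact Or.inr (Or.inl (Wild.unique hw.1 hD (hR a h1) h))
    · exact (h.not_mirror hw.1 hD (hL a h1)).elim
  by_cases hK : InPar cs {φ 1, t} w
  · exact Or.inl (Or.inr (Or.inl ⟨_, _, hK⟩))
  by_cases hnc : ∀ c, IsC φ c → c * t ≠ t * c → c * t ∉ φ.dom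
  · exact Or.inr (hasGoodLeft_mirror_of_wild hw hlet hnc hK)
  push Not at hnc
  obtain ⟨c, hc, hct, hmem⟩ := hnc
  obtain ⟨c', X, m, d, z, F⟩ := exists_wildFactor hw hD ht hlet hc hct hmem
  obtain ⟨p, k, b, x, D⟩ := h
  exact Or.inl (Or.inr (Or.inr (F.hasGoodLeft D (hD _ D.up.1))))

theorem mirror_mirror (φ : BSM cs) : mirror (mirror φ) = φ := by
  cases φ
  simp only [mirror, inv_inv, Set.ofPred_mem_eq, Set.mem_ofPred_eq]

theorem tractable_of_top (hw : Down φ w) (hD : ∀ u ∈ φ.dom, u ≼ w) :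
    Tractable φ w ∨ Tractable (mirror φ) w⁻¹ := by
  have hw' : Down (mirror φ) w⁻¹ := down_mirror.2 (by rwa [inv_inv])
  have hD' : ∀ u ∈ (mirror φ).dom, u ≼ w⁻¹ := by
    intro u hu
    have := ble_inv (hD _ (mem_mirror.1 hu))
    rwa [inv_inv] at this
  by_cases hR : ∀ r, IsR φ r → Wild φ r
  swap
  · push Not at hR
    obtain ⟨r, hr, hrw⟩ := hR
    exact Or.inl (Or.inr (Or.inr (hasGoodLeft_of_not_wild hw hD hr hrw)))
  by_cases hL : ∀ l, IsL φ l → Wild (mirror φ) l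
  swap
  · push Not at hL
    obtain ⟨l, hl, hlw⟩ := hL
    exact Or.inr (Or.inr (Or.inr (hasGoodLeft_of_not_wild hw' hD' (isR_mirror.2 hl) hlw)))
  by_cases h : ∃ t, IsR φ t
  · obtain ⟨t, ht⟩ := h
    exact (tractable_of_wild hw hD (hR t ht) hR hL).imp_right fun h => Or.inr (Or.inr h)
  by_cases h' : ∃ l, IsL φ l
  · obtain ⟨l, hl⟩ := h'
    have h1 := tractable_of_wild hw' hD' (hL l hl) (fun r hr => hL r (isR_mirror.1 hr))
      (fun r hr => by rw [mirror_mirror]; exact hR r (isL_mirror.1 hr))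
    rw [mirror_mirror, inv_inv] at h1
    exact h1.symm.imp_left fun h => Or.inr (Or.inr h)
  · push Not at h h'
    refine Or.inl (Or.inl ⟨φ 1, gen_map_one (one_mem hw.1), fun u hu hup => ?_⟩)
    exact map_eq_mul_right hw.1 (fun l hl => absurd hl (h' l))
      (fun t p k b x D => absurd D.isR (h t)) hup hu

theorem tractable_or_mirror (φ : BSM cs) (w : W) (hw : Down φ w) :
    Tractable φ w ∨ Tractable (mirror φ) w⁻¹ := by
  have h := tractable_of_top (φ := restrict φ w hw) (w := w) ⟨ble_refl w, hw.2⟩ fun u hu => hu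
  refine h.imp ?_ ?_
  · rintro (⟨s, hs, h⟩ | h | h)
    · exact Or.inl ⟨s, hs, fun u hu hup => h u hu ((up_restrict hw).2 ⟨hu, hup⟩)⟩
    · exact Or.inr (Or.inl h)
    · exact Or.inr (Or.inr h)
  · rintro (⟨s, hs, h⟩ | h | h)
    · refine Or.inl ⟨s, hs, fun u hu hup => h u hu ?_⟩
      rw [up_mirror, up_restrict]
      exact ⟨by rwa [← ble_inv_iff, inv_inv], up_mirror.1 hup⟩
    · exact Or.inr (Or.inl h)
    · exact Or.inr (Or.inr h)

end Main

end SpecialMatching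

/-- the descent formulas for `R`-polynomials with respect to any special
matching `φ` of a Bruhat order ideal: if `x ⋖ φ(x)` and `y ⋖ φ(y)` then
`R_{φ(x),φ(y)} = R_{x,y}` and `R_{x,φ(y)} = (q-1) R_{x,y} + q R_{φ(x),y}`. -/
theorem stmt18 {B : Type*} {W : Type*} [Group W] {M : CoxeterMatrix B}
    (cs : CoxeterSystem M W)
    (R : W → W → Polynomial ℤ) (hR : RAxioms cs R)
    (φ : BSM cs) (x y : W) (hx : x ∈ φ.dom) (hy : y ∈ φ.dom)
    (hcx : bCov cs x (φ.toFun x)) (hcy : bCov cs y (φ.toFun y)) :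
    R (φ.toFun x) (φ.toFun y) = R x y ∧
      R x (φ.toFun y) =
        (Polynomial.X - 1) * R x y + Polynomial.X * R (φ.toFun x) y := by
  have hux := SpecialMatching.up_iff.2 ⟨hx, hcx⟩
  have huy := SpecialMatching.up_iff.2 ⟨hy, hcy⟩
  have h := SpecialMatching.RRec.of_tractable SpecialMatching.tractable_or_mirror hR huy.down x hux
  rwa [φ.invol _ hy] at h
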